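/- Let $X$ be a smooth projective (integral) surface over an algebraically closed field $k$ with $p_g(X)=\dim H^0(X,\Omega^2_X)=0$ and $q(X)=\dim H^1(X,\mathcal O_X)=0$. For a field extension $K/k$ write $X_K=X\times_k K$ and let $\mathrm{CH}^2(X_K)_0\subset\mathrm{CH}^2(X_K)$ be the subgroup of classes of degree zero. An integral curve $C\subset X$ with generic point $\eta_C$ is called a constant cycle curve of order $n$ if $n$ is the minimal positive integer such that $n\cdot[\eta_C]$ lies in the image of the base change map $\mathrm{CH}^2(X)\to\mathrm{CH}^2(X\times_k k(\eta_C))$, where $\eta_C$ is viewed as a closed point of $X\times_k k(\eta_C)$; an arbitrary curve on $X$ is a constant cycle curve of order at most $n$ if each of its integral components is a constant cycle curve of some order $\le n$. Assume that $\mathrm{CH}^2(X_K)_0=0$ for all algebraically closed field extensions $K/k$. Then there exists a positive integer $n$ such that every curve on $X$ is a constant cycle curve of order at most $n$. -/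

import Mathlib

open AlgebraicGeometry CategoryTheory CategoryTheory.Limits Order

universe u

noncomputable section

namespace SurfaceCycles

/-! ### Projective schemes over a field -/

attribute [local instance] MvPolynomial.gradedAlgebra in
/-- Projective space `ℙⁿ` over `k`, as `Proj k[x₀, …, xₙ]`. -/
def projectiveSpace (n : ℕ) (k : Type u) [Field k] : Scheme.{u} :=
  Proj (MvPolynomial.homogeneousSubmodule (Fin (n + 1)) k)

attribute [local instance] MvPolynomial.gradedAlgebra in
/-- The structure morphism `ℙⁿ ⟶ Spec k`. -/
def projectiveSpaceToSpec (n : ℕ) (k : Type u) [Field k] :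
    projectiveSpace n k ⟶ Spec (.of k) :=
  Proj.toSpecZero (MvPolynomial.homogeneousSubmodule (Fin (n + 1)) k) ≫
    Spec.map (CommRingCat.ofHom
      (algebraMap k (MvPolynomial.homogeneousSubmodule (Fin (n + 1)) k 0)))

/-- `X` is projective over `k`: it is a closed subscheme of some projective space over `k`. -/
def IsProjective {k : Type u} [Field k] {X : Scheme.{u}} (π : X ⟶ Spec (.of k)) : Prop :=
  ∃ (n : ℕ) (i : X ⟶ projectiveSpace n k), IsClosedImmersion i ∧ i ≫ projectiveSpaceToSpec n k = π

/-- A smooth projective surface over `k` (integral, as varieties are). -/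
structure IsSmoothProjectiveSurface {k : Type u} [Field k] {X : Scheme.{u}}
    (π : X ⟶ Spec (.of k)) : Prop where
  isIntegral : IsIntegral X
  smooth : SmoothOfRelativeDimension 2 π
  projective : IsProjective π

/-! ### Global two-forms and the cohomology of the structure sheaf -/

/-- For a tower `R → A → B` of rings, the map `⋀²_A Ω_{A/R} → ⋀²_B Ω_{B/R}`
with `da ∧ da' ↦ da ∧ da'`. -/
def twoFormMap (R A B : Type u) [CommRing R] [CommRing A] [CommRing B] [Algebra R A] [Algebra R B]
    [Algebra A B] [IsScalarTower R A B] : ⋀[A]^2 (Ω[A⁄R]) →ₗ[A] ⋀[B]^2 (Ω[B⁄R]) :=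
  exteriorPower.alternatingMapLinearEquiv
    { toMultilinearMap :=
        ((exteriorPower.ιMulti B 2 (M := Ω[B⁄R])).toMultilinearMap.restrictScalars
          A).compLinearMap fun _ => KaehlerDifferential.map R R A B
      map_eq_zero_of_eq' := fun v i j h hij =>
        (exteriorPower.ιMulti B 2).map_eq_zero_of_eq
          (fun l => KaehlerDifferential.map R R A B (v l)) (by simp only [h]) hij }

section TwoForms

variable {k : Type u} [Field k] {X : Scheme.{u}} (π : X ⟶ Spec (.of k))

/-- The `k`-algebra structure on the sections over `U` of a `k`-scheme. -/
abbrev sectionAlgebra (U : X.Opens) : Algebra k Γ(X, U) :=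
  ((Scheme.ΓSpecIso (.of k)).inv ≫ π.appTop ≫
    X.presheaf.map (homOfLE (le_top : U ≤ ⊤)).op).hom.toAlgebra

/-- `⋀² Ω_{Γ(X, U)/k}`; for `U` affine these are the sections of `Ω²_{X/k}` over `U`. -/
abbrev TwoForm (U : X.Opens) : Type u :=
  letI := sectionAlgebra π U
  ⋀[Γ(X, U)]^2 (Ω[Γ(X, U)⁄k])

/-- Restriction of two-forms from `V` to `U ≤ V`. -/
def twoFormRestrict {U V : X.Opens} (h : U ≤ V) : TwoForm π V →+ TwoForm π U :=
  letI := sectionAlgebra π U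
  letI := sectionAlgebra π V
  letI : Algebra Γ(X, V) Γ(X, U) := (X.presheaf.map (homOfLE h).op).hom.toAlgebra
  haveI : IsScalarTower k Γ(X, V) Γ(X, U) := .of_algebraMap_eq' <| by
    rw [RingHom.algebraMap_toAlgebra, RingHom.algebraMap_toAlgebra, RingHom.algebraMap_toAlgebra,
      ← CommRingCat.hom_comp, Category.assoc, Category.assoc, ← Functor.map_comp]
    rfl
  (twoFormMap k Γ(X, V) Γ(X, U)).toAddMonoidHom

/-- `H⁰(X, Ω²_{X/k})`: compatible families of two-forms on the affine open subsets of `X`. -/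
def globalTwoForms : AddSubgroup (∀ U : X.affineOpens, TwoForm π U.1) where
  carrier := {ω | ∀ (U V : X.affineOpens) (h : U.1 ≤ V.1), twoFormRestrict π h (ω V) = ω U}
  zero_mem' _ _ _ := map_zero _
  add_mem' hω hη U V h := by
    rw [Pi.add_apply, Pi.add_apply, map_add, hω U V h, hη U V h]
  neg_mem' hω U V h := by
    rw [Pi.neg_apply, Pi.neg_apply, map_neg, hω U V h]

/-- `p_g(X) = dim H⁰(X, Ω²_{X/k})` is zero. -/
def GeometricGenusEqZero : Prop := ∀ ω ∈ globalTwoForms π, ω = 0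

end TwoForms

/-- The structure sheaf of `X` as a sheaf of abelian groups. -/
def structureSheafAb (X : Scheme.{u}) :
    Sheaf (Opens.grothendieckTopology X) AddCommGrpCat.{u} :=
  (sheafCompose _ (forget₂ CommRingCat.{u} RingCat.{u} ⋙
    forget₂ RingCat.{u} AddCommGrpCat.{u})).obj X.sheaf

/-- `q(X) = dim H¹(X, 𝒪_X)` is zero. -/
def IrregularityEqZero (X : Scheme.{u}) : Prop := Subsingleton ((structureSheafAb X).H 1)

/-! ### Chow groups

Integral closed subschemes are identified with their generic points, and the codimension of the
closure of `y` is `coheight y`, the Krull dimension of the local ring at `y`. The definitions are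
meant for schemes of finite type over a field that are integral (in particular noetherian,
catenary and equidimensional). -/

/-- Algebraic cycles on `Y`, of all codimensions. -/
abbrev Cycles (Y : Scheme.{u}) : Type u := Y →₀ ℤ

/-- `Z^p(Y)`: the cycles all of whose components have codimension `p`. -/
def codimCycles (p : ℕ) (Y : Scheme.{u}) : AddSubgroup (Cycles Y) where
  carrier := {α | ∀ y, α y ≠ 0 → coheight y = p}
  zero_mem' y h := (h rfl).elim
  add_mem' {α β} hα hβ y h := by
    by_cases h0 : α y = 0
    · exact hβ y fun h1 => h (by rw [Finsupp.add_apply, h0, h1, add_zero])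
    · exact hα y h0
  neg_mem' {α} hα y h := hα y fun h0 => h (by rw [Finsupp.neg_apply, h0, neg_zero])

/-- `α` is the push-forward to `Y` of the divisor of the rational function `φ` on the integral
closed subscheme `i : W ⟶ Y`. -/
def IsDivisorOf {Y W : Scheme.{u}} (i : W ⟶ Y) [IsIntegral W] [IsLocallyNoetherian W]
    (φ : W.functionField) (α : Cycles Y) : Prop :=
  (∀ z : W, α (i z) = Scheme.ord φ z) ∧ ∀ y ∉ Set.range i, α y = 0

/-- The cycles rationally equivalent to zero: the subgroup generated by the divisors of the
nonzero rational functions on the integral closed subschemes of `Y`. -/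
def ratTrivial (Y : Scheme.{u}) : AddSubgroup (Cycles Y) :=
  AddSubgroup.closure {α | ∃ (W : Scheme.{u}) (i : W ⟶ Y) (_ : IsClosedImmersion i)
    (_ : IsIntegral W) (_ : IsLocallyNoetherian W) (φ : W.functionField),
    φ ≠ 0 ∧ IsDivisorOf i φ α}

/-- The total Chow group `CH^*(Y) = ⨁ CH^p(Y)`. -/
abbrev Chow (Y : Scheme.{u}) : Type u := Cycles Y ⧸ ratTrivial Y

/-- The class of a cycle. -/
def cycleClass (Y : Scheme.{u}) : Cycles Y →+ Chow Y := QuotientAddGroup.mk' (ratTrivial Y)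

/-- The class `[y]` of a point (that is, of its closure). -/
def pointClass {Y : Scheme.{u}} (y : Y) : Chow Y := cycleClass Y (Finsupp.single y 1)

/-- The degree `∑ nᵢ [κ(yᵢ) : K]` of a zero-cycle on a scheme over the spectrum of a field `K`. -/
def cycleDegree {Y S : Scheme.{u}} (ρ : Y ⟶ S) : Cycles Y →+ ℤ :=
  Finsupp.liftAddHom fun y => AddMonoidHom.mulRight (ρ.residueDegree y : ℤ)

/-- For a surface `Y` over a field: the subgroup `CH²(Y)₀` of the degree-zero classes in
`CH²(Y)`. -/
def chowTwoDegreeZero {Y S : Scheme.{u}} (ρ : Y ⟶ S) : AddSubgroup (Chow Y) :=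
  (codimCycles 2 Y ⊓ (cycleDegree ρ).ker).map (cycleClass Y)

/-- For flat `g : Y ⟶ X`, the multiplicity of `y` in the pull-back of the point `g y`:
the length of the local ring at `y` of the fibre of `g`. It is infinite, and then counts as `0`,
if and only if `y` is not a generic point of the fibre. -/
def pullbackMultiplicity {X Y : Scheme.{u}} (g : Y ⟶ X) (y : Y) : ℕ :=
  (Module.length (Y.presheaf.stalk y) (Y.presheaf.stalk y ⧸
    (IsLocalRing.maximalIdeal (X.presheaf.stalk (g y))).map (g.stalkMap y).hom)).toNat

/-- The cycle `β` is the flat pull-back `g^* α`. -/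
def IsFlatPullback {X Y : Scheme.{u}} (g : Y ⟶ X) (α : Cycles X) (β : Cycles Y) : Prop :=
  ∀ y : Y, β y = pullbackMultiplicity g y * α (g y)

/-- The image of `g^* : CH^p(X) → CH^p(Y)` for flat `g`, i.e. the set of the classes of the
pull-backs of codimension `p` cycles on `X`. -/
def pullbackImage (p : ℕ) {X Y : Scheme.{u}} (g : Y ⟶ X) : Set (Chow Y) :=
  {c | ∃ α ∈ codimCycles p X, ∃ β : Cycles Y, IsFlatPullback g α β ∧ cycleClass Y β = c}

/-! ### Constant cycle curves -/

section Curves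

variable {S X : Scheme.{u}} (π : X ⟶ S)

/-- `j : D ⟶ X` is (the inclusion of) a curve on the surface `X`, possibly reducible or
non-reduced: a closed subscheme all of whose irreducible components are curves. -/
structure IsCurve {D : Scheme.{u}} (j : D ⟶ X) : Prop where
  isClosedImmersion : IsClosedImmersion j
  codim_one : ∀ η : D, closure {η} ∈ irreducibleComponents D → coheight (j η) = 1

variable {C : Scheme.{u}} [IrreducibleSpace C] (i : C ⟶ X)

/-- The canonical morphism `Spec k(η_C) ⟶ C ⟶ X`. -/
def genericMap : Spec C.functionField ⟶ X := C.fromSpecStalk (genericPoint C) ≫ i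

/-- `X ×ₖ k(η_C)`. -/
def genericBaseChange : Scheme.{u} := pullback π (genericMap i ≫ π)

/-- The projection `X ×ₖ k(η_C) ⟶ X`. -/
def genericBaseChangeFst : genericBaseChange π i ⟶ X := pullback.fst π (genericMap i ≫ π)

/-- The section `Spec k(η_C) ⟶ X ×ₖ k(η_C)` given by `η_C`. -/
def genericSection : Spec C.functionField ⟶ genericBaseChange π i :=
  pullback.lift (genericMap i) (𝟙 _) (Category.id_comp _).symm

/-- `η_C`, viewed as a closed point of `X ×ₖ k(η_C)`. -/
def genericPointOfCurve : genericBaseChange π i :=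
  genericSection π i (IsLocalRing.closedPoint C.functionField)

/-- The integral curve `C` is a constant cycle curve of order `n`: `n` is the minimal positive
integer with `n · [η_C]` in the image of `CH²(X) → CH²(X ×ₖ k(η_C))`. -/
def IsConstantCycleOfOrder (n : ℕ) : Prop :=
  IsLeast {m : ℕ | 0 < m ∧
    m • pointClass (genericPointOfCurve π i) ∈ pullbackImage 2 (genericBaseChangeFst π i)} n

/-- The curve `j : D ⟶ X` is a constant cycle curve of order at most `n`: every integral component
(irreducible component with its reduced structure) is a constant cycle curve of some
order `m ≤ n`. -/
def IsConstantCycleOfOrderLE {D : Scheme.{u}} (j : D ⟶ X) (n : ℕ) : Prop :=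
  ∀ (C : Scheme.{u}) [IsIntegral C] (c : C ⟶ D), IsClosedImmersion c →
    Set.range c ∈ irreducibleComponents D → ∃ m ≤ n, IsConstantCycleOfOrder π (c ≫ j) m

end Curves

end SurfaceCycles

end

open AlgebraicGeometry CategoryTheory CategoryTheory.Limits Order Polynomial
open scoped TensorProduct

noncomputable section

namespace SurfaceCycles

section

theorem length_coker_comp {R M N P : Type*} [CommRing R] [AddCommGroup M] [AddCommGroup N]
    [AddCommGroup P] [Module R M] [Module R N] [Module R P] (f : P →ₗ[R] N) (g : N →ₗ[R] M)
    (hg : Function.Injective g) :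
    Module.length R (M ⧸ LinearMap.range (g ∘ₗ f)) =
      Module.length R (N ⧸ LinearMap.range f) + Module.length R (M ⧸ LinearMap.range g) := by
  have h1 : LinearMap.range f ≤ (LinearMap.range (g ∘ₗ f)).comap g := by
    rintro _ ⟨x, rfl⟩; exact ⟨x, rfl⟩
  have h2 : LinearMap.range (g ∘ₗ f) ≤ LinearMap.range g := LinearMap.range_comp_le_range f g
  refine Module.length_eq_add_of_exact (Submodule.mapQ _ _ g h1) (Submodule.factor h2) ?_
    (Submodule.factor_surjective h2) ?_
  · rw [← LinearMap.ker_eq_bot, LinearMap.ker_eq_bot']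
    intro x
    induction x using Submodule.Quotient.induction_on with | _ x
    intro hx
    rw [Submodule.mapQ_apply, Submodule.Quotient.mk_eq_zero] at hx
    obtain ⟨y, hy⟩ := hx
    exact (Submodule.Quotient.mk_eq_zero _).mpr ⟨y, hg hy⟩
  · intro x
    induction x using Submodule.Quotient.induction_on with | _ x
    constructor
    · intro hx
      have : x ∈ LinearMap.range g := (Submodule.Quotient.mk_eq_zero _).mp hx
      obtain ⟨y, rfl⟩ := this
      exact ⟨Submodule.Quotient.mk y, rfl⟩
    · rintro ⟨y, hy⟩
      induction y using Submodule.Quotient.induction_on with | _ y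
      rw [← hy]
      exact (Submodule.Quotient.mk_eq_zero _).mpr ⟨y, rfl⟩

theorem length_coker_eq_of_commute {R M N : Type*} [CommRing R] [AddCommGroup M] [AddCommGroup N]
    [Module R M] [Module R N] (f : N →ₗ[R] M) (φ : M →ₗ[R] M) (ψ : N →ₗ[R] N)
    (hf : Function.Injective f) (hφ : Function.Injective φ)
    (hfin : Module.length R (M ⧸ LinearMap.range f) ≠ ⊤) (h : f ∘ₗ ψ = φ ∘ₗ f) :
    Module.length R (M ⧸ LinearMap.range φ) = Module.length R (N ⧸ LinearMap.range ψ) := by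
  have h1 := length_coker_comp ψ f hf
  have h2 := length_coker_comp f φ hφ
  rw [h, h2, add_comm] at h1
  exact (WithTop.add_right_inj hfin).mp h1

theorem length_ne_top_of_torsion {O M : Type*} [CommRing O] [IsNoetherianRing O] [IsDomain O]
    [Ring.KrullDimLE 1 O] [AddCommGroup M] [Module O M] [Module.Finite O M] {c : O} (hc : c ≠ 0)
    (h : ∀ m : M, c • m = 0) : Module.length O M ≠ ⊤ := by
  have hfl := isFiniteLength_quotient_span_singleton O (mem_nonZeroDivisors_of_ne_zero hc)
  obtain ⟨h1, h2⟩ := isFiniteLength_iff_isNoetherian_isArtinian.mp hfl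
  obtain ⟨n, f, hf⟩ := Module.Finite.exists_fin' O M
  let g : (Fin n → O ⧸ Ideal.span {c}) →ₗ[O] M :=
    ∑ i, (Submodule.liftQ (Ideal.span {c}) (LinearMap.toSpanSingleton O M (f (Pi.single i 1))) (by
      rw [Ideal.span, Submodule.span_le]
      rintro _ rfl
      simp [h])) ∘ₗ LinearMap.proj i
  have hg : Function.Surjective g := by
    intro m
    obtain ⟨v, rfl⟩ := hf m
    refine ⟨fun i => Ideal.Quotient.mk _ (v i), ?_⟩
    conv_rhs => rw [pi_eq_sum_univ' v]
    simp only [g, LinearMap.sum_apply, LinearMap.comp_apply, LinearMap.proj_apply, map_sum]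
    refine Finset.sum_congr rfl fun i _ => ?_
    rw [← Ideal.Quotient.mk_eq_mk]
    erw [Submodule.liftQ_apply]
    rw [LinearMap.toSpanSingleton_apply, ← map_smul]
  exact ne_top_of_le_ne_top Module.length_ne_top (Module.length_le_of_surjective g hg)

theorem length_coker_ne_top {O M N : Type*} [CommRing O] [IsNoetherianRing O] [IsDomain O]
    [Ring.KrullDimLE 1 O] [AddCommGroup M] [Module O M] [Module.Finite O M] [AddCommGroup N]
    [Module O N] (f : N →ₗ[O] M) (h : ∀ m : M, ∃ c : O, c ≠ 0 ∧ c • m ∈ LinearMap.range f) :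
    Module.length O (M ⧸ LinearMap.range f) ≠ ⊤ := by
  obtain ⟨S, hS⟩ := (Module.Finite.fg_top : (⊤ : Submodule O M).FG)
  choose c hc hcm using h
  refine length_ne_top_of_torsion (c := ∏ m ∈ S, c m) (Finset.prod_ne_zero_iff.mpr fun m _ => hc m)
    fun m => ?_
  induction m using Submodule.Quotient.induction_on with | _ m
  rw [← Submodule.Quotient.mk_smul, Submodule.Quotient.mk_eq_zero]
  have hm : m ∈ Submodule.span O (S : Set M) := hS ▸ Submodule.mem_top
  induction hm using Submodule.span_induction with
  | mem x hx =>
    obtain ⟨t, ht⟩ := Finset.dvd_prod_of_mem c hx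
    rw [ht, mul_comm, mul_smul]
    exact Submodule.smul_mem _ _ (hcm x)
  | zero => simp
  | add x y _ _ hx hy => rw [smul_add]; exact add_mem hx hy
  | smul a x _ hx => rw [smul_comm]; exact Submodule.smul_mem _ _ hx

theorem length_coker_pi {R A : Type*} [CommRing R] [AddCommGroup A] [Module R A] (r : ℕ)
    (φ : A →ₗ[R] A) :
    Module.length R ((Fin r → A) ⧸ LinearMap.range (φ.compLeft (Fin r))) =
      r * Module.length R (A ⧸ LinearMap.range φ) := by
  have e : LinearMap.range (φ.compLeft (Fin r)) =
      Submodule.pi Set.univ fun _ => LinearMap.range φ := by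
    ext v
    constructor
    · rintro ⟨w, rfl⟩ i _
      exact ⟨w i, rfl⟩
    · intro h
      choose w hw using fun i => h i (Set.mem_univ i)
      exact ⟨w, funext hw⟩
  rw [e, (Submodule.quotientPi fun _ : Fin r => LinearMap.range φ).length_eq, Module.length_pi]
  simp

theorem length_adjoinRoot_quot_root {O : Type*} [CommRing O] (P : O[X]) :
    Module.length O (AdjoinRoot P ⧸ LinearMap.range (LinearMap.mulLeft O (AdjoinRoot.root P))) =
      Ring.ord O (P.coeff 0) := by
  have h0 : P.eval₂ (Ideal.Quotient.mk (Ideal.span {P.coeff 0})) 0 = 0 := by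
    rw [eval₂_at_zero, Ideal.Quotient.eq_zero_iff_mem]
    exact Ideal.mem_span_singleton_self _
  let g : AdjoinRoot P →ₗ[O] O ⧸ Ideal.span {P.coeff 0} :=
    (AdjoinRoot.liftAlgHom P (Algebra.ofId O (O ⧸ Ideal.span {P.coeff 0})) 0 h0).toLinearMap
  have hgm (q : O[X]) : g (AdjoinRoot.mk P q) = Ideal.Quotient.mk _ (q.coeff 0) := by
    have : g (AdjoinRoot.mk P q) = q.eval₂ (Ideal.Quotient.mk (Ideal.span {P.coeff 0})) 0 :=
      AdjoinRoot.lift_mk (f := P) h0 q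
    rw [this, eval₂_at_zero]
  have hg : Function.Surjective g := fun x => by
    obtain ⟨x, rfl⟩ := Ideal.Quotient.mk_surjective x
    exact ⟨AdjoinRoot.mk P (C x), by rw [hgm, coeff_C_zero]⟩
  have hk : LinearMap.ker g = LinearMap.range (LinearMap.mulLeft O (AdjoinRoot.root P)) := by
    ext x
    induction x using AdjoinRoot.induction_on with | _ q
    rw [LinearMap.mem_ker, hgm, Ideal.Quotient.eq_zero_iff_mem, Ideal.mem_span_singleton]
    constructor
    · rintro ⟨c, hc⟩
      obtain ⟨q', hq'⟩ : X ∣ q - C c * P := by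
        rw [X_dvd_iff]; simp [hc, mul_comm]
      refine ⟨AdjoinRoot.mk P q', ?_⟩
      rw [LinearMap.mulLeft_apply, ← AdjoinRoot.mk_X, ← map_mul, ← hq', map_sub, map_mul,
        AdjoinRoot.mk_self, mul_zero, sub_zero]
    · rintro ⟨y, hy⟩
      induction y using AdjoinRoot.induction_on with | _ y
      rw [LinearMap.mulLeft_apply, ← AdjoinRoot.mk_X, ← map_mul, AdjoinRoot.mk_eq_mk] at hy
      obtain ⟨t, ht⟩ := hy
      have := congrArg (coeff · 0) ht
      simp only [coeff_sub, mul_coeff_zero, coeff_X_zero, zero_mul, zero_sub] at this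
      exact ⟨-t.coeff 0, by linear_combination -this⟩
  rw [Ring.ord, ← (g.quotKerEquivOfSurjective hg).length_eq, hk]

section NormOrd

variable {O F E : Type*} [CommRing O] [IsDomain O] [Field F] [Field E]
  [Algebra O F] [IsFractionRing O F] [Algebra F E] [Algebra O E]
  [IsScalarTower O F E]

theorem exists_smul_minpoly_descends [FiniteDimensional F E] (a : E) : ∃ c : O, c ≠ 0 ∧
    ∃ P : O[X], P.Monic ∧ P.map (algebraMap O F) = minpoly F (c • a) := by
  classical
  obtain ⟨⟨c, hc⟩, hcp⟩ := IsLocalization.exist_integer_multiples_of_finset (nonZeroDivisors O)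
    (Finset.image (minpoly F a).coeff (Finset.range (minpoly F a).natDegree))
  have hc0 : c ≠ 0 := nonZeroDivisors.ne_zero hc
  have hcF : algebraMap O F c ≠ 0 := by simpa using hc0
  have ha : IsIntegral F a := Algebra.IsIntegral.isIntegral a
  have e : minpoly F (c • a) = (minpoly F a).scaleRoots (algebraMap O F c) := by
    rw [← algebraMap_smul F c a, IsIntegrallyClosed.minpoly_smul hcF ha]
  have hm : (minpoly F (c • a)).Monic := minpoly.monic (Algebra.IsIntegral.isIntegral _)
  have hl : minpoly F (c • a) ∈ lifts (algebraMap O F) := by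
    rw [lifts_iff_coeff_lifts]
    intro n
    rcases lt_trichotomy n (minpoly F a).natDegree with h | h | h
    · obtain ⟨x, hx⟩ := hcp _ (Finset.mem_image_of_mem _ (Finset.mem_range.mpr h))
      rw [e, coeff_scaleRoots, ← Nat.sub_add_cancel (Nat.sub_pos_of_lt h)]
      refine ⟨x * c ^ ((minpoly F a).natDegree - n - 1), ?_⟩
      rw [map_mul, hx, Algebra.smul_def, map_pow]
      ring
    · refine ⟨1, ?_⟩
      rw [e, coeff_scaleRoots, h, Nat.sub_self, pow_zero, mul_one, map_one]
      exact (minpoly.monic ha).coeff_natDegree.symm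
    · refine ⟨0, ?_⟩
      rw [e, coeff_scaleRoots, coeff_eq_zero_of_natDegree_lt h, zero_mul, map_zero]
  obtain ⟨P, h1, -, h2⟩ := lifts_and_natDegree_eq_and_monic hl hm
  exact ⟨c, hc0, P, h2, h1⟩

theorem exists_smul_eq_sum_aeval [FiniteDimensional F E] {r : ℕ} (α : E)
    (b : Module.Basis (Fin r) (IntermediateField.adjoin F {α}) E) (x : E) :
    ∃ c : O, c ≠ 0 ∧ ∃ q : Fin r → O[X], c • x = ∑ i, aeval α (q i) * b i := by
  have h1 (i : Fin r) : ∃ c : O, c ≠ 0 ∧ ∃ q : O[X], c • ((b.repr x i : _) : E) = aeval α q := by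
    have h2 := (b.repr x i).2
    rw [← IntermediateField.mem_toSubalgebra, IntermediateField.adjoin_simple_toSubalgebra_of_isAlgebraic
      (Algebra.IsAlgebraic.isAlgebraic α), Algebra.adjoin_singleton_eq_range_aeval] at h2
    obtain ⟨p, hp⟩ := h2
    obtain ⟨⟨c, hc⟩, hcp⟩ := IsLocalization.integerNormalization_map_to_map (nonZeroDivisors O) p
    refine ⟨c, nonZeroDivisors.ne_zero hc, IsLocalization.integerNormalization (nonZeroDivisors O) p, ?_⟩
    rw [← aeval_map_algebraMap F, hcp, ← hp]
    simp only [AlgHom.toRingHom_eq_coe, RingHom.coe_coe]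
    rw [← algebraMap_smul F c p, map_smul, algebraMap_smul]
  choose c hc q hq using h1
  refine ⟨∏ i, c i, Finset.prod_ne_zero_iff.mpr fun i _ => hc i,
    fun i => C (∏ j ∈ Finset.univ.erase i, c j) * q i, ?_⟩
  conv_lhs => rw [← b.sum_repr x, Finset.smul_sum]
  refine Finset.sum_congr rfl fun i _ => ?_
  rw [map_mul, ← hq, ← Finset.mul_prod_erase _ _ (Finset.mem_univ i), aeval_C,
    IntermediateField.smul_def]
  simp only [Algebra.smul_def, smul_eq_mul, map_mul, Algebra.algebraMap_self, RingHom.id_apply]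
  ring

variable [IsNoetherianRing O] [Ring.KrullDimLE 1 O]

theorem length_quot_of_minpoly [FiniteDimensional F E] (Λ : Subalgebra O E) [Module.Finite O Λ]
    (hΛ : ∀ x : E, ∃ c : O, c ≠ 0 ∧ c • x ∈ Λ) (α : Λ) (hα : α ≠ 0) (P : O[X]) (hP : P.Monic)
    (hP' : P.map (algebraMap O F) = minpoly F (α : E)) :
    Module.length O (Λ ⧸ LinearMap.range (LinearMap.mulLeft O α)) =
      Module.finrank (IntermediateField.adjoin F {(α : E)}) E * Ring.ord O (P.coeff 0) := by
  set L := IntermediateField.adjoin F {(α : E)}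
  let b := Module.finBasis L E
  choose c hc hcb using fun i => hΛ (b i)
  have hα0 : aeval (α : E) P = 0 := by
    have := minpoly.aeval F (α : E)
    rwa [← hP', aeval_map_algebraMap] at this
  have hαΛ : eval₂ (Algebra.ofId O Λ).toRingHom α P = 0 := by
    apply Subtype.val_injective
    have : ((aeval α P : Λ) : E) = aeval (α : E) P := (aeval_algHom_apply Λ.val α P).symm
    rw [ZeroMemClass.coe_zero, ← hα0, ← this]; rfl
  let g : AdjoinRoot P →ₐ[O] Λ := AdjoinRoot.liftAlgHom P (Algebra.ofId O Λ) α hαΛ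
  have hΛa (q : O[X]) : ((aeval α q : Λ) : E) = aeval (α : E) q :=
    (aeval_algHom_apply Λ.val α q).symm
  have hgm (q : O[X]) : g (AdjoinRoot.mk P q) = aeval α q :=
    AdjoinRoot.lift_mk (f := P) hαΛ q
  have hgr : g (AdjoinRoot.root P) = α := by rw [← AdjoinRoot.mk_X, hgm, aeval_X]
  have hgL (x : AdjoinRoot P) : (g x : E) ∈ L := by
    induction x using AdjoinRoot.induction_on with | _ q
    rw [hgm, hΛa, ← aeval_map_algebraMap F]
    have := aeval_algHom_apply L.val (IntermediateField.AdjoinSimple.gen F (α : E))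
      (q.map (algebraMap O F))
    rw [IntermediateField.coe_val, IntermediateField.AdjoinSimple.coe_gen] at this
    rw [this]
    exact Subtype.property _
  have hginj : Function.Injective g := by
    rw [injective_iff_map_eq_zero]
    intro x hx
    induction x using AdjoinRoot.induction_on with | _ q
    have h1 := congrArg Subtype.val hx
    rw [hgm, hΛa, ZeroMemClass.coe_zero, ← aeval_map_algebraMap F] at h1
    have h2 := minpoly.dvd F (α : E) h1
    rw [← hP', map_dvd_map _ (IsFractionRing.injective O F) hP] at h2
    exact AdjoinRoot.mk_eq_zero.mpr h2
  let f : (Fin (Module.finrank L E) → AdjoinRoot P) →ₗ[O] Λ :=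
    ∑ i, LinearMap.mulRight O (⟨c i • b i, hcb i⟩ : Λ) ∘ₗ g.toLinearMap ∘ₗ LinearMap.proj i
  have hf (v) : (f v : E) = ∑ i, (⟨g (v i), hgL _⟩ : L) • (c i • b i) := by
    simp only [f, LinearMap.sum_apply, AddSubmonoidClass.coe_finset_sum]
    rfl
  have hfinj : Function.Injective f := by
    rw [← LinearMap.ker_eq_bot, LinearMap.ker_eq_bot']
    intro v hv
    have := hf v
    rw [hv, ZeroMemClass.coe_zero] at this
    have h2 : ∑ i, ((⟨g (v i), hgL _⟩ : L) * algebraMap F L (algebraMap O F (c i))) • b i = 0 := by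
      rw [this]
      refine Finset.sum_congr rfl fun i _ => ?_
      rw [mul_smul, algebraMap_smul, algebraMap_smul]
    have h3 := Fintype.linearIndependent_iff.mp b.linearIndependent _ h2
    ext i
    apply hginj
    have h4 := (mul_eq_zero.mp (h3 i)).resolve_right (by simpa using hc i)
    rw [Pi.zero_apply, map_zero]
    exact Subtype.val_injective (congrArg (L.val) h4)
  have hfin : Module.length O (Λ ⧸ LinearMap.range f) ≠ ⊤ := by
    refine length_coker_ne_top f fun m => ?_
    obtain ⟨d, hd, q, hq⟩ := exists_smul_eq_sum_aeval (O := O) (α : E) b (m : E)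
    refine ⟨d * ∏ i, c i, mul_ne_zero hd (Finset.prod_ne_zero_iff.mpr fun i _ => hc i),
      fun i => AdjoinRoot.mk P (C (∏ j ∈ Finset.univ.erase i, c j) * q i), ?_⟩
    apply Subtype.val_injective
    rw [hf, mul_comm d, mul_smul]
    have : (((∏ i, c i) • d • m : Λ) : E) = (∏ i, c i) • d • (m : E) := rfl
    rw [this, hq, Finset.smul_sum]
    refine Finset.sum_congr rfl fun i _ => ?_
    rw [IntermediateField.smul_def, ← Finset.mul_prod_erase _ _ (Finset.mem_univ i)]
    simp only [hgm, map_mul, aeval_C, MulMemClass.coe_mul, Subalgebra.coe_algebraMap]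
    simp only [Algebra.smul_def, smul_eq_mul, map_mul, hΛa, Algebra.algebraMap_self,
      RingHom.id_apply]
    ring
  have key := length_coker_eq_of_commute f (LinearMap.mulLeft O α)
    ((LinearMap.mulLeft O (AdjoinRoot.root P)).compLeft (Fin (Module.finrank L E))) hfinj
    (fun x y hxy => mul_left_cancel₀ hα hxy) hfin (by
      refine LinearMap.ext fun v => ?_
      simp only [f, LinearMap.comp_apply, LinearMap.sum_apply, LinearMap.proj_apply,
        LinearMap.compLeft_apply, Function.comp_apply, LinearMap.mulLeft_apply, map_sum,
        LinearMap.mulRight_apply, AlgHom.toLinearMap_apply, map_mul, hgr, mul_assoc])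
  rw [key, length_coker_pi, length_adjoinRoot_quot_root]

theorem ordFrac_algebraMap_pow {c : O} (hc : c ≠ 0) (r n : ℕ)
    (h : (r : ℕ∞) * Ring.ord O c = n) :
    Ring.ordFrac O (algebraMap O F c ^ r) = ((Multiplicative.ofAdd (n : ℤ) : Multiplicative ℤ) :
      WithZero (Multiplicative ℤ)) := by
  obtain ⟨m, hm⟩ := ENat.ne_top_iff_exists.mp
    (Ring.ord_ne_top (mem_nonZeroDivisors_of_ne_zero hc))
  rw [map_pow, Ring.ordFrac_eq_ord O hc, Ring.ordMonoidWithZeroHom_eq_coe O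
    (mem_nonZeroDivisors_of_ne_zero hc) hm.symm]
  rw [← hm] at h
  have h' : r * m = n := by exact_mod_cast h
  rw [← WithZero.coe_pow, ← ofAdd_nsmul, ← h']
  simp

/-- The order of the norm of `a` is the length of `Λ / aΛ`, for every order `Λ` in `E`. -/
theorem ordFrac_norm_eq_length [FiniteDimensional F E] (Λ : Subalgebra O E) [Module.Finite O Λ]
    (hΛ : ∀ x : E, ∃ c : O, c ≠ 0 ∧ c • x ∈ Λ) (a : Λ) (ha : a ≠ 0) :
    ∃ n : ℕ, Module.length O (Λ ⧸ LinearMap.range (LinearMap.mulLeft O a)) = n ∧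
      Ring.ordFrac O (Algebra.norm F (a : E)) = ((Multiplicative.ofAdd (n : ℤ) : Multiplicative ℤ) :
      WithZero (Multiplicative ℤ)) := by
  have special (α : Λ) (hα : α ≠ 0) (P : O[X]) (hP : P.Monic)
      (hP' : P.map (algebraMap O F) = minpoly F (α : E)) :
      ∃ n : ℕ, Module.length O (Λ ⧸ LinearMap.range (LinearMap.mulLeft O α)) = n ∧
      Ring.ordFrac O (Algebra.norm F (α : E)) =
        ((Multiplicative.ofAdd (n : ℤ) : Multiplicative ℤ) : WithZero (Multiplicative ℤ)) := by
    have hαE : (α : E) ≠ 0 := by simpa using hα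
    have hInt : IsIntegral F (α : E) := Algebra.IsIntegral.isIntegral _
    have h0 : P.coeff 0 ≠ 0 := by
      intro h
      refine minpoly.coeff_zero_ne_zero hInt hαE ?_
      rw [← hP', coeff_map, h, map_zero]
    obtain ⟨m, hm⟩ := ENat.ne_top_iff_exists.mp
      (Ring.ord_ne_top (mem_nonZeroDivisors_of_ne_zero h0))
    have hlen := length_quot_of_minpoly Λ hΛ α hα P hP hP'
    rw [← hm] at hlen
    refine ⟨Module.finrank (IntermediateField.adjoin F {(α : E)}) E * m, by exact_mod_cast hlen, ?_⟩
    have hn : Algebra.norm F (α : E) = (algebraMap O F ((-1) ^ (minpoly F (α : E)).natDegree *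
        P.coeff 0)) ^ Module.finrank (IntermediateField.adjoin F {(α : E)}) E := by
      have h1 := Algebra.norm_norm (R := F) (S := IntermediateField.adjoin F {(α : E)})
        (A := E) (a := (α : E))
      have h2 := Algebra.norm_algebraMap (R := IntermediateField.adjoin F {(α : E)}) (S := E)
        (IntermediateField.AdjoinSimple.gen F (α : E))
      rw [IntermediateField.AdjoinSimple.algebraMap_gen] at h2
      rw [← h1, h2, map_pow]
      congr 1
      have h3 := Algebra.PowerBasis.norm_gen_eq_coeff_zero_minpoly
        (IntermediateField.adjoin.powerBasis hInt)
      rw [IntermediateField.adjoin.powerBasis_gen, IntermediateField.minpoly_gen,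
        IntermediateField.adjoin.powerBasis_dim] at h3
      rw [h3, ← hP', coeff_map, map_mul, map_pow, map_neg, map_one, hP']
    rw [hn]
    refine ordFrac_algebraMap_pow (mul_ne_zero (pow_ne_zero _ (neg_ne_zero.mpr one_ne_zero)) h0) _ _ ?_
    rw [Ring.ord_mul_of_isUnit_left (isUnit_one.neg.pow _), ← hm]
    push_cast
    rfl
  obtain ⟨c, hc, P, hP, hP'⟩ := exists_smul_minpoly_descends (O := O) (F := F) (a : E)
  have hcΛ : algebraMap O Λ c ≠ 0 := by
    intro h
    have := congrArg (algebraMap Λ E) h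
    rw [← IsScalarTower.algebraMap_apply, map_zero, IsScalarTower.algebraMap_apply O F E] at this
    simp [hc] at this
  obtain ⟨n₁, h₁, h₁'⟩ := special (c • a) (by rw [Algebra.smul_def]; exact mul_ne_zero hcΛ ha)
    P hP hP'
  obtain ⟨n₂, h₂, h₂'⟩ := special (algebraMap O Λ c) hcΛ (X - C c) (monic_X_sub_C c) (by
    have : ((algebraMap O Λ c : Λ) : E) = algebraMap F E (algebraMap O F c) := by
      rw [← IsScalarTower.algebraMap_apply]; rfl
    rw [this, minpoly.eq_X_sub_C, Polynomial.map_sub, map_X, map_C])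
  have h3 := length_coker_comp (LinearMap.mulLeft O a) (LinearMap.mulLeft O (algebraMap O Λ c))
    fun x y hxy => mul_left_cancel₀ hcΛ hxy
  rw [← LinearMap.mulLeft_mul, ← Algebra.smul_def, h₁, h₂] at h3
  have h4 : Module.length O (Λ ⧸ LinearMap.range (LinearMap.mulLeft O a)) ≠ ⊤ := by
    intro h; rw [h] at h3; simp at h3
  obtain ⟨n, hn⟩ := ENat.ne_top_iff_exists.mp h4
  refine ⟨n, hn.symm, ?_⟩
  rw [← hn] at h3
  have h5 : n₁ = n + n₂ := by exact_mod_cast h3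
  have h6 : ((c • a : Λ) : E) = ((algebraMap O Λ c : Λ) : E) * (a : E) := by
    rw [Algebra.smul_def]; rfl
  rw [h6, map_mul, map_mul, h₂', h5, Nat.cast_add, ofAdd_add, WithZero.coe_mul, mul_comm] at h₁'
  exact mul_right_cancel₀ (WithZero.coe_ne_zero) h₁'

end NormOrd

section Chart

variable {O E : Type*} [CommRing O] [Field E] [Algebra O E]

theorem isIntegral_of_isIntegral_adjoin_inv {u : E}
    (h : IsIntegral (Algebra.adjoin O {u⁻¹}) u) : IsIntegral O u := by
  by_contra hu
  have hu' : u ∉ (integralClosure O E).toSubring := hu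
  have : IsIntegrallyClosedIn (integralClosure O E).toSubring E :=
    inferInstanceAs (IsIntegrallyClosedIn (integralClosure O E) E)
  obtain ⟨V, hV, huV⟩ := Subring.exists_le_valuationSubring_of_isIntegrallyClosedIn hu'
  have huV' : u⁻¹ ∈ V := (V.mem_or_inv_mem u).resolve_left huV
  let W : Subalgebra O E := { V.toSubring with
    algebraMap_mem' := fun r => hV (isIntegral_algebraMap (R := O) (A := E) (x := r)) }
  have hle : Algebra.adjoin O {u⁻¹} ≤ W := Algebra.adjoin_le (Set.singleton_subset_iff.mpr huV')
  obtain ⟨p, hp, hp0⟩ := h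
  refine huV ?_
  have hInt : IsIntegral V u := by
    refine ⟨p.map (Subalgebra.inclusion hle).toRingHom, hp.map _, ?_⟩
    rw [eval₂_map]
    exact hp0
  obtain ⟨v, hv⟩ := IsIntegrallyClosed.isIntegral_iff.mp hInt
  rw [← hv]
  exact v.2

theorem exists_mul_pow_isIntegral {u lam : E} {s d : E} (hu : IsIntegral O u) (hu0 : u ≠ 0)
    (hlam : IsIntegral O lam) (hs : s = lam + u⁻¹)
    (hd : IsIntegral (Algebra.adjoin O {s}) d) : ∃ N : ℕ, IsIntegral O (u ^ N * d) := by
  have mono (x : E) (m n : ℕ) (hmn : m ≤ n) (h : IsIntegral O (u ^ m * x)) :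
      IsIntegral O (u ^ n * x) := by
    rw [← Nat.sub_add_cancel hmn, pow_add, mul_assoc]
    exact (hu.pow _).mul h
  have h1 (x : E) (hx : x ∈ Algebra.adjoin O {s}) : ∃ N : ℕ, IsIntegral O (u ^ N * x) := by
    induction hx using Algebra.adjoin_induction with
    | mem x hx =>
      rw [Set.mem_singleton_iff] at hx
      refine ⟨1, ?_⟩
      rw [hx, hs, pow_one, mul_add, mul_inv_cancel₀ hu0]
      exact (hu.mul hlam).add isIntegral_one
    | algebraMap r => exact ⟨0, by simpa using isIntegral_algebraMap⟩
    | add x y _ _ hx hy =>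
      obtain ⟨a, ha⟩ := hx
      obtain ⟨b, hb⟩ := hy
      refine ⟨max a b, ?_⟩
      rw [mul_add]
      exact (mono _ _ _ (le_max_left _ _) ha).add (mono _ _ _ (le_max_right _ _) hb)
    | mul x y _ _ hx hy =>
      obtain ⟨a, ha⟩ := hx
      obtain ⟨b, hb⟩ := hy
      refine ⟨a + b, ?_⟩
      rw [pow_add, mul_mul_mul_comm]
      exact ha.mul hb
  obtain ⟨p, hp, hp0⟩ := hd
  choose N hN using fun i => h1 _ (p.coeff i).2
  set M := ∑ i ∈ Finset.range (p.natDegree + 1), N i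
  set q : E[X] := (p.map (algebraMap _ E)).scaleRoots (u ^ M)
  have hq : q.Monic := (monic_scaleRoots_iff _).mpr (hp.map _)
  have hdeg : (p.map (algebraMap _ E)).natDegree = p.natDegree := hp.natDegree_map _
  have hql : q ∈ lifts (algebraMap (integralClosure O E) E) := by
    rw [lifts_iff_coeff_lifts]
    intro n
    refine ⟨⟨q.coeff n, ?_⟩, rfl⟩
    rw [coeff_scaleRoots, hdeg, coeff_map, ← pow_mul, mul_comm]
    rcases lt_trichotomy n p.natDegree with h | h | h
    · refine mono _ (N n) _ ?_ (hN n)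
      calc N n ≤ M := Finset.single_le_sum (fun _ _ => Nat.zero_le _)
            (Finset.mem_range.mpr (by omega))
        _ ≤ _ := Nat.le_mul_of_pos_right _ (by omega)
    · rw [h, Nat.sub_self, mul_zero, pow_zero, hp.coeff_natDegree, map_one, one_mul]
      exact isIntegral_one
    · rw [coeff_eq_zero_of_natDegree_lt h, map_zero, mul_zero]
      exact isIntegral_zero
  obtain ⟨Q, hQ, -, hQm⟩ := lifts_and_natDegree_eq_and_monic hql hq
  refine ⟨M, ?_⟩
  have : IsIntegral (integralClosure O E) (u ^ M * d) := by
    refine ⟨Q, hQm, ?_⟩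
    rw [← Polynomial.eval_map, hQ]
    have h3 := scaleRoots_eval₂_mul (p := p.map (algebraMap _ E)) (RingHom.id E) d (u ^ M)
    rw [eval₂_id, RingHom.id_apply] at h3
    rw [h3, eval₂_id, Polynomial.eval_map, hp0, mul_zero]
  exact isIntegral_trans _ this

end Chart

section Chart2

variable {O F E : Type*} [CommRing O] [IsDomain O] [Field F] [Field E]
  [Algebra O F] [IsFractionRing O F] [Algebra F E] [Algebra O E]
  [IsScalarTower O F E] [FiniteDimensional F E]

theorem exists_smul_mem_of_adjoin_eq_top (Λ : Subalgebra O E)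
    (h : Algebra.adjoin F (Λ : Set E) = ⊤) (x : E) : ∃ c : O, c ≠ 0 ∧ c • x ∈ Λ := by
  have hx : x ∈ Submodule.span F (Λ : Set E) := by
    have := Algebra.adjoin_eq_span F (Λ : Set E)
    rw [h, show Submonoid.closure (Λ : Set E) = Λ.toSubmonoid from
      Submonoid.closure_eq Λ.toSubmonoid] at this
    exact this ▸ (Algebra.mem_top : x ∈ (⊤ : Subalgebra F E))
  induction hx using Submodule.span_induction with
  | mem x hx => exact ⟨1, one_ne_zero, by simpa using hx⟩
  | zero => exact ⟨1, one_ne_zero, by simp⟩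
  | add x y _ _ hx hy =>
    obtain ⟨a, ha, hax⟩ := hx
    obtain ⟨b, hb, hby⟩ := hy
    refine ⟨a * b, mul_ne_zero ha hb, ?_⟩
    rw [smul_add, mul_smul, mul_smul, smul_comm a b x]
    exact add_mem (Λ.smul_mem hax b) (Λ.smul_mem hby a)
  | smul f x _ hx =>
    obtain ⟨a, ha, hax⟩ := hx
    obtain ⟨n, d, hd, rfl⟩ := IsFractionRing.div_surjective (A := O) f
    have hd0 : d ≠ 0 := nonZeroDivisors.ne_zero hd
    refine ⟨d * a, mul_ne_zero hd0 ha, ?_⟩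
    have : (d * a) • (algebraMap O F n / algebraMap O F d) • x = n • a • x := by
      have hdF : algebraMap O F d ≠ 0 := by simpa using hd0
      rw [← algebraMap_smul F (d * a), ← algebraMap_smul F n, ← algebraMap_smul F a x, smul_smul,
        smul_smul]
      congr 1
      rw [map_mul]
      field_simp
    rw [this]
    exact Λ.smul_mem hax n

/-- The quotients of `T = Λ[u⁻¹]` and of `Λ` by an element `1 + μu` agree. -/
theorem length_quot_eq_of_away (T Λ : Subalgebra O E) (hΛT : Λ ≤ T) (u : E) (hu0 : u ≠ 0)
    (huΛ : u ∈ Λ) (hT : ∀ t ∈ T, ∃ n : ℕ, u ^ n * t ∈ Λ) (huT : u⁻¹ ∈ T) (μ : O)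
    (t : T) (a : Λ) (ha : (a : E) = 1 + algebraMap O E μ * u) (hta : (t : E) = a * u⁻¹) :
    Module.length O (T ⧸ LinearMap.range (LinearMap.mulLeft O t)) =
      Module.length O (Λ ⧸ LinearMap.range (LinearMap.mulLeft O a)) := by
  let ι : Λ →ₗ[O] T := (Subalgebra.inclusion hΛT).toLinearMap
  let π : Λ →ₗ[O] T ⧸ LinearMap.range (LinearMap.mulLeft O t) := Submodule.mkQ _ ∘ₗ ι
  have hinv : ∀ n : ℕ, ∃ w : Λ, (1 : E) = (-algebraMap O E μ * u) ^ n + a * w := by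
    intro n
    have : (1 : E) - (-algebraMap O E μ * u) = a := by rw [ha]; ring
    refine ⟨∑ i ∈ Finset.range n, (-algebraMap O Λ μ * ⟨u, huΛ⟩) ^ i, ?_⟩
    have h2 := mul_neg_geom_sum (-algebraMap O E μ * u) n
    rw [this] at h2
    push_cast
    rw [h2]
    ring
  have hπ : Function.Surjective π := by
    intro x
    induction x using Submodule.Quotient.induction_on with | _ x
    obtain ⟨n, hn⟩ := hT x x.2
    obtain ⟨w, hw⟩ := hinv n
    refine ⟨(-algebraMap O Λ μ) ^ n * ⟨_, hn⟩, ?_⟩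
    refine (Submodule.Quotient.eq _).mpr ?_
    refine ⟨-(⟨u, hΛT huΛ⟩ * Subalgebra.inclusion hΛT w * x), ?_⟩
    apply Subtype.val_injective
    simp only [LinearMap.mulLeft_apply, MulMemClass.coe_mul, AddSubgroupClass.coe_sub,
      NegMemClass.coe_neg, Subalgebra.coe_inclusion, hta, ι, AlgHom.toLinearMap_apply,
      SubmonoidClass.coe_pow, Subalgebra.coe_algebraMap]
    have h3 : (x : E) = (-algebraMap O E μ * u) ^ n * x + a * w * x := by
      rw [← add_mul, ← hw, one_mul]
    field_simp
    rw [mul_pow] at h3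
    linear_combination h3
  have hk : LinearMap.ker π = LinearMap.range (LinearMap.mulLeft O a) := by
    ext x
    rw [LinearMap.mem_ker]
    constructor
    · intro hx
      obtain ⟨y, hy⟩ := (Submodule.Quotient.mk_eq_zero _).mp hx
      obtain ⟨n, hn⟩ := hT y y.2
      obtain ⟨w, hw⟩ := hinv (n + 1)
      have hy' : (a : E) * u⁻¹ * y = x := by
        rw [← hta]; exact congrArg Subtype.val hy
      refine ⟨(-algebraMap O Λ μ) ^ (n + 1) * ⟨_, hn⟩ + w * x, ?_⟩
      apply Subtype.val_injective
      simp only [LinearMap.mulLeft_apply, MulMemClass.coe_mul, AddMemClass.coe_add,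
        NegMemClass.coe_neg, SubmonoidClass.coe_pow, Subalgebra.coe_algebraMap]
      have h3 : (x : E) = (-algebraMap O E μ * u) ^ (n + 1) * x + a * w * x := by
        rw [← add_mul, ← hw, one_mul]
      conv_rhs => rw [h3]
      rw [mul_add, mul_assoc]
      congr 1
      rw [← hy', mul_pow, pow_succ u n]
      field_simp
    · rintro ⟨y, rfl⟩
      refine (Submodule.Quotient.mk_eq_zero _).mpr ⟨⟨u, hΛT huΛ⟩ * Subalgebra.inclusion hΛT y, ?_⟩
      apply Subtype.val_injective
      simp only [LinearMap.mulLeft_apply, MulMemClass.coe_mul, Subalgebra.coe_inclusion, hta, ι,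
        AlgHom.toLinearMap_apply]
      field_simp
  rw [← (π.quotKerEquivOfSurjective hπ).length_eq, hk]

variable [IsNoetherianRing O] [Ring.KrullDimLE 1 O]

theorem ordFrac_norm_eq_length_of_chart (T : Subalgebra O E) (S : Finset E) (s : E)
    (hS : T = Algebra.adjoin O (S : Set E)) (hs : s ∈ T)
    (hInt : ∀ d ∈ S, IsIntegral (Algebra.adjoin O {s}) d)
    (hE : Algebra.adjoin F (T : Set E) = ⊤) (lam : O) (hlam : s - algebraMap O E lam ≠ 0)
    (hu : (s - algebraMap O E lam)⁻¹ ∈ T) (c : O) (t : T)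
    (ht : (t : E) = s - algebraMap O E c) (ht0 : t ≠ 0) :
    ∃ n : ℕ, Module.length O (T ⧸ LinearMap.range (LinearMap.mulLeft O t)) = n ∧
      Ring.ordFrac O (Algebra.norm F (t * (s - algebraMap O E lam)⁻¹)) =
        ((Multiplicative.ofAdd (n : ℤ) : Multiplicative ℤ) : WithZero (Multiplicative ℤ)) := by
  classical
  set u := (s - algebraMap O E lam)⁻¹ with hudef
  have hu0 : u ≠ 0 := inv_ne_zero hlam
  have hsu : s = algebraMap O E lam + u⁻¹ := by rw [hudef, inv_inv]; ring
  have huint : IsIntegral O u := by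
    apply isIntegral_of_isIntegral_adjoin_inv
    have h1 : Algebra.adjoin O {s} ≤ Algebra.adjoin O {u⁻¹} := by
      refine Algebra.adjoin_le ?_
      rw [Set.singleton_subset_iff, hsu]
      exact add_mem (Subalgebra.algebraMap_mem _ _) (Algebra.subset_adjoin rfl)
    have h2 : Algebra.adjoin O (S : Set E) ≤
        (integralClosure (Algebra.adjoin O {u⁻¹}) E).restrictScalars O := by
      refine Algebra.adjoin_le fun d hd => ?_
      obtain ⟨p, hp, hp0⟩ := hInt d hd
      exact ⟨p.map (Subalgebra.inclusion h1).toRingHom, hp.map _, by rw [eval₂_map]; exact hp0⟩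
    exact h2 (hS ▸ hu)
  choose! N hN using fun d (hd : d ∈ S) => exists_mul_pow_isIntegral huint hu0
    (isIntegral_algebraMap (x := lam)) hsu (hInt d hd)
  let G : Finset E := insert u (S.image fun d => u ^ N d * d)
  let Λ := Algebra.adjoin O (G : Set E)
  have huΛ : u ∈ Λ := Algebra.subset_adjoin (by simp [G])
  have hdΛ (d : E) (hd : d ∈ S) : u ^ N d * d ∈ Λ :=
    Algebra.subset_adjoin (by simp only [G, Finset.coe_insert]; right; exact Finset.mem_coe.mpr (Finset.mem_image_of_mem _ hd))
  have hfin : Module.Finite O Λ := by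
    refine ⟨(Submodule.fg_top _).mpr (fg_adjoin_of_finite G.finite_toSet fun x hx => ?_)⟩
    rcases Finset.mem_insert.mp hx with rfl | hx
    · exact huint
    · obtain ⟨d, hd, rfl⟩ := Finset.mem_image.mp hx
      exact hN d hd
  have hST : ∀ d ∈ S, d ∈ T := fun d hd => hS ▸ Algebra.subset_adjoin hd
  have hΛT : Λ ≤ T := by
    refine Algebra.adjoin_le fun x hx => ?_
    rcases Finset.mem_insert.mp hx with rfl | hx
    · exact hu
    · obtain ⟨d, hd, rfl⟩ := Finset.mem_image.mp hx
      exact mul_mem (pow_mem hu _) (hST d hd)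
  have huT : u⁻¹ ∈ T := by
    rw [hudef, inv_inv]; exact sub_mem hs (T.algebraMap_mem _)
  have hT : ∀ x ∈ T, ∃ n : ℕ, u ^ n * x ∈ Λ := by
    intro x hx
    rw [hS] at hx
    have mono (x : E) (m n : ℕ) (hmn : m ≤ n) (h : u ^ m * x ∈ Λ) : u ^ n * x ∈ Λ := by
      rw [← Nat.sub_add_cancel hmn, pow_add, mul_assoc]
      exact mul_mem (pow_mem huΛ _) h
    induction hx using Algebra.adjoin_induction with
    | mem x hx => exact ⟨_, hdΛ x hx⟩
    | algebraMap r => exact ⟨0, by simp⟩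
    | add x y _ _ hx hy =>
      obtain ⟨a, ha⟩ := hx
      obtain ⟨b, hb⟩ := hy
      refine ⟨max a b, ?_⟩
      rw [mul_add]
      exact add_mem (mono _ _ _ (le_max_left _ _) ha) (mono _ _ _ (le_max_right _ _) hb)
    | mul x y _ _ hx hy =>
      obtain ⟨a, ha⟩ := hx
      obtain ⟨b, hb⟩ := hy
      refine ⟨a + b, ?_⟩
      rw [pow_add, mul_mul_mul_comm]
      exact mul_mem ha hb
  have hEΛ : Algebra.adjoin F (Λ : Set E) = ⊤ := by
    rw [← top_le_iff, ← hE]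
    refine Algebra.adjoin_le fun x hx => ?_
    obtain ⟨n, hn⟩ := hT x hx
    have h1 : u⁻¹ ∈ Algebra.adjoin F (Λ : Set E) :=
      Subalgebra.inv_mem_of_algebraic (A := Algebra.adjoin F (Λ : Set E))
        (x := ⟨u, Algebra.subset_adjoin huΛ⟩) (Algebra.IsAlgebraic.isAlgebraic _)
    have h2 : x = (u⁻¹) ^ n * (u ^ n * x) := by
      rw [← mul_assoc, ← mul_pow, inv_mul_cancel₀ hu0, one_pow, one_mul]
    rw [h2]
    exact mul_mem (pow_mem h1 n) (Algebra.subset_adjoin hn)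
  let a : Λ := 1 + algebraMap O Λ (lam - c) * ⟨u, huΛ⟩
  have ha : (a : E) = 1 + algebraMap O E (lam - c) * u := rfl
  have hta : (t : E) = a * u⁻¹ := by
    rw [ht, ha, hsu, add_mul, mul_assoc, mul_inv_cancel₀ hu0, map_sub]
    ring
  have ha0 : a ≠ 0 := by
    rintro h
    apply ht0
    apply Subtype.val_injective
    rw [hta, h]; simp
  rw [length_quot_eq_of_away T Λ hΛT u hu0 huΛ hT huT (lam - c) t a ha hta]
  have := ordFrac_norm_eq_length (F := F) Λ (exists_smul_mem_of_adjoin_eq_top Λ hEΛ) a ha0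
  rwa [hta, mul_assoc, inv_mul_cancel₀ hu0, mul_one]

end Chart2
end

section

/-- `T` is the ring of `Spec D ×_Y Spec 𝒪_{Y,y}`. -/
structure IsFiberRing {Y : Scheme.{u}} {D : Type u} [CommRing D] (h : Spec (.of D) ⟶ Y) (y : Y)
    (T : Type u) [CommRing T] [Algebra D T] [Algebra (Y.presheaf.stalk y) T] : Prop where
  isPullback : IsPullback (Spec.map (CommRingCat.ofHom (algebraMap D T)))
    (Spec.map (CommRingCat.ofHom (algebraMap (Y.presheaf.stalk y) T))) h (Y.fromSpecStalk y)

instance flat_fromSpecStalk (Y : Scheme.{u}) (y : Y) : Flat (Y.fromSpecStalk y) := by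
  obtain ⟨_, ⟨U, hU, rfl⟩, hyU, -⟩ :=
    Y.isBasis_affineOpens.exists_subset_of_mem_open (Set.mem_univ y) isOpen_univ
  rw [← hU.fromSpecStalk_eq_fromSpecStalk hyU]
  change Flat (Spec.map (Y.presheaf.germ U y hyU) ≫ hU.fromSpec)
  have : Flat (Spec.map (Y.presheaf.germ U y hyU)) := by
    rw [HasRingHomProperty.Spec_iff (P := @Flat)]
    letI : Algebra Γ(Y, U) (Y.presheaf.stalk y) := (Y.presheaf.germ U y hyU).hom.toAlgebra
    haveI := hU.isLocalization_stalk ⟨y, hyU⟩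
    exact IsLocalization.flat (Y.presheaf.stalk y) (hU.primeIdealOf ⟨y, hyU⟩).asIdeal.primeCompl
  have : IsOpenImmersion hU.fromSpec := hU.isOpenImmersion_fromSpec
  have : Flat hU.fromSpec := inferInstance
  exact MorphismProperty.comp_mem _ _ _ ‹_› ‹_›

section

variable {κ : Type u} [CommRing κ] {Y : Scheme.{u}} {D : Type u} [CommRing D]

theorem exists_isFiberRing (ρ : Y ⟶ Spec (.of κ)) [IsSeparated ρ] (h : Spec (.of D) ⟶ Y) (y : Y) :
    ∃ (T : Type u) (_ : CommRing T) (_ : Algebra D T) (_ : Algebra (Y.presheaf.stalk y) T),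
      IsFiberRing h y T := by
  have : IsAffineHom (h ≫ ρ) := inferInstance
  have : IsAffineHom h := MorphismProperty.of_postcomp (W := @IsAffineHom) (W' := @IsSeparated) h ρ
    inferInstance inferInstance
  let P := pullback h (Y.fromSpecStalk y)
  have : IsAffine P := inferInstance
  let f₁ : Spec Γ(P, ⊤) ⟶ Spec (.of D) := P.isoSpec.inv ≫ pullback.fst _ _
  let f₂ : Spec Γ(P, ⊤) ⟶ Spec (Y.presheaf.stalk y) := P.isoSpec.inv ≫ pullback.snd _ _
  letI a₁ : Algebra D Γ(P, ⊤) := (Spec.preimage f₁).hom.toAlgebra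
  letI a₂ : Algebra (Y.presheaf.stalk y) Γ(P, ⊤) := (Spec.preimage f₂).hom.toAlgebra
  refine ⟨Γ(P, ⊤), inferInstance, a₁, a₂, ⟨?_⟩⟩
  have h₁ : Spec.map (CommRingCat.ofHom (Spec.preimage f₁).hom) = f₁ := Spec.map_preimage f₁
  have h₂ : Spec.map (CommRingCat.ofHom (Spec.preimage f₂).hom) = f₂ := Spec.map_preimage f₂
  rw [RingHom.algebraMap_toAlgebra, RingHom.algebraMap_toAlgebra, h₁, h₂]
  exact IsPullback.of_iso_pullback ⟨by simp [f₁, f₂, P, pullback.condition]⟩ P.isoSpec.symm rfl rfl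

theorem surjective_of_isClosedImmersion_SpecMap {A B : CommRingCat.{u}} (g : A ⟶ B)
    (H : IsClosedImmersion (Spec.map g)) : Function.Surjective g.hom := by
  have h1 := (IsClosedImmersion.isAffine_surjective_of_isAffine (Spec.map g)).2
  intro b
  obtain ⟨a, ha⟩ := h1 ((Scheme.ΓSpecIso B).inv.hom b)
  refine ⟨(Scheme.ΓSpecIso A).hom.hom a, ?_⟩
  have h2 := Scheme.ΓSpecIso_naturality g
  have h3 : (Scheme.ΓSpecIso B).hom.hom ((Spec.map g).appTop.hom a) =
    g.hom ((Scheme.ΓSpecIso A).hom.hom a) := congr($(h2).hom a)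
  rw [← h3]
  erw [ha]
  exact congr($((Scheme.ΓSpecIso B).inv_hom_id).hom b)

theorem adjoin_range_eq_top_of_isPullback (ρ : Y ⟶ Spec (.of κ)) [IsSeparated ρ]
    {O T : Type u} [CommRing O] [CommRing T] [Algebra D T] [Algebra O T]
    (h : Spec (.of D) ⟶ Y) (f : Spec (.of O) ⟶ Y)
    (H : IsPullback (Spec.map (CommRingCat.ofHom (algebraMap D T)))
      (Spec.map (CommRingCat.ofHom (algebraMap O T))) h f) :
    Algebra.adjoin O (Set.range (algebraMap D T)) = ⊤ := by
  letI : Algebra κ D := (Spec.preimage (h ≫ ρ)).hom.toAlgebra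
  letI : Algebra κ O := (Spec.preimage (f ≫ ρ)).hom.toAlgebra
  have e₁ : h ≫ ρ = Spec.map (CommRingCat.ofHom (algebraMap κ D)) := (Spec.map_preimage _).symm
  have e₂ : f ≫ ρ = Spec.map (CommRingCat.ofHom (algebraMap κ O)) := (Spec.map_preimage _).symm
  let e : pullback (h ≫ ρ) (f ≫ ρ) ≅ Spec (.of (D ⊗[κ] O)) :=
    pullback.congrHom e₁ e₂ ≪≫ pullbackSpecIso κ D O
  have he₁ : e.hom ≫ Spec.map (CommRingCat.ofHom Algebra.TensorProduct.includeLeftRingHom) =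
      pullback.fst _ _ := by
    simp only [e, Iso.trans_hom, Category.assoc, pullbackSpecIso_hom_fst]
    rw [pullback.congrHom_hom, pullback.map]
    rw [pullback.lift_fst, Category.comp_id]
  have he₂ : e.hom ≫ Spec.map (CommRingCat.ofHom
      (Algebra.TensorProduct.includeRight : O →ₐ[κ] D ⊗[κ] O).toRingHom) =
      pullback.snd _ _ := by
    simp only [e, Iso.trans_hom, Category.assoc]
    rw [AlgHom.toRingHom_eq_coe, pullbackSpecIso_hom_snd]
    rw [pullback.congrHom_hom, pullback.map]
    rw [pullback.lift_snd, Category.comp_id]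
  let j : Spec (.of T) ⟶ Spec (.of (D ⊗[κ] O)) :=
    H.isoPullback.hom ≫ pullback.mapDesc h f ρ ≫ e.hom
  have hj : IsClosedImmersion j := by infer_instance
  have hj₁ : j ≫ Spec.map (CommRingCat.ofHom Algebra.TensorProduct.includeLeftRingHom) =
      Spec.map (CommRingCat.ofHom (algebraMap D T)) := by
    simp only [j, Category.assoc, he₁, pullback.mapDesc]
    rw [pullback.lift_fst, Category.comp_id, H.isoPullback_hom_fst]
  have hj₂ : j ≫ Spec.map (CommRingCat.ofHom
      (Algebra.TensorProduct.includeRight : O →ₐ[κ] D ⊗[κ] O).toRingHom) =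
      Spec.map (CommRingCat.ofHom (algebraMap O T)) := by
    simp only [j, Category.assoc, he₂, pullback.mapDesc]
    rw [pullback.lift_snd, Category.comp_id, H.isoPullback_hom_snd]
  obtain ⟨g, hg⟩ := Spec.map_surjective j
  rw [← hg] at hj hj₁ hj₂
  rw [← Spec.map_comp] at hj₁ hj₂
  have hg₁ := Spec.map_injective hj₁
  have hg₂ := Spec.map_injective hj₂
  have hsurj := surjective_of_isClosedImmersion_SpecMap g hj
  rw [eq_top_iff]
  intro t _
  obtain ⟨x, rfl⟩ := hsurj t
  induction x using TensorProduct.induction_on with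
  | zero => rw [map_zero]; exact zero_mem _
  | add a b ha hb => rw [map_add]; exact add_mem (ha trivial) (hb trivial)
  | tmul a b =>
    have h1 : g.hom (a ⊗ₜ 1) = algebraMap D T a := congr($(hg₁).hom a)
    have h2 : g.hom (1 ⊗ₜ b) = algebraMap _ T b := congr($(hg₂).hom b)
    have : a ⊗ₜ[κ] b = (a ⊗ₜ 1) * (1 ⊗ₜ b) := by simp
    rw [this, map_mul, h1, h2]
    exact mul_mem (Algebra.subset_adjoin ⟨a, rfl⟩) (Subalgebra.algebraMap_mem _ _)

namespace IsFiberRing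

variable {h : Spec (.of D) ⟶ Y} {y : Y} {T : Type u} [CommRing T] [Algebra D T]
  [Algebra (Y.presheaf.stalk y) T]

theorem flat (H : IsFiberRing h y T) : Module.Flat D T := by
  have : Flat (Spec.map (CommRingCat.ofHom (algebraMap D T))) :=
    MorphismProperty.of_isPullback H.isPullback.flip inferInstance
  rw [HasRingHomProperty.Spec_iff (P := @Flat)] at this
  exact (RingHom.flat_algebraMap_iff).mp this

theorem isEpi (H : IsFiberRing h y T) : Algebra.IsEpi D T := by
  rw [← CommRingCat.epi_iff_epi]
  have : Mono (Spec.map (CommRingCat.ofHom (algebraMap D T))) :=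
    MorphismProperty.of_isPullback (P := MorphismProperty.monomorphisms Scheme.{u})
      H.isPullback.flip (MorphismProperty.monomorphisms.infer_property _)
  refine ⟨fun {Z} a b hab => Spec.map_injective ?_⟩
  rw [← cancel_mono (Spec.map (CommRingCat.ofHom (algebraMap D T))), ← Spec.map_comp,
    ← Spec.map_comp, hab]

theorem specializes (H : IsFiberRing h y T) (P : Spec (.of T)) :
    h (Spec.map (CommRingCat.ofHom (algebraMap D T)) P) ⤳ y := by
  have h1 : h (Spec.map (CommRingCat.ofHom (algebraMap D T)) P) =
      Y.fromSpecStalk y (Spec.map (CommRingCat.ofHom (algebraMap (Y.presheaf.stalk y) T)) P) := by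
    rw [← Scheme.Hom.comp_apply, ← Scheme.Hom.comp_apply, H.isPullback.w]
  have h2 : h (Spec.map (CommRingCat.ofHom (algebraMap D T)) P) ∈
      Set.range (Y.fromSpecStalk y) := ⟨_, h1.symm⟩
  rwa [Scheme.range_fromSpecStalk] at h2

theorem adjoin_eq_top (H : IsFiberRing h y T) (ρ : Y ⟶ Spec (.of κ)) [IsSeparated ρ] :
    Algebra.adjoin (Y.presheaf.stalk y) (Set.range (algebraMap D T)) = ⊤ :=
  adjoin_range_eq_top_of_isPullback ρ h (Y.fromSpecStalk y) H.isPullback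

theorem exists_lift (H : IsFiberRing h y T) {E : Type u} [CommRing E] (ψ : D →+* E)
    (θ : Y.presheaf.stalk y →+* E)
    (hw : Spec.map (CommRingCat.ofHom ψ) ≫ h =
      Spec.map (CommRingCat.ofHom θ) ≫ Y.fromSpecStalk y) :
    ∃ τ : T →+* E, τ.comp (algebraMap D T) = ψ ∧ τ.comp (algebraMap _ T) = θ := by
  obtain ⟨g, hg⟩ := Spec.map_surjective (H.isPullback.lift _ _ hw)
  have h₁ := H.isPullback.lift_fst _ _ hw
  have h₂ := H.isPullback.lift_snd _ _ hw
  rw [← hg, ← Spec.map_comp] at h₁ h₂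
  exact ⟨g.hom, congr($(Spec.map_injective h₁).hom), congr($(Spec.map_injective h₂).hom)⟩

end IsFiberRing

end

end

section

section Herbrand

variable {O : Type*} [CommRing O]

theorem length_eq_range_add_range {A B C : Type*} [AddCommGroup A] [AddCommGroup B] [AddCommGroup C]
    [Module O A] [Module O B] [Module O C] (f : A →ₗ[O] B) (g : B →ₗ[O] C)
    (h : Function.Exact f g) :
    Module.length O B =
      Module.length O (LinearMap.range f) + Module.length O (LinearMap.range g) := by
  refine Module.length_eq_add_of_exact (LinearMap.range f).subtype g.rangeRestrict
    (Submodule.subtype_injective _) g.surjective_rangeRestrict fun b => ?_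
  have := h b
  simp only [Submodule.coe_subtype, Subtype.range_coe_subtype, Set.mem_setOf_eq,
    LinearMap.mem_range]
  rw [Subtype.ext_iff]
  simpa using this

variable {N₁ N₂ N₃ : Type*} [AddCommGroup N₁] [AddCommGroup N₂] [AddCommGroup N₃]
  [Module O N₁] [Module O N₂] [Module O N₃]

theorem length_range_of_injective (f : N₁ →ₗ[O] N₂) (h : Function.Injective f) :
    Module.length O (LinearMap.range f) = Module.length O N₁ :=
  (LinearEquiv.ofInjective f h).length_eq.symm

theorem length_range_of_surjective (f : N₁ →ₗ[O] N₂) (h : Function.Surjective f) :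
    Module.length O (LinearMap.range f) = Module.length O N₂ :=
  (LinearEquiv.ofTop _ (LinearMap.range_eq_top.mpr h)).length_eq

theorem length_ker_coker_of_exact (f : N₁ →ₗ[O] N₂) (g : N₂ →ₗ[O] N₃)
    (hf : Function.Injective f) (hg : Function.Surjective g) (h : Function.Exact f g)
    (φ₁ : Module.End O N₁) (φ₂ : Module.End O N₂) (φ₃ : Module.End O N₃)
    (h₁ : f ∘ₗ φ₁ = φ₂ ∘ₗ f) (h₂ : g ∘ₗ φ₂ = φ₃ ∘ₗ g) :
    ∃ a b c : ℕ∞,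
      Module.length O (LinearMap.ker φ₂) = Module.length O (LinearMap.ker φ₁) + a ∧
      Module.length O (LinearMap.ker φ₃) = a + b ∧
      Module.length O (N₁ ⧸ LinearMap.range φ₁) = b + c ∧
      Module.length O (N₂ ⧸ LinearMap.range φ₂) = c + Module.length O (N₃ ⧸ LinearMap.range φ₃) := by
  have c₁ : ∀ x, f (φ₁ x) = φ₂ (f x) := fun x => congr($h₁ x)
  have c₂ : ∀ x, g (φ₂ x) = φ₃ (g x) := fun x => congr($h₂ x)
  let F₁ : LinearMap.ker φ₁ →ₗ[O] LinearMap.ker φ₂ := f.restrict fun x hx => by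
    rw [LinearMap.mem_ker] at hx ⊢; rw [← c₁, hx, map_zero]
  let F₂ : LinearMap.ker φ₂ →ₗ[O] LinearMap.ker φ₃ := g.restrict fun x hx => by
    rw [LinearMap.mem_ker] at hx ⊢; rw [← c₂, hx, map_zero]
  let G₁ : (N₁ ⧸ LinearMap.range φ₁) →ₗ[O] (N₂ ⧸ LinearMap.range φ₂) :=
    Submodule.mapQ _ _ f (by rintro _ ⟨x, rfl⟩; exact ⟨f x, (c₁ x).symm⟩)
  let G₂ : (N₂ ⧸ LinearMap.range φ₂) →ₗ[O] (N₃ ⧸ LinearMap.range φ₃) :=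
    Submodule.mapQ _ _ g (by rintro _ ⟨x, rfl⟩; exact ⟨g x, (c₂ x).symm⟩)
  let δ := SnakeLemma.δ' φ₁ φ₂ φ₃ f g h f g h h₁ h₂ (LinearMap.ker φ₃).subtype
    (LinearMap.exact_subtype_ker_map φ₃) (LinearMap.range φ₁).mkQ
    (LinearMap.exact_map_mkQ_range φ₁) hg hf
  have e₁ : Function.Exact F₁ F₂ := by
    rintro ⟨x, hx⟩
    have := h x
    simp only [F₂, F₁, LinearMap.restrict_apply, Subtype.ext_iff, Set.mem_range, ZeroMemClass.coe_zero]
    rw [this]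
    constructor
    · rintro ⟨y, hy⟩
      refine ⟨⟨y, ?_⟩, hy⟩
      rw [LinearMap.mem_ker] at hx ⊢
      apply hf
      rw [c₁, hy, hx, map_zero]
    · rintro ⟨y, hy⟩
      exact ⟨y, hy⟩
  have e₂ : Function.Exact F₂ δ := SnakeLemma.exact_δ'_right φ₁ φ₂ φ₃ f g h f g h h₁ h₂
    (LinearMap.ker φ₂).subtype (LinearMap.exact_subtype_ker_map φ₂) _ _ _ _ hg hf F₂ rfl
    (Submodule.subtype_injective _)
  have e₃ : Function.Exact δ G₁ := SnakeLemma.exact_δ'_left φ₁ φ₂ φ₃ f g h f g h h₁ h₂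
    _ _ _ _ (LinearMap.range φ₂).mkQ (LinearMap.exact_map_mkQ_range φ₂) hg hf G₁ rfl
    (Submodule.mkQ_surjective _)
  have e₄ : Function.Exact G₁ G₂ := by
    intro x
    obtain ⟨x, rfl⟩ := Submodule.mkQ_surjective _ x
    constructor
    · intro hx
      have hx' : (LinearMap.range φ₃).mkQ (g x) = 0 := hx
      rw [Submodule.mkQ_apply, Submodule.Quotient.mk_eq_zero] at hx'
      obtain ⟨z, hz⟩ := hx'
      obtain ⟨z, rfl⟩ := hg z
      rw [← c₂] at hz
      obtain ⟨w, hw⟩ := (h (x - φ₂ z)).mp (by rw [map_sub, hz, sub_self])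
      refine ⟨(LinearMap.range φ₁).mkQ w, ?_⟩
      change (LinearMap.range φ₂).mkQ (f w) = _
      rw [hw, map_sub, sub_eq_self]
      exact (Submodule.Quotient.mk_eq_zero _).mpr ⟨z, rfl⟩
    · rintro ⟨w, hw⟩
      obtain ⟨w, rfl⟩ := Submodule.mkQ_surjective _ w
      rw [← hw]
      change (LinearMap.range φ₃).mkQ (g (f w)) = 0
      rw [h.apply_apply_eq_zero, map_zero]
  have i₁ : Function.Injective F₁ := fun x y hxy => Subtype.ext (hf congr(($hxy : N₂)))
  have s₂ : Function.Surjective G₂ := fun x => by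
    obtain ⟨x, rfl⟩ := Submodule.mkQ_surjective _ x
    obtain ⟨x, rfl⟩ := hg x
    exact ⟨(LinearMap.range φ₂).mkQ x, rfl⟩
  refine ⟨Module.length O (LinearMap.range F₂), Module.length O (LinearMap.range δ),
    Module.length O (LinearMap.range G₁), ?_, length_eq_range_add_range _ _ e₂,
    length_eq_range_add_range _ _ e₃, ?_⟩
  · rw [length_eq_range_add_range _ _ e₁, length_range_of_injective _ i₁]
  · rw [length_eq_range_add_range _ _ e₄, length_range_of_surjective _ s₂]

/-- The endomorphism `φ` has kernel and cokernel of finite length, and the difference of the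
lengths is `n`. -/
def HasIndex (φ : Module.End O N₁) (n : ℤ) : Prop :=
  ∃ a b : ℕ, Module.length O (N₁ ⧸ LinearMap.range φ) = a ∧
    Module.length O (LinearMap.ker φ) = b ∧ n = a - b

theorem HasIndex.of_exact (f : N₁ →ₗ[O] N₂) (g : N₂ →ₗ[O] N₃)
    (hf : Function.Injective f) (hg : Function.Surjective g) (h : Function.Exact f g)
    {φ₁ : Module.End O N₁} {φ₂ : Module.End O N₂} {φ₃ : Module.End O N₃}
    (h₁ : f ∘ₗ φ₁ = φ₂ ∘ₗ f) (h₂ : g ∘ₗ φ₂ = φ₃ ∘ₗ g) {m n : ℤ} (hm : HasIndex φ₁ m)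
    (hn : HasIndex φ₃ n) : HasIndex φ₂ (m + n) := by
  obtain ⟨a, b, c, e₁, e₂, e₃, e₄⟩ := length_ker_coker_of_exact f g hf hg h φ₁ φ₂ φ₃ h₁ h₂
  obtain ⟨p, q, h1, h2, rfl⟩ := hm
  obtain ⟨p', q', h1', h2', rfl⟩ := hn
  rw [h2] at e₁
  rw [h2'] at e₂
  rw [h1] at e₃
  rw [h1'] at e₄
  have ha : a ≠ ⊤ := by rintro rfl; simp at e₂
  have hb : b ≠ ⊤ := by rintro rfl; simp at e₂
  have hc : c ≠ ⊤ := by rintro rfl; simp at e₃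
  lift a to ℕ using ha
  lift b to ℕ using hb
  lift c to ℕ using hc
  refine ⟨c + p', q + a, by rw [e₄]; push_cast; rfl, by rw [e₁]; push_cast; rfl, ?_⟩
  have e₂' : q' = a + b := by exact_mod_cast e₂
  have e₃' : p = b + c := by exact_mod_cast e₃
  subst e₂' e₃'
  push_cast
  ring

theorem HasIndex.of_equiv (e : N₁ ≃ₗ[O] N₂) {φ₁ : Module.End O N₁} {φ₂ : Module.End O N₂}
    (h : ∀ x, e (φ₁ x) = φ₂ (e x)) {n : ℤ} (hn : HasIndex φ₁ n) : HasIndex φ₂ n := by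
  obtain ⟨a, b, h1, h2, rfl⟩ := hn
  refine ⟨a, b, ?_, ?_, rfl⟩
  · rw [← h1]
    refine (Submodule.Quotient.equiv _ _ e ?_).length_eq.symm
    ext x
    constructor
    · rintro ⟨_, ⟨z, rfl⟩, rfl⟩
      exact ⟨e z, (h z).symm⟩
    · rintro ⟨z, rfl⟩
      exact ⟨_, ⟨e.symm z, rfl⟩, by simp [h]⟩
  · rw [← h2]
    have : LinearMap.ker φ₂ = (LinearMap.ker φ₁).map (e : N₁ →ₗ[O] N₂) := by
      ext x
      constructor
      · intro hx
        refine ⟨e.symm x, ?_, by simp⟩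
        apply e.injective
        simpa [h] using hx
      · rintro ⟨z, hz, rfl⟩
        have hz' : φ₁ z = 0 := hz
        simp [← h, hz']
    rw [this]
    exact (e.submoduleMap (LinearMap.ker φ₁)).symm.length_eq

theorem HasIndex.zero_of_length_ne_top (φ : Module.End O N₁) (h : Module.length O N₁ ≠ ⊤) :
    HasIndex φ 0 := by
  have e₁ := Module.length_eq_add_of_exact (LinearMap.ker φ).subtype φ.rangeRestrict
    (Submodule.subtype_injective _) φ.surjective_rangeRestrict (by
      rw [LinearMap.exact_iff, LinearMap.ker_rangeRestrict, Submodule.range_subtype])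
  have e₂ := Module.length_eq_add_of_exact (LinearMap.range φ).subtype (LinearMap.range φ).mkQ
    (Submodule.subtype_injective _) (Submodule.mkQ_surjective _)
    (by rw [LinearMap.exact_iff, Submodule.ker_mkQ, Submodule.range_subtype])
  generalize Module.length O (LinearMap.range φ) = r at e₁ e₂
  have hr : r ≠ ⊤ := by rintro rfl; rw [add_top] at e₁; exact h e₁
  have hk : Module.length O (LinearMap.ker φ) ≠ ⊤ := by
    intro hk; rw [hk, top_add] at e₁; exact h e₁
  have hc : Module.length O (N₁ ⧸ LinearMap.range φ) ≠ ⊤ := by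
    intro hk; rw [hk, add_top] at e₂; exact h e₂
  lift r to ℕ using hr
  obtain ⟨a, ha⟩ := ENat.ne_top_iff_exists.mp hk
  obtain ⟨b, hb⟩ := ENat.ne_top_iff_exists.mp hc
  refine ⟨b, a, hb.symm, ha.symm, ?_⟩
  rw [e₁, ← ha, ← hb] at e₂
  have : a + r = r + b := by exact_mod_cast e₂
  omega

theorem HasIndex.of_injective {φ : Module.End O N₁} (hφ : Function.Injective φ) {n : ℕ}
    (h : Module.length O (N₁ ⧸ LinearMap.range φ) = n) : HasIndex φ n := by
  refine ⟨n, 0, h, ?_, by simp⟩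
  rw [LinearMap.ker_eq_bot.mpr hφ]
  exact Module.length_bot

end Herbrand

end

section

theorem smulCommClass_of_algebra (A B T : Type*) [CommRing A] [CommRing B] [CommRing T]
    [Algebra A T] [Algebra B T] : SMulCommClass A B T :=
  ⟨fun a b t => by simp only [Algebra.smul_def]; ring⟩

attribute [local instance] smulCommClass_of_algebra

section

variable {κ : Type u} [Field κ] {Y : Scheme.{u}} {D : Type u} [CommRing D]
  {h : Spec (.of D) ⟶ Y} {y : Y} {T : Type u} [CommRing T] [Algebra D T]
  [Algebra (Y.presheaf.stalk y) T]

attribute [local instance] Algebra.TensorProduct.rightAlgebra in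
theorem IsFiberRing.tensor (H : IsFiberRing h y T) (D' : Type u) [CommRing D'] [Algebra D D'] :
    IsFiberRing (Spec.map (CommRingCat.ofHom (algebraMap D D')) ≫ h) y (T ⊗[D] D') := by
  have h1 := isPullback_SpecMap_of_isPushout
    (CommRingCat.ofHom (algebraMap D T)) (CommRingCat.ofHom (algebraMap D D'))
    (CommRingCat.ofHom Algebra.TensorProduct.includeLeftRingHom)
    (CommRingCat.ofHom (Algebra.TensorProduct.includeRight : D' →ₐ[D] T ⊗[D] D').toRingHom)
    (CommRingCat.isPushout_tensorProduct D T D')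
  have h2 := h1.flip.paste_vert H.isPullback
  rw [← Spec.map_comp] at h2
  exact ⟨h2⟩

theorem isClosed_singleton_of_finite (ρ : Y ⟶ Spec (.of κ)) [LocallyOfFiniteType ρ]
    {E : Type u} [Field E] [Algebra κ E] [Module.Finite κ E] (f : Spec (.of E) ⟶ Y)
    (hf : f ≫ ρ = Spec.map (CommRingCat.ofHom (algebraMap κ E))) (P : Spec (.of E)) :
    IsClosed {f P} := by
  have := LocallyOfFiniteType.jacobsonSpace ρ
  have h1 : LocallyOfFiniteType (f ≫ ρ) := by
    rw [hf, HasRingHomProperty.Spec_iff (P := @LocallyOfFiniteType)]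
    exact RingHom.FiniteType.of_finite (RingHom.finite_algebraMap.mpr inferInstance)
  have : LocallyOfFiniteType f := locallyOfFiniteType_of_comp f ρ
  exact f.closePoints_subset_preimage_closedPoints (isClosed_discrete {P})

theorem IsFiberRing.subsingleton_of_field (ρ : Y ⟶ Spec (.of κ)) [LocallyOfFiniteType ρ]
    {E : Type u} [Field E] [Algebra κ E] [Module.Finite κ E] {f : Spec (.of E) ⟶ Y}
    (hf : f ≫ ρ = Spec.map (CommRingCat.ofHom (algebraMap κ E))) [Algebra E T]
    (H : IsFiberRing f y T) (P : Spec (.of E)) (hy : f P ≠ y) : Subsingleton T := by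
  by_contra hne
  rw [not_subsingleton_iff_nontrivial] at hne
  obtain ⟨Q⟩ : Nonempty (Spec (.of T)) := inferInstanceAs (Nonempty (PrimeSpectrum T))
  have h1 := H.specializes Q
  have h2 : Spec.map (CommRingCat.ofHom (algebraMap E T)) Q = P :=
    Subsingleton.elim (α := PrimeSpectrum E) _ _
  rw [h2] at h1
  have h3 := (isClosed_singleton_of_finite ρ f hf P).closure_eq
  rw [specializes_iff_mem_closure, h3] at h1
  exact hy h1.symm

/-- The length of `E` over the local ring at the image of `Spec E ⟶ Y`, i.e. the degree of `E`
over the residue field. -/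
def pointDegree {E : Type u} [Field E] (f : Spec (.of E) ⟶ Y) : ℕ∞ :=
  letI := (Scheme.stalkClosedPointTo f).hom.toAlgebra
  Module.length (Y.presheaf.stalk (f (IsLocalRing.closedPoint E))) E

theorem IsFiberRing.length_of_field {E : Type u} [Field E] {f : Spec (.of E) ⟶ Y} [Algebra E T]
    [Algebra (Y.presheaf.stalk (f (IsLocalRing.closedPoint E))) T]
    (H : IsFiberRing f (f (IsLocalRing.closedPoint E)) T) :
    Module.length (Y.presheaf.stalk (f (IsLocalRing.closedPoint E))) T = pointDegree f := by
  obtain ⟨τ, h1, h2⟩ := H.exists_lift (RingHom.id E) (Scheme.stalkClosedPointTo f).hom (by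
    have := Scheme.Spec_stalkClosedPointTo_fromSpecStalk f
    simpa using this.symm)
  letI := (Scheme.stalkClosedPointTo f).hom.toAlgebra
  letI := τ.toAlgebra
  haveI : IsScalarTower E T E := .of_algebraMap_eq' h1.symm
  haveI : IsScalarTower (Y.presheaf.stalk (f (IsLocalRing.closedPoint E))) T E :=
    .of_algebraMap_eq' h2.symm
  haveI := H.isEpi
  let e := TensorProduct.lid' E T E
  let e' : T ⊗[E] E ≃ₗ[T] T := TensorProduct.AlgebraTensorModule.rid E T T
  exact ((e'.symm ≪≫ₗ e).restrictScalars
    (Y.presheaf.stalk (f (IsLocalRing.closedPoint E)))).length_eq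

theorem pointDegree_ne_top (ρ : Y ⟶ Spec (.of κ))
    {E : Type u} [Field E] [Algebra κ E] [Module.Finite κ E] (f : Spec (.of E) ⟶ Y)
    (hf : f ≫ ρ = Spec.map (CommRingCat.ofHom (algebraMap κ E))) : pointDegree f ≠ ⊤ := by
  letI := (Scheme.stalkClosedPointTo f).hom.toAlgebra
  let g := Y.fromSpecStalk (f (IsLocalRing.closedPoint E)) ≫ ρ
  letI : Algebra κ (Y.presheaf.stalk (f (IsLocalRing.closedPoint E))) :=
    (Spec.preimage g).hom.toAlgebra
  haveI : IsScalarTower κ (Y.presheaf.stalk (f (IsLocalRing.closedPoint E))) E := by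
    refine .of_algebraMap_eq' ?_
    have h1 : CommRingCat.ofHom (algebraMap κ E) = Spec.preimage g ≫ Scheme.stalkClosedPointTo f := by
      apply Spec.map_injective
      rw [← hf, Spec.map_comp, Spec.map_preimage]
      simp only [g]
      rw [Scheme.Spec_stalkClosedPointTo_fromSpecStalk_assoc]
    exact congr($(h1).hom)
  have : IsNoetherian (Y.presheaf.stalk (f (IsLocalRing.closedPoint E))) E :=
    isNoetherian_of_tower κ inferInstance
  have : IsArtinian (Y.presheaf.stalk (f (IsLocalRing.closedPoint E))) E :=
    isArtinian_of_tower κ inferInstance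
  exact Module.length_ne_top

theorem IsFiberRing.length_ne_top_of_field (ρ : Y ⟶ Spec (.of κ)) [LocallyOfFiniteType ρ]
    {E : Type u} [Field E] [Algebra κ E] [Module.Finite κ E] {f : Spec (.of E) ⟶ Y}
    (hf : f ≫ ρ = Spec.map (CommRingCat.ofHom (algebraMap κ E))) [Algebra E T]
    (H : IsFiberRing f y T) : Module.length (Y.presheaf.stalk y) T ≠ ⊤ := by
  by_cases hy : f (IsLocalRing.closedPoint E) = y
  · subst hy
    rw [H.length_of_field]
    exact pointDegree_ne_top ρ f hf
  · have := H.subsingleton_of_field ρ hf _ hy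
    simp

end

end

section

section Algebra

theorem krullDimLE_one_of_trdeg_le_one {κ O : Type*} [Field κ] [CommRing O] [IsDomain O]
    [Algebra κ O] (h : Algebra.trdeg κ O ≤ 1) : Ring.KrullDimLE 1 O := by
  refine Ring.KrullDimLE.mk₁' fun p hp hpr => ?_
  rw [Ideal.Quotient.maximal_ideal_iff_isField_quotient]
  have : Algebra.IsAlgebraic κ (O ⧸ p) := ⟨fun x => by
    obtain ⟨a, rfl⟩ := Ideal.Quotient.mk_surjective x
    by_contra ha
    have ha' : Transcendental κ a := fun h => ha (h.algHom (Ideal.Quotient.mkₐ κ p))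
    letI : Algebra κ[X] O := (aeval a).toAlgebra
    haveI : IsScalarTower κ κ[X] O := .of_algebraMap_eq' (aeval a).comp_algebraMap.symm
    haveI : FaithfulSMul κ[X] O := (faithfulSMul_iff_algebraMap_injective _ _).mpr
      (transcendental_iff_injective.mp ha')
    have h0 : Algebra.IsAlgebraic κ[X] O := by
      have h1 := lift_trdeg_add_eq κ κ[X] O
      rw [Polynomial.trdeg_of_isDomain] at h1
      rw [← trdeg_eq_zero_iff]
      have h2 : Cardinal.lift (Algebra.trdeg κ O) ≤ 1 := by simpa using h
      rw [← h1, Cardinal.lift_one] at h2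
      by_contra hne
      have h3 : (1 : Cardinal) ≤ Cardinal.lift (Algebra.trdeg κ[X] O) := by
        rw [Cardinal.one_le_iff_ne_zero]
        simpa using hne
      have h4 := (add_le_add_right h3 1).trans h2
      norm_num [one_add_one_eq_two] at h4
    obtain ⟨b, hb, hb0⟩ := Submodule.exists_mem_ne_zero_of_ne_bot hp
    obtain ⟨r, hr0, c, hc⟩ := (h0.isAlgebraic b).exists_nonzero_dvd (mem_nonZeroDivisors_of_ne_zero hb0)
    have hr : aeval a r ∈ p := by
      rw [show aeval a r = algebraMap κ[X] O r from rfl, hc]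
      exact Ideal.mul_mem_right _ _ hb
    apply ha
    refine ⟨r, hr0, ?_⟩
    have := Polynomial.aeval_algHom_apply (Ideal.Quotient.mkₐ κ p) a r
    rw [Ideal.Quotient.mkₐ_eq_mk, Ideal.Quotient.eq_zero_iff_mem.mpr hr] at this
    exact this⟩
  have : Algebra.IsIntegral κ (O ⧸ p) := Algebra.isAlgebraic_iff_isIntegral.mp this
  exact isField_of_isIntegral_of_isField' (Field.toIsField κ)

theorem isField_of_isAlgebraic {κ O : Type*} [Field κ] [CommRing O] [IsDomain O]
    [Algebra κ O] [Algebra.IsAlgebraic κ O] : IsField O :=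
  have : Algebra.IsIntegral κ O := Algebra.isAlgebraic_iff_isIntegral.mp inferInstance
  isField_of_isIntegral_of_isField' (Field.toIsField κ)

section Line

variable {κ D : Type*} [Field κ] [CommRing D] [Algebra κ D] {s : D}

theorem exists_aeval_mem_of_ne_bot [IsDomain D]
    (hfin : (aeval (R := κ) s).toRingHom.Finite) (I : Ideal D) (hI : I ≠ ⊥) :
    ∃ g : κ[X], g ≠ 0 ∧ aeval s g ∈ I := by
  letI : Algebra κ[X] D := (aeval s).toAlgebra
  haveI : Module.Finite κ[X] D := hfin
  obtain ⟨b, hb, hb0⟩ := Submodule.exists_mem_ne_zero_of_ne_bot hI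
  obtain ⟨r, hr0, c, hc⟩ := (Algebra.IsIntegral.isIntegral (R := κ[X]) b).isAlgebraic.exists_nonzero_dvd
    (mem_nonZeroDivisors_of_ne_zero hb0)
  exact ⟨r, hr0, by
    rw [show aeval s r = algebraMap κ[X] D r from rfl, hc]; exact Ideal.mul_mem_right _ _ hb⟩

theorem finite_quotient_of_aeval_mem
    (hfin : (aeval (R := κ) s).toRingHom.Finite) (I : Ideal D) (g : κ[X]) (hg : g ≠ 0)
    (hgI : aeval s g ∈ I) : Module.Finite κ (D ⧸ I) := by
  letI : Algebra κ[X] D := (aeval s).toAlgebra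
  haveI : IsScalarTower κ κ[X] D := .of_algebraMap_eq' (aeval s).comp_algebraMap.symm
  haveI : Module.Finite κ[X] D := hfin
  let J : Ideal κ[X] := Ideal.span {g}
  have hJ : J ≤ I.comap (algebraMap κ[X] D) := by
    rw [Ideal.span_le, Set.singleton_subset_iff]; exact hgI
  letI : Algebra (κ[X] ⧸ J) (D ⧸ I) := (Ideal.quotientMap I (algebraMap κ[X] D) hJ).toAlgebra
  haveI : IsScalarTower κ[X] (κ[X] ⧸ J) (D ⧸ I) :=
    IsScalarTower.of_algebraMap_smul (R := κ[X]) (A := κ[X] ⧸ J) (M := D ⧸ I) fun r x => by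
    obtain ⟨d, rfl⟩ := Ideal.Quotient.mk_surjective (I := I) x
    change Ideal.Quotient.mk I (algebraMap κ[X] D r) * Ideal.Quotient.mk I d =
      Ideal.Quotient.mk I (r • d)
    rw [← map_mul, Algebra.smul_def]
  haveI : IsScalarTower κ (κ[X] ⧸ J) (D ⧸ I) :=
    IsScalarTower.of_algebraMap_smul (R := κ) (A := κ[X] ⧸ J) (M := D ⧸ I) fun r x => by
    obtain ⟨d, rfl⟩ := Ideal.Quotient.mk_surjective (I := I) x
    change Ideal.Quotient.mk I (algebraMap κ[X] D (algebraMap κ κ[X] r)) * Ideal.Quotient.mk I d =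
      Ideal.Quotient.mk I (r • d)
    rw [← map_mul, ← IsScalarTower.algebraMap_apply, Algebra.smul_def]
  haveI : Module.Finite (κ[X] ⧸ J) (D ⧸ I) := Module.Finite.of_restrictScalars_finite κ[X] _ _
  haveI : Module.Finite κ (κ[X] ⧸ J) := by
    have := (AdjoinRoot.powerBasis hg).finite
    exact this
  exact Module.Finite.trans (κ[X] ⧸ J) _

theorem trdeg_fractionRing_eq_one [IsDomain D] {E : Type*} [Field E] [Algebra D E]
    [IsFractionRing D E] [Algebra κ E] [IsScalarTower κ D E] (hs : Transcendental κ s)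
    (hfin : (aeval (R := κ) s).toRingHom.Finite) : Algebra.trdeg κ E = 1 := by
  letI : Algebra κ[X] D := (aeval s).toAlgebra
  haveI : IsScalarTower κ κ[X] D := .of_algebraMap_eq' (aeval s).comp_algebraMap.symm
  haveI : Module.Finite κ[X] D := hfin
  letI : Algebra κ[X] E := ((algebraMap D E).comp (algebraMap κ[X] D)).toAlgebra
  haveI : IsScalarTower κ[X] D E := .of_algebraMap_eq' rfl
  haveI : IsScalarTower κ κ[X] E := .of_algebraMap_eq fun r => by
    rw [IsScalarTower.algebraMap_apply κ[X] D E, ← IsScalarTower.algebraMap_apply κ κ[X] D,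
      ← IsScalarTower.algebraMap_apply κ D E]
  haveI : FaithfulSMul κ[X] E := (faithfulSMul_iff_algebraMap_injective _ _).mpr
    ((IsFractionRing.injective D E).comp (transcendental_iff_injective.mp hs))
  haveI : FaithfulSMul κ[X] D := (faithfulSMul_iff_algebraMap_injective _ _).mpr
    (transcendental_iff_injective.mp hs)
  haveI : Algebra.IsAlgebraic D E := IsLocalization.isAlgebraic E (nonZeroDivisors D)
  haveI : Algebra.IsAlgebraic κ[X] E := Algebra.IsAlgebraic.trans κ[X] D E
  have h1 := lift_trdeg_add_eq κ κ[X] E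
  rw [Polynomial.trdeg_of_isDomain, trdeg_eq_zero] at h1
  simpa using h1.symm

theorem adjoin_range_eq_top_of_isAlgebraic {D F E : Type*} [CommRing D] [IsDomain D] [Field F]
    [Field E] [Algebra D E] [IsFractionRing D E] [Algebra F E] [Algebra.IsAlgebraic F E] :
    Algebra.adjoin F (Set.range (algebraMap D E)) = ⊤ := by
  have hA := Subalgebra.isField_of_algebraic (Algebra.adjoin F (Set.range (algebraMap D E)))
  rw [eq_top_iff]
  rintro e -
  obtain ⟨a, b, hb, rfl⟩ := IsFractionRing.div_surjective D e
  have hmem : ∀ d, algebraMap D E d ∈ Algebra.adjoin F (Set.range (algebraMap D E)) :=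
    fun d => Algebra.subset_adjoin ⟨d, rfl⟩
  have hb0 : algebraMap D E b ≠ 0 := by simpa using nonZeroDivisors.ne_zero hb
  obtain ⟨c, hc⟩ := hA.mul_inv_cancel (a := ⟨_, hmem b⟩) (by simpa [Subtype.ext_iff] using hb0)
  have hc' : algebraMap D E b * (c : E) = 1 := congr(($hc : E))
  rw [div_eq_mul_inv, ← eq_inv_of_mul_eq_one_right hc']
  exact mul_mem (hmem a) c.2

theorem finiteDimensional_of_isAlgebraic {F E : Type*} [IsDomain D] [Field F]
    [Field E] [Algebra D E] [IsFractionRing D E] [Algebra F E] [Algebra.IsAlgebraic F E]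
    [Algebra κ E] [Algebra κ F] [IsScalarTower κ D E] [IsScalarTower κ F E]
    [Algebra.FiniteType κ D] : FiniteDimensional F E := by
  obtain ⟨S, hS⟩ := Algebra.FiniteType.out (R := κ) (A := D)
  have h1 : Algebra.adjoin F (algebraMap D E '' S) = ⊤ := by
    rw [eq_top_iff, ← adjoin_range_eq_top_of_isAlgebraic (D := D), Algebra.adjoin_le_iff]
    rintro _ ⟨d, rfl⟩
    have h2 : d ∈ Algebra.adjoin κ (S : Set D) := hS ▸ Algebra.mem_top
    have h3 : algebraMap D E d ∈ (Algebra.adjoin κ (S : Set D)).map (IsScalarTower.toAlgHom κ D E) :=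
      ⟨d, h2, rfl⟩
    rw [AlgHom.map_adjoin] at h3
    have h4 : Algebra.adjoin κ (algebraMap D E '' S) ≤
        (Algebra.adjoin F (algebraMap D E '' S)).restrictScalars κ :=
      Algebra.adjoin_le Algebra.subset_adjoin
    exact h4 h3
  haveI : Algebra.FiniteType F E := by
    classical
    exact ⟨⟨S.image (algebraMap D E), by rw [Finset.coe_image, h1]⟩⟩
  haveI : Algebra.IsIntegral F E := Algebra.isAlgebraic_iff_isIntegral.mp inferInstance
  exact Algebra.IsIntegral.finite

theorem exists_length_quot_eq {K T : Type*} [Field K] [CommRing T] [IsDomain T] [Algebra K T]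
    (s : T) (hs : Transcendental K s) (hfin : (aeval (R := K) s).toRingHom.Finite) :
    ∃ n : ℕ, ∀ c : K,
      Module.length K (T ⧸ LinearMap.range (LinearMap.mulLeft K (s - algebraMap K T c))) = n := by
  letI : Algebra K[X] T := (aeval s).toAlgebra
  haveI : IsScalarTower K K[X] T := .of_algebraMap_eq' (aeval s).comp_algebraMap.symm
  haveI : Module.Finite K[X] T := hfin
  haveI : FaithfulSMul K[X] T := (faithfulSMul_iff_algebraMap_injective _ _).mpr
    (transcendental_iff_injective.mp hs)
  haveI : Module.IsTorsionFree K[X] T := inferInstance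
  haveI : Module.Free K[X] T := inferInstance
  let b := Module.finBasis K[X] T
  refine ⟨Module.finrank K[X] T, fun c => ?_⟩
  let φ : K[X] →ₗ[K] K[X] := LinearMap.mulLeft K (X - C c)
  let e : T ≃ₗ[K] (Fin (Module.finrank K[X] T) → K[X]) := b.equivFun.restrictScalars K
  have he : ∀ t : T, e ((s - algebraMap K T c) * t) = φ.compLeft _ (e t) := fun t => by
    have h1 : (s - algebraMap K T c) * t = (X - C c : K[X]) • t := by
      rw [Algebra.smul_def]
      congr 1
      change _ = aeval s (X - C c)
      simp
    rw [h1]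
    change b.equivFun ((X - C c : K[X]) • t) = _
    rw [map_smul]
    rfl
  have h1 : Module.length K (K[X] ⧸ LinearMap.range φ) = 1 := by
    let ev : K[X] →ₗ[K] K := (aeval c).toLinearMap
    have hev : Function.Surjective ev := fun x => ⟨C x, by simp [ev]⟩
    have hk : LinearMap.range φ = LinearMap.ker ev := by
      ext p
      have : ev p = 0 ↔ (X - C c) ∣ p := by
        rw [dvd_iff_isRoot, IsRoot.def]
        simp [ev, aeval_def, eval₂_eq_eval_map]
      rw [LinearMap.mem_ker, this]
      constructor
      · rintro ⟨q, rfl⟩; exact ⟨q, rfl⟩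
      · rintro ⟨q, rfl⟩; exact ⟨q, rfl⟩
    rw [((Submodule.quotEquivOfEq _ _ hk) ≪≫ₗ ev.quotKerEquivOfSurjective hev).length_eq]
    rw [Module.length_eq_finrank]
    simp
  have h2 := length_coker_pi (R := K) (Module.finrank K[X] T) φ
  rw [h1, mul_one] at h2
  rw [← h2]
  refine (Submodule.Quotient.equiv _ _ e ?_).length_eq
  ext v
  constructor
  · rintro ⟨_, ⟨t, rfl⟩, rfl⟩
    exact ⟨e t, (he t).symm⟩
  · rintro ⟨w, rfl⟩
    refine ⟨_, ⟨e.symm w, rfl⟩, ?_⟩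
    change e ((s - algebraMap K T c) * e.symm w) = _
    rw [he, e.apply_symm_apply]

end Line

theorem adjoin_restrictScalars_of_surjective {O' O E : Type*} [CommRing O'] [CommRing O]
    [CommRing E] [Algebra O' O] [Algebra O E] [Algebra O' E] [IsScalarTower O' O E]
    (hsurj : Function.Surjective (algebraMap O' O)) (S : Set E) :
    (Algebra.adjoin O S).restrictScalars O' = Algebra.adjoin O' S := by
  apply le_antisymm
  · intro x hx
    have hx' : x ∈ Algebra.adjoin O S := hx
    clear hx
    induction hx' using Algebra.adjoin_induction with
    | mem x hx => exact Algebra.subset_adjoin hx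
    | algebraMap r =>
      obtain ⟨r, rfl⟩ := hsurj r
      rw [← IsScalarTower.algebraMap_apply]
      exact Subalgebra.algebraMap_mem _ _
    | add x y _ _ hx hy => exact add_mem hx hy
    | mul x y _ _ hx hy => exact mul_mem hx hy
  · exact Algebra.adjoin_le Algebra.subset_adjoin

theorem length_quot_eq_of_surjective {O' O D T E : Type*} [CommRing O'] [CommRing O] [CommRing D]
    [CommRing T] [CommRing E] [Algebra O' O] [Algebra O E] [Algebra O' E] [IsScalarTower O' O E]
    [Algebra O' T] [Algebra D T] [Algebra D E]
    (hsurj : Function.Surjective (algebraMap O' O))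
    (hadj : Algebra.adjoin O' (Set.range (algebraMap D T)) = ⊤)
    (τ : T →ₐ[O'] E) (hτ : Function.Injective τ)
    (hD : ∀ d, τ (algebraMap D T d) = algebraMap D E d) (A : Subalgebra O E)
    (hA : A = Algebra.adjoin O (Set.range (algebraMap D E))) (t : D) (a : A)
    (ha : (a : E) = algebraMap D E t) :
    Module.length O' (T ⧸ LinearMap.range (LinearMap.mulLeft O' (algebraMap D T t))) =
      Module.length O (A ⧸ LinearMap.range (LinearMap.mulLeft O a)) := by
  have h1 : τ.range = A.restrictScalars O' := by
    rw [← Algebra.map_top, ← hadj, AlgHom.map_adjoin, ← Set.range_comp]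
    have h2 : (τ ∘ algebraMap D T) = algebraMap D E := funext hD
    rw [h2, hA, adjoin_restrictScalars_of_surjective hsurj]
  have hmem : ∀ x, τ x ∈ A := fun x => by
    have : τ x ∈ τ.range := ⟨x, rfl⟩
    rw [h1] at this
    exact this
  let e₀ : T →ₗ[O'] A :=
    { toFun := fun x => ⟨τ x, hmem x⟩
      map_add' := fun x y => Subtype.ext (map_add τ x y)
      map_smul' := fun r x => Subtype.ext (map_smul τ r x) }
  let q : T →ₗ[O'] (A ⧸ LinearMap.range (LinearMap.mulLeft O a)) :=
    ((LinearMap.range (LinearMap.mulLeft O a)).mkQ.restrictScalars O') ∘ₗ e₀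
  have hq : Function.Surjective q := fun x => by
    obtain ⟨⟨x, hx⟩, rfl⟩ := Submodule.mkQ_surjective _ x
    obtain ⟨z, hz⟩ : x ∈ τ.range := by rw [h1]; exact hx
    exact ⟨z, congrArg _ (Subtype.ext hz)⟩
  have hk : LinearMap.range (LinearMap.mulLeft O' (algebraMap D T t)) = LinearMap.ker q := by
    ext x
    rw [LinearMap.mem_ker]
    change _ ↔ (Submodule.Quotient.mk (⟨τ x, hmem x⟩ : A) : A ⧸ LinearMap.range (LinearMap.mulLeft O a)) = 0
    rw [Submodule.Quotient.mk_eq_zero]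
    constructor
    · rintro ⟨z, rfl⟩
      refine ⟨⟨τ z, hmem z⟩, Subtype.ext ?_⟩
      change (a : E) * τ z = τ (algebraMap D T t * z)
      rw [map_mul, hD, ha]
    · rintro ⟨⟨z, hz⟩, hzx⟩
      have hz' : z ∈ τ.range := by rw [h1]; exact hz
      obtain ⟨z, rfl⟩ := hz'
      refine ⟨z, hτ ?_⟩
      have h3 : (a : E) * τ z = τ x := congr(($hzx : E))
      change τ (algebraMap D T t * z) = _
      rw [map_mul, hD, ← ha, h3]
  rw [((Submodule.quotEquivOfEq _ _ hk) ≪≫ₗ q.quotKerEquivOfSurjective hq).length_eq]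
  exact Module.length_eq_of_surjective hsurj

end Algebra

end

section

section

instance isIntegral_image {Z Y : Scheme.{u}} (f : Z ⟶ Y) [QuasiCompact f] [IsIntegral Z] :
    IsIntegral f.image := by
  have : IrreducibleSpace f.image := by
    rw [irreducibleSpace_def]
    convert! ((IrreducibleSpace.isIrreducible_univ Z).image _
      f.toImage.continuous.continuousOn).closure
    simpa using f.toImage.denseRange.closure_range.symm
  have : ∀ x : f.image, _root_.IsReduced (f.image.presheaf.stalk x) := fun x => by
    obtain ⟨_, ⟨U, hU, rfl⟩, hyU, -⟩ :=
      Y.isBasis_affineOpens.exists_subset_of_mem_open (Set.mem_univ (f.imageι x)) isOpen_univ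
    have hV : IsAffineOpen (f.imageι ⁻¹ᵁ U) := hU.preimage f.imageι
    have h1 : _root_.IsReduced Γ(f.image, f.imageι ⁻¹ᵁ U) :=
      isReduced_of_injective _ (f.toImage_app_injective ⟨U, hU⟩)
    letI : Algebra Γ(f.image, f.imageι ⁻¹ᵁ U) (f.image.presheaf.stalk x) :=
      (f.image.presheaf.germ _ x hyU).hom.toAlgebra
    haveI := hV.isLocalization_stalk ⟨x, hyU⟩
    exact isReduced_localizationPreserves
      (hV.primeIdealOf ⟨x, hyU⟩).asIdeal.primeCompl _ h1
  have := isReduced_of_isReduced_stalk f.image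
  exact isIntegral_of_irreducibleSpace_of_isReduced _

theorem exists_functionField_hom {W : Scheme.{u}} [IsIntegral W] {E : Type u} [Field E]
    (f : Spec (.of E) ⟶ W) [IsDominant f] :
    ∃ Φ : W.functionField →+* E,
      Spec.map (CommRingCat.ofHom Φ) ≫ W.fromSpecStalk (genericPoint W) = f := by
  have h1 : f (IsLocalRing.closedPoint E) = genericPoint W := by
    refine ((genericPoint_spec W).eq ?_).symm
    have h2 : Set.range f = {f (IsLocalRing.closedPoint E)} := by
      ext x
      constructor
      · rintro ⟨P, rfl⟩
        rw [Set.mem_singleton_iff]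
        exact congrArg f (Subsingleton.elim (α := PrimeSpectrum E) _ _)
      · rintro rfl
        exact ⟨_, rfl⟩
    rw [IsGenericPoint, ← h2]
    exact f.denseRange.closure_range
  refine ⟨(W.presheaf.stalkSpecializes (specializes_of_eq h1) ≫
    Scheme.stalkClosedPointTo f).hom, ?_⟩
  rw [CommRingCat.ofHom_hom, Spec.map_comp, Category.assoc,
    Scheme.SpecMap_stalkSpecializes_fromSpecStalk, Scheme.Spec_stalkClosedPointTo_fromSpecStalk]

theorem IsFiberRing.injective_of_isFractionRing {Y : Scheme.{u}} {D T E : Type u} [CommRing D]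
    [IsDomain D] [CommRing T] [Field E] [Algebra D E] [IsFractionRing D E] [Algebra D T]
    {h : Spec (.of D) ⟶ Y} {y : Y} [Algebra (Y.presheaf.stalk y) T]
    (H : IsFiberRing h y T) (τ : T →+* E) (hτ : τ.comp (algebraMap D T) = algebraMap D E) :
    Function.Injective τ := by
  letI := τ.toAlgebra
  haveI : IsScalarTower D T E := .of_algebraMap_eq' hτ.symm
  haveI := H.isEpi
  haveI := H.flat
  let f : T ⊗[D] D →ₗ[D] T ⊗[D] E := (Algebra.linearMap D E).lTensor T
  have hf : Function.Injective f :=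
    Module.Flat.lTensor_preserves_injective_linearMap _ (IsFractionRing.injective D E)
  have h1 : ∀ t : T, τ t = TensorProduct.lid' D T E (f (t ⊗ₜ 1)) := fun t => by
    simp [f, Algebra.smul_def, RingHom.algebraMap_toAlgebra]
  intro a b hab
  rw [h1, h1] at hab
  have h2 := hf ((TensorProduct.lid' D T E).injective hab)
  simpa using congr(TensorProduct.rid D T $h2)

variable {κ : Type u} [Field κ] {Y W : Scheme.{u}} [IsIntegral W] {D E : Type u} [CommRing D]
  [IsDomain D] [Field E] [Algebra D E] [IsFractionRing D E]

/-- The fibre ring at a point of the image `W` of `Spec D` is the compositum of `D` and the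
local ring of `W` inside the fraction field of `D`. -/
theorem IsFiberRing.length_eq_of_image (ρ : Y ⟶ Spec (.of κ)) [IsSeparated ρ] (i : W ⟶ Y)
    [IsClosedImmersion i] (g : Spec (.of D) ⟶ W) [Algebra W.functionField E]
    (hg : Spec.map (CommRingCat.ofHom (algebraMap W.functionField E)) ≫
      W.fromSpecStalk (genericPoint W) = Spec.map (CommRingCat.ofHom (algebraMap D E)) ≫ g)
    (z : W) [Algebra (W.presheaf.stalk z) E]
    [IsScalarTower (W.presheaf.stalk z) W.functionField E] {T : Type u} [CommRing T]
    [Algebra D T] [Algebra (Y.presheaf.stalk (i z)) T] (H : IsFiberRing (g ≫ i) (i z) T) :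
    ∃ τ : T →+* E, Function.Injective τ ∧ τ.comp (algebraMap D T) = algebraMap D E ∧
      τ.range = (Algebra.adjoin (W.presheaf.stalk z) (Set.range (algebraMap D E))).toSubring ∧
      ∀ (t : D) (a : Algebra.adjoin (W.presheaf.stalk z) (Set.range (algebraMap D E))),
        (a : E) = algebraMap D E t →
        Module.length (Y.presheaf.stalk (i z))
          (T ⧸ LinearMap.range (LinearMap.mulLeft (Y.presheaf.stalk (i z)) (algebraMap D T t))) =
        Module.length (W.presheaf.stalk z)
          (_ ⧸ LinearMap.range (LinearMap.mulLeft (W.presheaf.stalk z) a)) := by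
  let θ : Y.presheaf.stalk (i z) →+* E :=
    (algebraMap (W.presheaf.stalk z) E).comp (i.stalkMap z).hom
  obtain ⟨τ, h1, h2⟩ := H.exists_lift (algebraMap D E) θ (by
    obtain ⟨a, ha⟩ : ∃ a : W.presheaf.stalk z ⟶ .of E,
      a.hom = algebraMap (W.presheaf.stalk z) E := ⟨CommRingCat.ofHom _, rfl⟩
    obtain ⟨b, hb⟩ : ∃ b : W.functionField ⟶ .of E,
      b = CommRingCat.ofHom (algebraMap W.functionField E) := ⟨_, rfl⟩
    have e1 : a = W.presheaf.stalkSpecializes ((genericPoint_spec W).specializes trivial) ≫ b := by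
      ext x
      rw [ha, hb]
      exact IsScalarTower.algebraMap_apply (W.presheaf.stalk z) W.functionField E x
    have e2 : CommRingCat.ofHom θ = i.stalkMap z ≫ a := by
      ext x
      change (algebraMap (W.presheaf.stalk z) E) _ = a.hom _
      rw [ha]
      rfl
    have e3 : Spec.map (i.stalkMap z ≫ a) ≫ Y.fromSpecStalk (i z) =
        Spec.map (CommRingCat.ofHom (algebraMap D E)) ≫ g ≫ i := by
      rw [e1, Spec.map_comp, Spec.map_comp, Category.assoc, Category.assoc,
        Scheme.SpecMap_stalkMap_fromSpecStalk,
        Scheme.SpecMap_stalkSpecializes_fromSpecStalk_assoc, ← Category.assoc, ← Category.assoc,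
        hb, hg]
    exact ((congrArg (fun q => Spec.map q ≫ Y.fromSpecStalk (i z)) e2).trans e3).symm)
  letI : Algebra (Y.presheaf.stalk (i z)) (W.presheaf.stalk z) := (i.stalkMap z).hom.toAlgebra
  letI : Algebra (Y.presheaf.stalk (i z)) E := θ.toAlgebra
  haveI : IsScalarTower (Y.presheaf.stalk (i z)) (W.presheaf.stalk z) E := .of_algebraMap_eq' rfl
  let τ' : T →ₐ[Y.presheaf.stalk (i z)] E := { τ with commutes' := fun r => congr($h2 r) }
  have hsurj : Function.Surjective
    (algebraMap (Y.presheaf.stalk (i z)) (W.presheaf.stalk z)) := i.stalkMap_surjective z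
  have hinj := H.injective_of_isFractionRing τ h1
  have hD : ∀ d, τ' (algebraMap D T d) = algebraMap D E d := fun d => congr($h1 d)
  refine ⟨τ, hinj, h1, ?_, fun t a ha => ?_⟩
  · have h3 : τ'.range = (Algebra.adjoin (W.presheaf.stalk z)
        (Set.range (algebraMap D E))).restrictScalars (Y.presheaf.stalk (i z)) := by
      rw [adjoin_restrictScalars_of_surjective hsurj, ← Algebra.map_top, ← H.adjoin_eq_top ρ,
        AlgHom.map_adjoin, ← Set.range_comp]
      congr 2
      exact funext hD
    ext x
    exact SetLike.ext_iff.mp h3 x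
  · exact length_quot_eq_of_surjective hsurj (H.adjoin_eq_top ρ) τ' hinj hD _ rfl t a ha

end

end

section

theorem IsField.of_isAlgebraic {O A : Type*} [CommRing O] [CommRing A] [IsDomain A] [Algebra O A]
    [Algebra.IsAlgebraic O A] (hO : IsField O) : IsField A := by
  letI := hO.toField
  exact isField_of_isAlgebraic (κ := O)

theorem ordFrac_norm_div_eq {κ O F D E : Type*} [Field κ] [CommRing O] [IsDomain O] [Field F]
    [Field E] [Algebra O F] [IsFractionRing O F] [Algebra F E] [Algebra O E]
    [IsScalarTower O F E] [FiniteDimensional F E] [IsNoetherianRing O] [Ring.KrullDimLE 1 O]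
    [CommRing D] [IsDomain D] [Algebra D E] [IsFractionRing D E] [Algebra κ O] [Algebra κ D]
    [Algebra κ E] [IsScalarTower κ D E] [IsScalarTower κ O E] (s : D)
    (hfin : (aeval (R := κ) s).toRingHom.Finite) (A : Subalgebra O E)
    (hA : A = Algebra.adjoin O (Set.range (algebraMap D E))) (lam : κ)
    (hlam : s - algebraMap κ D lam ≠ 0) (hu : (algebraMap D E (s - algebraMap κ D lam))⁻¹ ∈ A)
    (s₀ s₁ : A) (h₀ : (s₀ : E) = algebraMap D E s) (h₁ : (s₁ : E) = algebraMap D E (s - 1))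
    (hs₀ : s ≠ 0) (hs₁ : s - 1 ≠ 0) :
    ∃ a b : ℕ, Module.length O (A ⧸ LinearMap.range (LinearMap.mulLeft O s₀)) = a ∧
      Module.length O (A ⧸ LinearMap.range (LinearMap.mulLeft O s₁)) = b ∧
      Ring.ordFrac O (Algebra.norm F (algebraMap D E s / algebraMap D E (s - 1))) =
        ((Multiplicative.ofAdd ((a : ℤ) - b) : Multiplicative ℤ) :
          WithZero (Multiplicative ℤ)) := by
  classical
  letI : Algebra κ[X] D := (aeval s).toAlgebra
  haveI : IsScalarTower κ κ[X] D := .of_algebraMap_eq' (aeval s).comp_algebraMap.symm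
  haveI : Module.Finite κ[X] D := hfin
  have hinj := IsFractionRing.injective D E
  obtain ⟨S₀, hS₀⟩ := Module.Finite.fg_top (R := κ[X]) (M := D)
  let S : Finset E := insert (algebraMap D E s) (S₀.image (algebraMap D E))
  have hκ : ∀ c : κ, algebraMap O E (algebraMap κ O c) = algebraMap D E (algebraMap κ D c) :=
    fun c => by rw [← IsScalarTower.algebraMap_apply, ← IsScalarTower.algebraMap_apply]
  have hsS : algebraMap D E s ∈ Algebra.adjoin O (S : Set E) :=
    Algebra.subset_adjoin (by simp [S])
  have hpoly : ∀ (B : Subalgebra O E) (p : κ[X]), algebraMap D E s ∈ B →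
      algebraMap D E (aeval s p) ∈ B := fun B p hB => by
    induction p using Polynomial.induction_on' with
    | add p q hp hq => rw [map_add, map_add]; exact add_mem hp hq
    | monomial n c =>
      rw [aeval_monomial, map_mul, map_pow, ← hκ]
      exact mul_mem (Subalgebra.algebraMap_mem _ _) (pow_mem hB _)
  have hSA : A = Algebra.adjoin O (S : Set E) := by
    rw [hA]
    apply le_antisymm
    · rw [Algebra.adjoin_le_iff]
      rintro _ ⟨d, rfl⟩
      have hd : d ∈ Submodule.span κ[X] (S₀ : Set D) := hS₀ ▸ Submodule.mem_top
      induction hd using Submodule.span_induction with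
      | mem x hx => exact Algebra.subset_adjoin (by
          simp only [S, Finset.coe_insert, Finset.coe_image]
          exact Or.inr ⟨x, hx, rfl⟩)
      | zero => rw [map_zero]; exact zero_mem _
      | add x y _ _ hx hy => rw [map_add]; exact add_mem hx hy
      | smul p x _ hx =>
        rw [Algebra.smul_def, map_mul]
        exact mul_mem (hpoly _ p hsS) hx
    · rw [Algebra.adjoin_le_iff]
      intro x hx
      simp only [S, Finset.coe_insert, Finset.coe_image] at hx
      rcases hx with rfl | ⟨x, _, rfl⟩
      · exact Algebra.subset_adjoin ⟨s, rfl⟩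
      · exact Algebra.subset_adjoin ⟨x, rfl⟩
  have hInt : ∀ d ∈ S, IsIntegral (Algebra.adjoin O {algebraMap D E s}) d := fun d hd => by
    have : ∃ x, d = algebraMap D E x := by
      simp only [S, Finset.mem_insert, Finset.mem_image] at hd
      rcases hd with rfl | ⟨x, _, rfl⟩
      · exact ⟨_, rfl⟩
      · exact ⟨_, rfl⟩
    obtain ⟨x, rfl⟩ := this
    obtain ⟨p, hp, hpx⟩ := Algebra.IsIntegral.isIntegral (R := κ[X]) x
    have hmem : ∀ q : κ[X], algebraMap D E (aeval s q) ∈ Algebra.adjoin O {algebraMap D E s} :=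
      fun q => hpoly _ q (Algebra.subset_adjoin rfl)
    let f : κ[X] →+* Algebra.adjoin O {algebraMap D E s} :=
      (((algebraMap D E).comp (algebraMap κ[X] D)).codRestrict
        (Algebra.adjoin O {algebraMap D E s}).toSubring hmem)
    refine ⟨p.map f, hp.map f, ?_⟩
    rw [eval₂_map]
    have hcomp : (algebraMap (Algebra.adjoin O {algebraMap D E s}) E).comp f =
      (algebraMap D E).comp (algebraMap κ[X] D) := rfl
    rw [hcomp, ← Polynomial.hom_eval₂, hpx, map_zero]
  have hs : algebraMap D E s ∈ A := hSA ▸ hsS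
  haveI : Algebra.IsAlgebraic F E := inferInstance
  have hE : Algebra.adjoin F (A : Set E) = ⊤ := by
    rw [eq_top_iff, ← adjoin_range_eq_top_of_isAlgebraic (D := D)]
    apply Algebra.adjoin_mono
    rw [hA]
    exact Algebra.subset_adjoin
  have hl : algebraMap D E s - algebraMap O E (algebraMap κ O lam) =
      algebraMap D E (s - algebraMap κ D lam) := by rw [hκ, map_sub]
  have hl0 : algebraMap D E (s - algebraMap κ D lam) ≠ 0 := by
    rw [Ne, map_eq_zero_iff _ hinj]; exact hlam
  have key : ∀ (c : κ) (t : A), (t : E) = algebraMap D E (s - algebraMap κ D c) → t ≠ 0 →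
      ∃ n : ℕ, Module.length O (A ⧸ LinearMap.range (LinearMap.mulLeft O t)) = n ∧
      Ring.ordFrac O (Algebra.norm F (t * (algebraMap D E (s - algebraMap κ D lam))⁻¹)) =
        ((Multiplicative.ofAdd (n : ℤ) : Multiplicative ℤ) : WithZero (Multiplicative ℤ)) := by
    intro c t ht ht0
    rw [← hl]
    exact ordFrac_norm_eq_length_of_chart A S (algebraMap D E s) hSA hs hInt hE (algebraMap κ O lam)
      (hl ▸ hl0) (hl ▸ hu) (algebraMap κ O c) t (by rw [ht, hκ, map_sub]) ht0
  have e₀ : algebraMap D E s ≠ 0 := by simpa using hs₀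
  have e₁ : algebraMap D E (s - 1) ≠ 0 := by
    rw [Ne, map_eq_zero_iff _ hinj]; exact hs₁
  obtain ⟨a, ha, ha'⟩ := key 0 s₀ (by rw [h₀, map_zero, sub_zero]) (by
    intro h; rw [h] at h₀; exact e₀ h₀.symm)
  obtain ⟨b, hb, hb'⟩ := key 1 s₁ (by rw [h₁, map_one]) (by
    intro h; rw [h] at h₁; exact e₁ h₁.symm)
  refine ⟨a, b, ha, hb, ?_⟩
  have e : algebraMap D E s / algebraMap D E (s - 1) =
      (s₀ * (algebraMap D E (s - algebraMap κ D lam))⁻¹) /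
      (s₁ * (algebraMap D E (s - algebraMap κ D lam))⁻¹) := by
    rw [h₀, h₁, mul_div_mul_right _ _ (inv_ne_zero hl0)]
  have hw : (s₁ : E) * (algebraMap D E (s - algebraMap κ D lam))⁻¹ ≠ 0 :=
    mul_ne_zero (h₁ ▸ e₁) (inv_ne_zero hl0)
  have hN := (Algebra.norm_ne_zero_iff (R := F)).mpr hw
  have e' : Algebra.norm F (algebraMap D E s / algebraMap D E (s - 1)) =
      Algebra.norm F (s₀ * (algebraMap D E (s - algebraMap κ D lam))⁻¹) /
      Algebra.norm F (s₁ * (algebraMap D E (s - algebraMap κ D lam))⁻¹) := by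
    rw [eq_div_iff hN, ← map_mul, e, div_mul_cancel₀ _ hw]
  rw [e', map_div₀, ha', hb', ofAdd_sub, WithZero.coe_div]

section

variable {κ : Type u} [Field κ] {Y : Scheme.{u}} {D : Type u} [CommRing D] [Algebra κ D] {s : D}

theorem isClosed_image_of_aeval_mem (ρ : Y ⟶ Spec (.of κ)) [LocallyOfFiniteType ρ]
    (hfin : (aeval (R := κ) s).toRingHom.Finite) (h : Spec (.of D) ⟶ Y)
    (hρ : h ≫ ρ = Spec.map (CommRingCat.ofHom (algebraMap κ D))) (P : PrimeSpectrum D)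
    (g : κ[X]) (hg : g ≠ 0) (hgP : aeval s g ∈ P.asIdeal) : IsClosed {h P} := by
  have := finite_quotient_of_aeval_mem hfin P.asIdeal g hg hgP
  haveI : Algebra.IsIntegral κ (D ⧸ P.asIdeal) := inferInstance
  letI : Field (D ⧸ P.asIdeal) :=
    (isField_of_isIntegral_of_isField' (Field.toIsField κ) : IsField (D ⧸ P.asIdeal)).toField
  let f : Spec (.of (D ⧸ P.asIdeal)) ⟶ Spec (.of D) :=
    Spec.map (CommRingCat.ofHom (Ideal.Quotient.mk P.asIdeal))
  let B : Spec (.of (D ⧸ P.asIdeal)) := (⊥ : PrimeSpectrum (D ⧸ P.asIdeal))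
  have hB : f B = P := by
    apply PrimeSpectrum.ext
    change Ideal.comap (Ideal.Quotient.mk P.asIdeal) ⊥ = P.asIdeal
    rw [← RingHom.ker_eq_comap_bot, Ideal.mk_ker]
  have := isClosed_singleton_of_finite ρ (f ≫ h) (by
    rw [Category.assoc, hρ, ← Spec.map_comp]; rfl) B
  rwa [Scheme.Hom.comp_apply, hB] at this

theorem IsFiberRing.exists_isUnit_sub [Infinite κ] [IsDomain D] (ρ : Y ⟶ Spec (.of κ))
    [LocallyOfFiniteType ρ] (hfin : (aeval (R := κ) s).toRingHom.Finite) (h : Spec (.of D) ⟶ Y)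
    (hρ : h ≫ ρ = Spec.map (CommRingCat.ofHom (algebraMap κ D))) {y : Y} {T : Type u} [CommRing T]
    [Algebra D T] [Algebra (Y.presheaf.stalk y) T] (H : IsFiberRing h y T)
    (P₀ : PrimeSpectrum D) (hP₀ : h P₀ ∉ closure {y}) (hs : Transcendental κ s) :
    ∃ lam : κ, s - algebraMap κ D lam ≠ 0 ∧ IsUnit (algebraMap D T (s - algebraMap κ D lam)) := by
  classical
  let Z : Set (PrimeSpectrum D) := h ⁻¹' closure {y}
  have hZ : IsClosed Z := isClosed_closure.preimage h.continuous
  have hI : PrimeSpectrum.vanishingIdeal Z ≠ ⊥ := fun hI => by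
    have h1 := PrimeSpectrum.zeroLocus_vanishingIdeal_eq_closure Z
    rw [hI, hZ.closure_eq] at h1
    have : P₀ ∈ Z := by rw [← h1]; simp
    exact hP₀ this
  obtain ⟨g, hg0, hg⟩ := exists_aeval_mem_of_ne_bot hfin _ hI
  obtain ⟨lam, hlam⟩ := Infinite.exists_notMem_finset g.roots.toFinset
  have hlam' : g.eval lam ≠ 0 := fun h0 => hlam (by simp [hg0, IsRoot, h0])
  refine ⟨lam, fun h0 => ?_, ?_⟩
  · refine hs ⟨X - C lam, X_sub_C_ne_zero lam, ?_⟩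
    simpa using h0
  by_contra hu
  obtain ⟨M, hM, hmem⟩ := exists_max_ideal_of_mem_nonunits hu
  let Q : Spec (.of T) := (⟨M, hM.isPrime⟩ : PrimeSpectrum T)
  let q : PrimeSpectrum D := Spec.map (CommRingCat.ofHom (algebraMap D T)) Q
  have hq : s - algebraMap κ D lam ∈ q.asIdeal := hmem
  have h1 : h q ⤳ y := H.specializes Q
  have h2 := isClosed_image_of_aeval_mem ρ hfin h hρ q (X - C lam) (X_sub_C_ne_zero lam)
    (by simpa using hq)
  rw [specializes_iff_mem_closure, h2.closure_eq] at h1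
  have h3 : q ∈ Z := by
    change h q ∈ closure {y}
    rw [Set.mem_singleton_iff] at h1
    rw [← h1]
    exact subset_closure rfl
  have h4 : aeval s g ∈ q.asIdeal := (PrimeSpectrum.mem_vanishingIdeal _ _).mp hg q h3
  have h5 : algebraMap κ D (g.eval lam) ∈ q.asIdeal := by
    obtain ⟨g', hg'⟩ := X_sub_C_dvd_sub_C_eval (a := lam) (p := g)
    have h6 := congr(aeval s $hg')
    rw [map_sub, aeval_C, map_mul, map_sub, aeval_X, aeval_C] at h6
    have h7 : algebraMap κ D (g.eval lam) = aeval s g - (s - algebraMap κ D lam) * aeval s g' := by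
      rw [← h6]; ring
    rw [h7]
    exact sub_mem h4 (Ideal.mul_mem_right _ _ hq)
  exact q.2.ne_top (Ideal.eq_top_of_isUnit_mem _ h5 ((IsUnit.mk0 _ hlam').map _))

end

end

section

section

variable {κ : Type u} [Field κ] {Y W : Scheme.{u}} [IsIntegral W]
  {D E : Type u} [CommRing D] [IsDomain D] [Field E] [Algebra D E] [IsFractionRing D E]
  [Algebra κ D] [Algebra κ E] [IsScalarTower κ D E]

theorem apply_bot_eq_genericPoint (g : Spec (.of D) ⟶ W) [Algebra W.functionField E]
    (hg : Spec.map (CommRingCat.ofHom (algebraMap W.functionField E)) ≫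
      W.fromSpecStalk (genericPoint W) = Spec.map (CommRingCat.ofHom (algebraMap D E)) ≫ g) :
    g (⊥ : PrimeSpectrum D) = genericPoint W := by
  let p : Spec (.of E) := (⊥ : PrimeSpectrum E)
  have h1 := congr($hg p)
  rw [Scheme.Hom.comp_apply, Scheme.Hom.comp_apply] at h1
  have h2 : Spec.map (CommRingCat.ofHom (algebraMap W.functionField E)) p =
      IsLocalRing.closedPoint W.functionField :=
    Subsingleton.elim (α := PrimeSpectrum W.functionField) _ _
  have h3 : Spec.map (CommRingCat.ofHom (algebraMap D E)) p = (⊥ : PrimeSpectrum D) := by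
    apply PrimeSpectrum.ext
    change Ideal.comap (algebraMap D E) ⊥ = ⊥
    rw [← RingHom.ker_eq_comap_bot, RingHom.injective_iff_ker_eq_bot _ |>.mp
      (IsFractionRing.injective D E)]
  rw [h2, h3, Scheme.fromSpecStalk_closedPoint] at h1
  exact h1.symm

/-- The base field acts on the local rings of `W` compatibly with the fraction field of `D`. -/
theorem exists_algebra_stalk (τ : W ⟶ Spec (.of κ)) (g : Spec (.of D) ⟶ W)
    [Algebra W.functionField E]
    (hg : Spec.map (CommRingCat.ofHom (algebraMap W.functionField E)) ≫
      W.fromSpecStalk (genericPoint W) = Spec.map (CommRingCat.ofHom (algebraMap D E)) ≫ g)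
    (hτ : g ≫ τ = Spec.map (CommRingCat.ofHom (algebraMap κ D))) (z : W)
    [Algebra (W.presheaf.stalk z) E] [IsScalarTower (W.presheaf.stalk z) W.functionField E] :
    ∃ _ : Algebra κ (W.presheaf.stalk z), IsScalarTower κ (W.presheaf.stalk z) E := by
  let q := Spec.preimage (W.fromSpecStalk z ≫ τ)
  letI : Algebra κ (W.presheaf.stalk z) := q.hom.toAlgebra
  refine ⟨inferInstance, .of_algebraMap_eq' ?_⟩
  obtain ⟨a, ha⟩ : ∃ a : W.functionField ⟶ .of E,
    a = CommRingCat.ofHom (algebraMap W.functionField E) := ⟨_, rfl⟩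
  have h1 : CommRingCat.ofHom (algebraMap κ D) ≫ CommRingCat.ofHom (algebraMap D E) =
      q ≫ W.presheaf.stalkSpecializes ((genericPoint_spec W).specializes trivial) ≫ a := by
    apply Spec.map_injective
    rw [Spec.map_comp, Spec.map_comp, Spec.map_comp, Spec.map_preimage, ← hτ, ← Category.assoc,
      ← hg, ha, Category.assoc, Category.assoc,
      Scheme.SpecMap_stalkSpecializes_fromSpecStalk_assoc]
  ext x
  have h2 := congr($(h1).hom x)
  rw [IsScalarTower.algebraMap_apply κ D E]
  refine Eq.trans h2 ?_
  rw [RingHom.comp_apply, IsScalarTower.algebraMap_apply (W.presheaf.stalk z) W.functionField E]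
  rw [ha]
  rfl

/-- The divisor of the norm of `s / (s - 1)` is the difference of the push-forwards of the
divisors of `s` and `s - 1`. -/
theorem IsFiberRing.ord_norm_eq [Infinite κ] [IsLocallyNoetherian W] (ρ : Y ⟶ Spec (.of κ))
    [IsSeparated ρ] [LocallyOfFiniteType ρ] (i : W ⟶ Y) [IsClosedImmersion i]
    (g : Spec (.of D) ⟶ W) [Algebra W.functionField E] [FiniteDimensional W.functionField E]
    (hg : Spec.map (CommRingCat.ofHom (algebraMap W.functionField E)) ≫
      W.fromSpecStalk (genericPoint W) = Spec.map (CommRingCat.ofHom (algebraMap D E)) ≫ g)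
    (hρ : (g ≫ i) ≫ ρ = Spec.map (CommRingCat.ofHom (algebraMap κ D))) (s : D)
    (hs : Transcendental κ s) (hfin : (aeval (R := κ) s).toRingHom.Finite)
    (z : W) {T : Type u} [CommRing T] [Algebra D T] [Algebra (Y.presheaf.stalk (i z)) T]
    (H : IsFiberRing (g ≫ i) (i z) T) :
    ∃ a b : ℕ,
      Module.length (Y.presheaf.stalk (i z)) (T ⧸ LinearMap.range
        (LinearMap.mulLeft (Y.presheaf.stalk (i z)) (algebraMap D T s))) = a ∧
      Module.length (Y.presheaf.stalk (i z)) (T ⧸ LinearMap.range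
        (LinearMap.mulLeft (Y.presheaf.stalk (i z)) (algebraMap D T (s - 1)))) = b ∧
      Scheme.ord (Algebra.norm W.functionField (algebraMap D E s / algebraMap D E (s - 1))) z =
        a - b := by
  letI : Algebra (W.presheaf.stalk z) E :=
    ((algebraMap W.functionField E).comp (algebraMap (W.presheaf.stalk z) W.functionField)).toAlgebra
  haveI : IsScalarTower (W.presheaf.stalk z) W.functionField E := .of_algebraMap_eq' rfl
  obtain ⟨_, _⟩ := exists_algebra_stalk (i ≫ ρ) g hg (by rw [← hρ, Category.assoc]) z
  have hinj := IsFractionRing.injective D E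
  have hOE : Function.Injective (algebraMap (W.presheaf.stalk z) E) :=
    (algebraMap W.functionField E).injective.comp
      (IsFractionRing.injective (W.presheaf.stalk z) W.functionField)
  have hdim : Ring.KrullDimLE 1 (W.presheaf.stalk z) := by
    apply krullDimLE_one_of_trdeg_le_one (κ := κ)
    rw [← trdeg_fractionRing_eq_one (E := E) hs hfin]
    exact trdeg_le_of_injective (IsScalarTower.toAlgHom κ (W.presheaf.stalk z) E) hOE
  obtain ⟨τ, hτ, hτD, hτr, hlen⟩ := H.length_eq_of_image ρ i g hg z
  let A := Algebra.adjoin (W.presheaf.stalk z) (Set.range (algebraMap D E))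
  have hmem : ∀ d, algebraMap D E d ∈ A := fun d => Algebra.subset_adjoin ⟨d, rfl⟩
  have hs0 : s ≠ 0 := by
    rintro rfl; exact hs isAlgebraic_zero
  have hs1 : s - 1 ≠ 0 := by
    intro h; rw [sub_eq_zero.mp h] at hs; exact hs isAlgebraic_one
  have e₀ : algebraMap D E s ≠ 0 := by rwa [Ne, map_eq_zero_iff _ hinj]
  have e₁ : algebraMap D E (s - 1) ≠ 0 := by rwa [Ne, map_eq_zero_iff _ hinj]
  rw [hlen s ⟨_, hmem s⟩ rfl, hlen (s - 1) ⟨_, hmem _⟩ rfl]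
  by_cases hz : coheight z = 1
  · have hne : (g ≫ i) (⊥ : PrimeSpectrum D) ∉ closure {i z} := by
      change i (g (⊥ : PrimeSpectrum D)) ∉ _
      rw [apply_bot_eq_genericPoint g hg]
      intro hc
      rw [← Set.image_singleton, i.isClosedEmbedding.closure_image_eq] at hc
      obtain ⟨w, hw, hw'⟩ := hc
      rw [i.isClosedEmbedding.injective hw'] at hw
      have h1 : z ⤳ genericPoint W := specializes_iff_mem_closure.mpr hw
      have h2 := h1.antisymm ((genericPoint_spec W).specializes trivial)
      have h3 : coheight (genericPoint W) = 1 := h2.eq ▸ hz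
      have h4 := ringKrullDim_stalk_eq_coheight (genericPoint W)
      have h5 : ringKrullDim W.functionField = 0 := ringKrullDim_eq_zero_of_field _
      rw [h3, h5] at h4
      exact absurd h4 (by decide)
    obtain ⟨lam, hlam, hu⟩ := H.exists_isUnit_sub ρ hfin (g ≫ i) hρ ⊥ hne hs
    have hu' : (algebraMap D E (s - algebraMap κ D lam))⁻¹ ∈ A := by
      obtain ⟨u, hu⟩ := hu
      have h1 : (algebraMap D E (s - algebraMap κ D lam)) * τ (u⁻¹ : Tˣ) = 1 := by
        rw [← hτD, RingHom.comp_apply, ← hu, ← map_mul, Units.mul_inv, map_one]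
      rw [← eq_inv_of_mul_eq_one_right h1]
      have h2 : τ (u⁻¹ : Tˣ) ∈ τ.range := ⟨_, rfl⟩
      rw [hτr] at h2
      exact h2
    obtain ⟨a, b, ha, hb, hab⟩ := ordFrac_norm_div_eq (κ := κ) (F := W.functionField) s hfin A rfl
      lam hlam hu' ⟨_, hmem s⟩ ⟨_, hmem (s - 1)⟩ rfl rfl hs0 hs1
    refine ⟨a, b, ha, hb, ?_⟩
    rw [Scheme.ord_eq_iff hz]
    · exact hab
    · exact (Algebra.norm_ne_zero_iff (R := W.functionField)).mpr (div_ne_zero e₀ e₁)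
  · rw [Scheme.ord_eq_zero_of_coheight_neq_one hz]
    have hO : IsField (W.presheaf.stalk z) := by
      have h1 := (Ring.krullDimLE_iff).mp hdim
      rw [ringKrullDim_stalk_eq_coheight] at h1
      have h2 : coheight z ≤ 1 := by exact_mod_cast h1
      have h3 : coheight z = 0 := ENat.lt_one_iff_eq_zero.mp (lt_of_le_of_ne h2 hz)
      have : Ring.KrullDimLE 0 (W.presheaf.stalk z) := by
        rw [Ring.krullDimLE_iff, ringKrullDim_stalk_eq_coheight, h3]; rfl
      exact Ring.KrullDimLE.isField_of_isDomain
    haveI : Algebra.IsAlgebraic (W.presheaf.stalk z) W.functionField :=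
      IsLocalization.isAlgebraic _ (nonZeroDivisors (W.presheaf.stalk z))
    haveI : Algebra.IsAlgebraic (W.presheaf.stalk z) E :=
      Algebra.IsAlgebraic.trans (W.presheaf.stalk z) W.functionField E
    haveI : Algebra.IsAlgebraic (W.presheaf.stalk z) A :=
      Algebra.IsAlgebraic.of_injective A.val Subtype.val_injective
    have hA : IsField A := IsField.of_isAlgebraic hO
    have hzero : ∀ t : A, t ≠ 0 → Module.length (W.presheaf.stalk z)
        (A ⧸ LinearMap.range (LinearMap.mulLeft (W.presheaf.stalk z) t)) = 0 := fun t ht => by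
      rw [Module.length_eq_zero_iff, Submodule.Quotient.subsingleton_iff, LinearMap.range_eq_top]
      obtain ⟨u, hu⟩ := hA.mul_inv_cancel ht
      exact fun x => ⟨u * x, by rw [LinearMap.mulLeft_apply, ← mul_assoc, hu, one_mul]⟩
    refine ⟨0, 0, ?_, ?_, by simp⟩
    · exact hzero _ fun h => e₀ congr(($h : E))
    · exact hzero _ fun h => e₁ congr(($h : E))

end

end

section

theorem finiteType_of_aeval_finite {κ D : Type*} [CommRing κ] [CommRing D] [Algebra κ D] {s : D}
    (hfin : (aeval (R := κ) s).toRingHom.Finite) : Algebra.FiniteType κ D := by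
  letI : Algebra κ[X] D := (aeval s).toAlgebra
  haveI : IsScalarTower κ κ[X] D := .of_algebraMap_eq' (aeval s).comp_algebraMap.symm
  haveI : Module.Finite κ[X] D := hfin
  exact Algebra.FiniteType.trans (S := κ[X]) inferInstance inferInstance

theorem exists_length_quot_adjoin {κ O D E : Type*} [Field κ] [CommRing O] [IsDomain O]
    [Field E] [Algebra O E] [FaithfulSMul O E] [CommRing D] [IsDomain D] [Algebra D E]
    [IsFractionRing D E] [Algebra κ O] [Algebra κ D] [Algebra κ E] [IsScalarTower κ D E]
    [IsScalarTower κ O E] [Algebra.IsAlgebraic κ O] {s : D} (hs : Transcendental κ s)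
    (hfin : (aeval (R := κ) s).toRingHom.Finite) (A : Subalgebra O E)
    (hA : A = Algebra.adjoin O (Set.range (algebraMap D E)))
    (s₀ s₁ : A) (h₀ : (s₀ : E) = algebraMap D E s) (h₁ : (s₁ : E) = algebraMap D E (s - 1)) :
    ∃ n : ℕ, Module.length O (A ⧸ LinearMap.range (LinearMap.mulLeft O s₀)) = n ∧
      Module.length O (A ⧸ LinearMap.range (LinearMap.mulLeft O s₁)) = n := by
  classical
  have hO : IsField O := isField_of_isAlgebraic (κ := κ)
  letI : Field O := hO.toField
  have hinj := IsFractionRing.injective D E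
  have hκ : ∀ c : κ, algebraMap O E (algebraMap κ O c) = algebraMap D E (algebraMap κ D c) :=
    fun c => by rw [← IsScalarTower.algebraMap_apply, ← IsScalarTower.algebraMap_apply]
  have hmem : ∀ d, algebraMap D E d ∈ A := fun d => hA ▸ Algebra.subset_adjoin ⟨d, rfl⟩
  have hs' : Transcendental O s₀ := fun h => hs <| by
    have h1 : IsAlgebraic O (algebraMap D E s) := by
      rw [← h₀]
      exact h.algHom A.val
    have h2 : IsAlgebraic κ (algebraMap D E s) := h1.restrictScalars κ
    exact (isAlgebraic_algebraMap_iff hinj).mp h2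
  have hftD := finiteType_of_aeval_finite hfin
  have hftA : Algebra.FiniteType O A := by
    obtain ⟨S, hS⟩ := Algebra.FiniteType.out (R := κ) (A := D)
    have h1 : A = Algebra.adjoin O (S.image (algebraMap D E) : Set E) := by
      rw [hA, Finset.coe_image]
      apply le_antisymm
      · rw [Algebra.adjoin_le_iff]
        rintro _ ⟨d, rfl⟩
        have h2 : d ∈ Algebra.adjoin κ (S : Set D) := hS ▸ Algebra.mem_top
        have h3 : algebraMap D E d ∈
            (Algebra.adjoin κ (S : Set D)).map (IsScalarTower.toAlgHom κ D E) := ⟨d, h2, rfl⟩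
        rw [AlgHom.map_adjoin] at h3
        have h4 : Algebra.adjoin κ (algebraMap D E '' S) ≤
            (Algebra.adjoin O (algebraMap D E '' S)).restrictScalars κ :=
          Algebra.adjoin_le Algebra.subset_adjoin
        exact h4 h3
      · exact Algebra.adjoin_mono (Set.image_subset_range _ _)
    exact (Subalgebra.fg_iff_finiteType A).mp ⟨_, h1.symm⟩
  have hfin' : (aeval (R := O) s₀).toRingHom.Finite := by
    letI : Algebra O[X] A := (aeval s₀).toAlgebra
    haveI : IsScalarTower O O[X] A := .of_algebraMap_eq' (aeval s₀).comp_algebraMap.symm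
    haveI : Algebra.FiniteType O[X] A := Algebra.FiniteType.of_restrictScalars_finiteType O _ _
    haveI : Algebra.IsIntegral O[X] A := ⟨fun a => by
      obtain ⟨a, ha⟩ := a
      have ha' : a ∈ Algebra.adjoin O (Set.range (algebraMap D E)) := hA ▸ ha
      suffices h : ∀ b (hb : b ∈ Algebra.adjoin O (Set.range (algebraMap D E))),
          IsIntegral O[X] (⟨b, hA ▸ hb⟩ : A) from h a ha'
      intro b hb
      induction hb using Algebra.adjoin_induction with
      | mem x hx =>
        obtain ⟨d, rfl⟩ := hx
        letI : Algebra κ[X] D := (aeval s).toAlgebra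
        haveI : Module.Finite κ[X] D := hfin
        obtain ⟨p, hp, hpd⟩ := Algebra.IsIntegral.isIntegral (R := κ[X]) d
        let f : κ[X] →+* O[X] := mapRingHom (algebraMap κ O)
        refine ⟨p.map f, hp.map f, ?_⟩
        let ψ : D →+* A := (algebraMap D E).codRestrict A.toSubring hmem
        have hcomp : (algebraMap O[X] A).comp f = ψ.comp (algebraMap κ[X] D) := by
          refine Polynomial.ringHom_ext (fun c => ?_) ?_
          · apply Subtype.ext
            change ((aeval s₀ (map (algebraMap κ O) (C c)) : A) : E) =
              algebraMap D E (aeval s (C c))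
            rw [map_C, aeval_C, aeval_C, ← hκ]
            rfl
          · apply Subtype.ext
            change ((aeval s₀ (map (algebraMap κ O) X) : A) : E) = algebraMap D E (aeval s X)
            rw [map_X, aeval_X, aeval_X, h₀]
        rw [eval₂_map, hcomp]
        change eval₂ (ψ.comp (algebraMap κ[X] D)) (ψ d) p = 0
        rw [← Polynomial.hom_eval₂, hpd, map_zero]
      | algebraMap r =>
        have : IsIntegral O[X] (algebraMap O[X] A (C r)) := isIntegral_algebraMap
        convert this using 1
        apply Subtype.ext
        change algebraMap O E r = ((aeval s₀ (C r) : A) : E)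
        rw [aeval_C]
        rfl
      | add x y hx hy hx' hy' => exact IsIntegral.add hx' hy'
      | mul x y hx hy hx' hy' => exact IsIntegral.mul hx' hy'⟩
    exact Algebra.IsIntegral.finite
  obtain ⟨n, hn⟩ := exists_length_quot_eq s₀ hs' hfin'
  refine ⟨n, ?_, ?_⟩
  · rw [← hn 0, map_zero, sub_zero]
  · rw [← hn 1, map_one]
    have : s₁ = s₀ - 1 := Subtype.ext (by
      rw [h₁, map_sub, map_one, ← h₀]; rfl)
    rw [this]

section

variable {κ : Type u} [Field κ] {Y : Scheme.{u}} {D : Type u} [CommRing D] [Algebra κ D]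

/-- `Z` is the cycle on `Y` obtained by pushing forward the difference of the divisors of `s` and
`s - 1` on `Spec D`. -/
def IsLengthCycle (h : Spec (.of D) ⟶ Y) (s : D) (Z : Cycles Y) : Prop :=
  ∀ (y : Y) (T : Type u) [CommRing T] [Algebra D T] [Algebra (Y.presheaf.stalk y) T],
    IsFiberRing h y T → ∃ a b : ℕ,
      Module.length (Y.presheaf.stalk y) (T ⧸ LinearMap.range
        (LinearMap.mulLeft (Y.presheaf.stalk y) (algebraMap D T s))) = a ∧
      Module.length (Y.presheaf.stalk y) (T ⧸ LinearMap.range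
        (LinearMap.mulLeft (Y.presheaf.stalk y) (algebraMap D T (s - 1)))) = b ∧
      Z y = a - b

theorem IsFiberRing.mem_of_length_ne_zero (ρ : Y ⟶ Spec (.of κ)) [LocallyOfFiniteType ρ] {s : D}
    (hfin : (aeval (R := κ) s).toRingHom.Finite) {h : Spec (.of D) ⟶ Y}
    (hρ : h ≫ ρ = Spec.map (CommRingCat.ofHom (algebraMap κ D))) {y : Y} {T : Type u}
    [CommRing T] [Algebra D T] [Algebra (Y.presheaf.stalk y) T] (H : IsFiberRing h y T) (c : κ)
    (hlen : Module.length (Y.presheaf.stalk y) (T ⧸ LinearMap.range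
      (LinearMap.mulLeft (Y.presheaf.stalk y) (algebraMap D T (s - algebraMap κ D c)))) ≠ 0) :
    y ∈ h '' PrimeSpectrum.zeroLocus {s - algebraMap κ D c} := by
  have hu : ¬ IsUnit (algebraMap D T (s - algebraMap κ D c)) := fun ⟨u, hu⟩ => hlen <| by
    rw [Module.length_eq_zero_iff, Submodule.Quotient.subsingleton_iff, LinearMap.range_eq_top]
    exact fun x => ⟨(u⁻¹ : Tˣ) * x, by
      rw [LinearMap.mulLeft_apply, ← hu, ← mul_assoc, Units.mul_inv, one_mul]⟩
  obtain ⟨M, hM, hmem⟩ := exists_max_ideal_of_mem_nonunits hu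
  let Q : Spec (.of T) := (⟨M, hM.isPrime⟩ : PrimeSpectrum T)
  let q : PrimeSpectrum D := Spec.map (CommRingCat.ofHom (algebraMap D T)) Q
  have hq : s - algebraMap κ D c ∈ q.asIdeal := hmem
  have h1 : h q ⤳ y := H.specializes Q
  have h2 := isClosed_image_of_aeval_mem ρ hfin h hρ q (X - C c) (X_sub_C_ne_zero c)
    (by simpa using hq)
  rw [specializes_iff_mem_closure, h2.closure_eq] at h1
  exact ⟨q, Set.singleton_subset_iff.mpr hq, h1.symm⟩

theorem finite_zeroLocus_sub {s : D} (hfin : (aeval (R := κ) s).toRingHom.Finite) (c : κ) :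
    (PrimeSpectrum.zeroLocus {s - algebraMap κ D c}).Finite := by
  have h1 := finite_quotient_of_aeval_mem hfin (Ideal.span {s - algebraMap κ D c}) (X - C c)
    (X_sub_C_ne_zero c) (by
      rw [map_sub, aeval_X, aeval_C]; exact Ideal.subset_span rfl)
  have h2 : IsArtinianRing (D ⧸ Ideal.span {s - algebraMap κ D c}) :=
    IsArtinianRing.of_finite κ _
  have h3 : Finite (PrimeSpectrum (D ⧸ Ideal.span {s - algebraMap κ D c})) := inferInstance
  rw [← PrimeSpectrum.zeroLocus_span]
  have h4 := range_comap_of_surjective _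
    (Ideal.Quotient.mk (Ideal.span {s - algebraMap κ D c})) Ideal.Quotient.mk_surjective
  rw [Ideal.mk_ker] at h4
  rw [← h4]
  exact Set.finite_range _

theorem isLengthCycle_zero_of_isAlgebraic {W : Scheme.{u}} [IsIntegral W] [IsDomain D] {E : Type u}
    [Field E] [Algebra D E] [IsFractionRing D E] [Algebra κ E] [IsScalarTower κ D E]
    (ρ : Y ⟶ Spec (.of κ)) [IsSeparated ρ] (i : W ⟶ Y)
    [IsClosedImmersion i] (g : Spec (.of D) ⟶ W) [Algebra W.functionField E]
    [Algebra κ W.functionField] [IsScalarTower κ W.functionField E]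
    [Algebra.IsAlgebraic κ W.functionField]
    (hg : Spec.map (CommRingCat.ofHom (algebraMap W.functionField E)) ≫
      W.fromSpecStalk (genericPoint W) = Spec.map (CommRingCat.ofHom (algebraMap D E)) ≫ g)
    (hρ : (g ≫ i) ≫ ρ = Spec.map (CommRingCat.ofHom (algebraMap κ D))) (s : D)
    (hs : Transcendental κ s) (hfin : (aeval (R := κ) s).toRingHom.Finite)
    (z : W) {T : Type u} [CommRing T] [Algebra D T] [Algebra (Y.presheaf.stalk (i z)) T]
    (H : IsFiberRing (g ≫ i) (i z) T) :
    ∃ n : ℕ,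
      Module.length (Y.presheaf.stalk (i z)) (T ⧸ LinearMap.range
        (LinearMap.mulLeft (Y.presheaf.stalk (i z)) (algebraMap D T s))) = n ∧
      Module.length (Y.presheaf.stalk (i z)) (T ⧸ LinearMap.range
        (LinearMap.mulLeft (Y.presheaf.stalk (i z)) (algebraMap D T (s - 1)))) = n := by
  letI : Algebra (W.presheaf.stalk z) E :=
    ((algebraMap W.functionField E).comp (algebraMap (W.presheaf.stalk z) W.functionField)).toAlgebra
  haveI : IsScalarTower (W.presheaf.stalk z) W.functionField E := .of_algebraMap_eq' rfl
  obtain ⟨_, _⟩ := exists_algebra_stalk (i ≫ ρ) g hg (by rw [← hρ, Category.assoc]) z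
  haveI : IsScalarTower κ (W.presheaf.stalk z) W.functionField := .of_algebraMap_eq fun c =>
    (algebraMap W.functionField E).injective (by
      rw [← IsScalarTower.algebraMap_apply, ← IsScalarTower.algebraMap_apply,
        ← IsScalarTower.algebraMap_apply])
  haveI : Algebra.IsAlgebraic κ (W.presheaf.stalk z) :=
    Algebra.IsAlgebraic.of_injective (IsScalarTower.toAlgHom κ (W.presheaf.stalk z) W.functionField)
      (IsFractionRing.injective (W.presheaf.stalk z) W.functionField)
  haveI : FaithfulSMul (W.presheaf.stalk z) E := (faithfulSMul_iff_algebraMap_injective _ _).mpr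
    ((algebraMap W.functionField E).injective.comp
      (IsFractionRing.injective (W.presheaf.stalk z) W.functionField))
  obtain ⟨τ, hτ, hτD, hτr, hlen⟩ := H.length_eq_of_image ρ i g hg z
  let A := Algebra.adjoin (W.presheaf.stalk z) (Set.range (algebraMap D E))
  have hmem : ∀ d, algebraMap D E d ∈ A := fun d => Algebra.subset_adjoin ⟨d, rfl⟩
  rw [hlen s ⟨_, hmem s⟩ rfl, hlen (s - 1) ⟨_, hmem _⟩ rfl]
  exact exists_length_quot_adjoin hs hfin A rfl _ _ rfl rfl

end

end

section

section

variable {κ : Type u} [Field κ] {Y : Scheme.{u}} {D : Type u} [CommRing D] [Algebra κ D]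

theorem IsFiberRing.subsingleton_of_notMem {h : Spec (.of D) ⟶ Y} {y : Y} {T : Type u} [CommRing T]
    [Algebra D T] [Algebra (Y.presheaf.stalk y) T] (H : IsFiberRing h y T) (Z : Set Y)
    (hZ : IsClosed Z) (hh : ∀ P : Spec (.of D), h P ∈ Z) (hy : y ∉ Z) : Subsingleton T := by
  by_contra hne
  rw [not_subsingleton_iff_nontrivial] at hne
  obtain ⟨Q⟩ : Nonempty (Spec (.of T)) := inferInstanceAs (Nonempty (PrimeSpectrum T))
  exact hy ((H.specializes Q).mem_closed hZ (hh _))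

theorem isDominant_SpecMap_of_injective {A B : CommRingCat.{u}} (f : A ⟶ B)
    (hf : Function.Injective f.hom) : IsDominant (Spec.map f) := by
  refine ⟨?_⟩
  have : DenseRange (PrimeSpectrum.comap f.hom) :=
    (PrimeSpectrum.denseRange_comap_iff_ker_le_nilRadical f.hom).mpr (by
      rw [(RingHom.injective_iff_ker_eq_bot _).mp hf]; exact bot_le)
  exact this

theorem isAffineHom_of_isSeparated (ρ : Y ⟶ Spec (.of κ)) [IsSeparated ρ]
    (h : Spec (.of D) ⟶ Y) : IsAffineHom h := by
  have : IsAffineHom (h ≫ ρ) := inferInstance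
  exact MorphismProperty.of_postcomp (W := @IsAffineHom) (W' := @IsSeparated) h ρ
    inferInstance inferInstance

theorem exists_isLengthCycle_of_isDomain [Infinite κ] [IsDomain D] (ρ : Y ⟶ Spec (.of κ))
    [IsSeparated ρ] [LocallyOfFiniteType ρ] (h : Spec (.of D) ⟶ Y)
    (hρ : h ≫ ρ = Spec.map (CommRingCat.ofHom (algebraMap κ D))) (s : D)
    (hs : Transcendental κ s) (hfin : (aeval (R := κ) s).toRingHom.Finite) :
    ∃ Z ∈ ratTrivial Y, IsLengthCycle h s Z := by
  classical
  have := isAffineHom_of_isSeparated ρ h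
  haveI : IsIntegral (Spec (.of D)) := inferInstance
  obtain ⟨W, i, g, _, _, _, rfl⟩ : ∃ (W : Scheme.{u}) (i : W ⟶ Y) (g : Spec (.of D) ⟶ W),
      IsIntegral W ∧ IsClosedImmersion i ∧ IsDominant g ∧ g ≫ i = h :=
    ⟨h.image, h.imageι, h.toImage, inferInstance, inferInstance, inferInstance, h.toImage_imageι⟩
  have : LocallyOfFiniteType (i ≫ ρ) := inferInstance
  haveI : IsLocallyNoetherian W := LocallyOfFiniteType.isLocallyNoetherian (i ≫ ρ)
  let E := FractionRing D
  have : IsDominant (Spec.map (CommRingCat.ofHom (algebraMap D E))) :=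
    isDominant_SpecMap_of_injective _ (IsFractionRing.injective D E)
  obtain ⟨Φ, hΦ⟩ := exists_functionField_hom (Spec.map (CommRingCat.ofHom (algebraMap D E)) ≫ g)
  letI : Algebra W.functionField E := Φ.toAlgebra
  let q := Spec.preimage (W.fromSpecStalk (genericPoint W) ≫ i ≫ ρ)
  letI : Algebra κ W.functionField := q.hom.toAlgebra
  haveI : IsScalarTower κ W.functionField E := by
    refine .of_algebraMap_eq' ?_
    obtain ⟨a, ha⟩ : ∃ a : W.functionField ⟶ .of E, a = CommRingCat.ofHom Φ := ⟨_, rfl⟩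
    have h1 : CommRingCat.ofHom (algebraMap κ D) ≫ CommRingCat.ofHom (algebraMap D E) = q ≫ a := by
      apply Spec.map_injective
      rw [Spec.map_comp, Spec.map_comp, Spec.map_preimage, ← hρ, ← Category.assoc (Spec.map a), ha,
        hΦ]
      simp only [Category.assoc]
    rw [ha] at h1
    exact congr($(h1).hom)
  have hout : ∀ y ∉ Set.range i, ∀ (T : Type u) [CommRing T] [Algebra D T]
      [Algebra (Y.presheaf.stalk y) T], IsFiberRing (g ≫ i) y T → Subsingleton T :=
    fun y hy T _ _ _ H => H.subsingleton_of_notMem (Set.range i) i.isClosedEmbedding.isClosed_range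
      (fun P => ⟨g P, rfl⟩) hy
  have htr := trdeg_add_eq κ W.functionField (A := E)
  rw [trdeg_fractionRing_eq_one (E := E) hs hfin] at htr
  by_cases hal : Algebra.IsAlgebraic W.functionField E
  · have := finiteType_of_aeval_finite hfin
    haveI : FiniteDimensional W.functionField E := finiteDimensional_of_isAlgebraic (κ := κ) (D := D)
    let f : W.functionField :=
      Algebra.norm W.functionField (algebraMap D E s / algebraMap D E (s - 1))
    let c : Y → ℤ := fun y => if hy : y ∈ Set.range i then Scheme.ord f hy.choose else 0
    have hc : ∀ z, c (i z) = Scheme.ord f z := fun z => by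
      have hz : i z ∈ Set.range i := ⟨z, rfl⟩
      simp only [c, dif_pos hz]
      rw [i.isClosedEmbedding.injective hz.choose_spec]
    have hc' : ∀ y ∉ Set.range i, c y = 0 := fun y hy => by simp only [c, dif_neg hy]
    have hlen : ∀ (y : Y) (T : Type u) [CommRing T] [Algebra D T] [Algebra (Y.presheaf.stalk y) T],
        IsFiberRing (g ≫ i) y T → ∃ a b : ℕ,
          Module.length (Y.presheaf.stalk y) (T ⧸ LinearMap.range
            (LinearMap.mulLeft (Y.presheaf.stalk y) (algebraMap D T s))) = a ∧
          Module.length (Y.presheaf.stalk y) (T ⧸ LinearMap.range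
            (LinearMap.mulLeft (Y.presheaf.stalk y) (algebraMap D T (s - 1)))) = b ∧
          c y = a - b := by
      intro y T _ _ _ H
      by_cases hy : y ∈ Set.range i
      · obtain ⟨z, rfl⟩ := hy
        rw [hc]
        exact H.ord_norm_eq ρ i g hΦ hρ s hs hfin z
      · have := hout y hy T H
        exact ⟨0, 0, by simp, by simp, by simp [hc' y hy]⟩
    have hsupp : (Function.support c).Finite := by
      refine (((finite_zeroLocus_sub hfin 0).image (g ≫ i)).union
        ((finite_zeroLocus_sub hfin 1).image (g ≫ i))).subset fun y hy => ?_
      obtain ⟨T, _, _, _, H⟩ := exists_isFiberRing ρ (g ≫ i) y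
      obtain ⟨a, b, ha, hb, hab⟩ := hlen y T H
      have : a ≠ 0 ∨ b ≠ 0 := by
        by_contra! h0
        apply hy
        rw [hab, h0.1, h0.2]; simp
      rcases this with h0 | h0
      · left
        apply H.mem_of_length_ne_zero ρ hfin hρ 0
        rw [map_zero, sub_zero, ha]
        exact_mod_cast h0
      · right
        apply H.mem_of_length_ne_zero ρ hfin hρ 1
        rw [map_one, hb]
        exact_mod_cast h0
    refine ⟨Finsupp.ofSupportFinite c hsupp, ?_, fun y T _ _ _ H => hlen y T H⟩
    refine AddSubgroup.subset_closure ⟨W, i, inferInstance, inferInstance, inferInstance, f, ?_,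
      fun z => hc z, fun y hy => hc' y hy⟩
    have hs0 : s ≠ 0 := by
      rintro rfl; exact hs isAlgebraic_zero
    have hs1 : s - 1 ≠ 0 := by
      intro h; rw [sub_eq_zero.mp h] at hs; exact hs isAlgebraic_one
    have hinj := IsFractionRing.injective D E
    have e₀ : algebraMap D E s ≠ 0 := by rwa [Ne, map_eq_zero_iff _ hinj]
    have e₁ : algebraMap D E (s - 1) ≠ 0 := by rwa [Ne, map_eq_zero_iff _ hinj]
    exact (Algebra.norm_ne_zero_iff (R := W.functionField)).mpr (div_ne_zero e₀ e₁)
  · have h0 : Algebra.trdeg κ W.functionField = 0 := by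
      by_contra hne
      have h1 : (1 : Cardinal) ≤ Algebra.trdeg W.functionField E := by
        rw [Cardinal.one_le_iff_ne_zero, Ne, trdeg_eq_zero_iff]; exact hal
      have h2 : (1 : Cardinal) ≤ Algebra.trdeg κ W.functionField :=
        Cardinal.one_le_iff_ne_zero.mpr hne
      have h3 := add_le_add h2 h1
      rw [htr] at h3
      norm_num [one_add_one_eq_two] at h3
    haveI := trdeg_eq_zero_iff.mp h0
    refine ⟨0, zero_mem _, fun y T _ _ _ H => ?_⟩
    by_cases hy : y ∈ Set.range i
    · obtain ⟨z, rfl⟩ := hy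
      obtain ⟨n, h1, h2⟩ := isLengthCycle_zero_of_isAlgebraic ρ i g hΦ hρ s hs hfin z H
      exact ⟨n, n, h1, h2, by simp⟩
    · have := hout y hy T H
      exact ⟨0, 0, by simp, by simp, by simp⟩

end

end

section

attribute [local instance] smulCommClass_of_algebra

section Devissage

variable {O D T : Type u} [CommRing O] [CommRing D] [CommRing T] [Algebra D T] [Algebra O T]

variable (O T) in
/-- Multiplication by `t` on `T ⊗[D] M`, as an `O`-linear map. -/
def tensorMul (M : Type u) [AddCommGroup M] [Module D M] (t : D) : Module.End O (T ⊗[D] M) :=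
  (LinearMap.lsmul T (T ⊗[D] M) (algebraMap D T t)).restrictScalars O

theorem tensorMul_apply (M : Type u) [AddCommGroup M] [Module D M] (t : D) (x : T ⊗[D] M) :
    tensorMul O T M t x = algebraMap D T t • x := rfl

theorem HasIndex.tensorMul_of_equiv {M N : Type u} [AddCommGroup M] [AddCommGroup N] [Module D M]
    [Module D N] (e : M ≃ₗ[D] N) (t : D) {n : ℤ} (h : HasIndex (tensorMul O T M t) n) :
    HasIndex (tensorMul O T N t) n :=
  h.of_equiv ((TensorProduct.AlgebraTensorModule.congr (LinearEquiv.refl T T) e).restrictScalars O)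
    fun x => map_smul (TensorProduct.AlgebraTensorModule.congr (LinearEquiv.refl T T) e) _ x

theorem HasIndex.tensorMul_of_exact [Module.Flat D T] {M₁ M₂ M₃ : Type u} [AddCommGroup M₁]
    [AddCommGroup M₂] [AddCommGroup M₃] [Module D M₁] [Module D M₂] [Module D M₃]
    (f : M₁ →ₗ[D] M₂) (g : M₂ →ₗ[D] M₃) (hf : Function.Injective f) (hg : Function.Surjective g)
    (h : Function.Exact f g) (t : D) {m n : ℤ} (hm : HasIndex (tensorMul O T M₁ t) m)
    (hn : HasIndex (tensorMul O T M₃ t) n) : HasIndex (tensorMul O T M₂ t) (m + n) := by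
  let F : T ⊗[D] M₁ →ₗ[T] T ⊗[D] M₂ := TensorProduct.AlgebraTensorModule.lTensor T T f
  let G : T ⊗[D] M₂ →ₗ[T] T ⊗[D] M₃ := TensorProduct.AlgebraTensorModule.lTensor T T g
  refine HasIndex.of_exact (F.restrictScalars O) (G.restrictScalars O) ?_ ?_ ?_ ?_ ?_ hm hn
  · exact Module.Flat.lTensor_preserves_injective_linearMap f hf
  · exact LinearMap.lTensor_surjective T hg
  · exact lTensor_exact T h hg
  · ext x; exact map_smul F _ x
  · ext x; exact map_smul G _ x

attribute [local instance] Algebra.TensorProduct.rightAlgebra in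
theorem tensorMul_eq_mulLeft (D' : Type u) [CommRing D'] [Algebra D D'] (t : D) :
    tensorMul O T D' t = LinearMap.mulLeft O (algebraMap D' (T ⊗[D] D') (algebraMap D D' t)) := by
  ext x
  rw [tensorMul_apply, LinearMap.mulLeft_apply]
  change _ = ((1 : T) ⊗ₜ[D] algebraMap D D' t) * x
  induction x using TensorProduct.induction_on with
  | zero => simp
  | add x y hx hy => rw [smul_add, hx, hy, mul_add]
  | tmul a b =>
    rw [Algebra.TensorProduct.tmul_mul_tmul, one_mul, TensorProduct.smul_tmul', smul_eq_mul,
      ← Algebra.smul_def, TensorProduct.smul_tmul, Algebra.smul_def]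

end Devissage

section

variable {κ : Type u} [Field κ] {Y : Scheme.{u}} {D : Type u} [CommRing D] [Algebra κ D]

theorem IsFiberRing.mulLeft_injective {h : Spec (.of D) ⟶ Y} {y : Y} {T : Type u} [CommRing T]
    [Algebra D T] [Algebra (Y.presheaf.stalk y) T] (H : IsFiberRing h y T) {t : D}
    (ht : t ∈ nonZeroDivisors D) :
    Function.Injective (LinearMap.mulLeft (Y.presheaf.stalk y) (algebraMap D T t)) := by
  haveI := H.flat
  have h1 : Function.Injective (LinearMap.lsmul D D t) := fun a b hab => by
    have := (mul_cancel_left_mem_nonZeroDivisors ht).mp (show t * a = t * b from hab)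
    exact this
  have h2 := Module.Flat.lTensor_preserves_injective_linearMap (M := T) _ h1
  intro a b hab
  have h3 := @h2 (a ⊗ₜ 1) (b ⊗ₜ 1) (by
    apply (TensorProduct.rid D T).injective
    have hab' : algebraMap D T t * a = algebraMap D T t * b := hab
    simpa [Algebra.smul_def] using hab')
  simpa using congr(TensorProduct.rid D T $h3)

attribute [local instance] Algebra.TensorProduct.rightAlgebra in
theorem exists_ratTrivial_index [Infinite κ] (ρ : Y ⟶ Spec (.of κ))
    [IsSeparated ρ] [LocallyOfFiniteType ρ] (h : Spec (.of D) ⟶ Y)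
    (hρ : h ≫ ρ = Spec.map (CommRingCat.ofHom (algebraMap κ D))) (s : D)
    (hfin : (aeval (R := κ) s).toRingHom.Finite) (M : Type u) [AddCommGroup M] [Module D M]
    [Module.Finite D M] :
    ∃ Z ∈ ratTrivial Y, ∀ (y : Y) (T : Type u) [CommRing T] [Algebra D T]
      [Algebra (Y.presheaf.stalk y) T], IsFiberRing h y T → ∃ m n : ℤ,
        HasIndex (tensorMul (Y.presheaf.stalk y) T M s) m ∧
        HasIndex (tensorMul (Y.presheaf.stalk y) T M (s - 1)) n ∧ Z y = m - n := by
  have hft := finiteType_of_aeval_finite hfin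
  haveI : IsNoetherianRing D := Algebra.FiniteType.isNoetherianRing κ D
  refine IsNoetherianRing.induction_on_isQuotientEquivQuotientPrime D (M := M) inferInstance
    (motive := fun N _ _ _ => ∃ Z ∈ ratTrivial Y, ∀ (y : Y) (T : Type u) [CommRing T] [Algebra D T]
      [Algebra (Y.presheaf.stalk y) T], IsFiberRing h y T → ∃ m n : ℤ,
        HasIndex (tensorMul (Y.presheaf.stalk y) T N s) m ∧
        HasIndex (tensorMul (Y.presheaf.stalk y) T N (s - 1)) n ∧ Z y = m - n) ?_ ?_ ?_
  · intro N _ _ _ _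
    refine ⟨0, zero_mem _, fun y T _ _ _ H => ⟨0, 0, ?_, ?_, by simp⟩⟩
    · exact HasIndex.zero_of_length_ne_top _ (by simp)
    · exact HasIndex.zero_of_length_ne_top _ (by simp)
  · intro N _ _ _ p e
    let D' := D ⧸ p.asIdeal
    let s' : D' := algebraMap D D' s
    have hfin' : (aeval (R := κ) s').toRingHom.Finite := by
      have h1 : (aeval (R := κ) s').toRingHom =
          (algebraMap D D').comp (aeval (R := κ) s).toRingHom := by
        refine Polynomial.ringHom_ext (fun c => ?_) ?_
        · simp [s']; rfl
        · simp [s']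
      rw [h1]
      exact (RingHom.Finite.of_surjective _ Ideal.Quotient.mk_surjective).comp hfin
    have hρ' : (Spec.map (CommRingCat.ofHom (algebraMap D D')) ≫ h) ≫ ρ =
        Spec.map (CommRingCat.ofHom (algebraMap κ D')) := by
      rw [Category.assoc, hρ, ← Spec.map_comp]; rfl
    by_cases htr : Transcendental κ s'
    · obtain ⟨Z, hZ, hlen⟩ := exists_isLengthCycle_of_isDomain ρ _ hρ' s' htr hfin'
      refine ⟨Z, hZ, fun y T _ _ _ H => ?_⟩
      have H' := H.tensor D'
      obtain ⟨a, b, ha, hb, hab⟩ := hlen y _ H'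
      have hs0 : s' ≠ 0 := by
        intro h0; rw [h0] at htr; exact htr isAlgebraic_zero
      have hs1 : s' - 1 ≠ 0 := by
        intro h0; rw [sub_eq_zero.mp h0] at htr; exact htr isAlgebraic_one
      refine ⟨a, b, HasIndex.tensorMul_of_equiv e.symm _ ?_,
        HasIndex.tensorMul_of_equiv e.symm _ ?_, hab⟩
      · rw [tensorMul_eq_mulLeft]
        exact HasIndex.of_injective (H'.mulLeft_injective (mem_nonZeroDivisors_of_ne_zero hs0)) ha
      · rw [tensorMul_eq_mulLeft, map_sub, map_one]
        exact HasIndex.of_injective (H'.mulLeft_injective (mem_nonZeroDivisors_of_ne_zero hs1)) hb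
    · obtain ⟨g, hg0, hg⟩ : IsAlgebraic κ s' := by
        rwa [Transcendental, not_not] at htr
      have := finite_quotient_of_aeval_mem hfin' ⊥ g hg0 (by rw [hg]; exact zero_mem _)
      haveI : Module.Finite κ D' := Module.Finite.of_surjective
        ((AlgEquiv.quotientBot κ D').toLinearMap) (AlgEquiv.quotientBot κ D').surjective
      haveI : Algebra.IsIntegral κ D' := inferInstance
      letI : Field D' :=
        (isField_of_isIntegral_of_isField' (Field.toIsField κ) : IsField D').toField
      refine ⟨0, zero_mem _, fun y T _ _ _ H => ⟨0, 0, ?_, ?_, by simp⟩⟩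
      · exact HasIndex.tensorMul_of_equiv e.symm _ (HasIndex.zero_of_length_ne_top _
          ((H.tensor D').length_ne_top_of_field ρ hρ'))
      · exact HasIndex.tensorMul_of_equiv e.symm _ (HasIndex.zero_of_length_ne_top _
          ((H.tensor D').length_ne_top_of_field ρ hρ'))
  · intro N₁ _ _ _ N₂ _ _ _ N₃ _ _ _ f g hf hg hfg ⟨Z₁, hZ₁, h₁⟩ ⟨Z₃, hZ₃, h₃⟩
    refine ⟨Z₁ + Z₃, add_mem hZ₁ hZ₃, fun y T _ _ _ H => ?_⟩
    obtain ⟨m₁, n₁, hm₁, hn₁, e₁⟩ := h₁ y T H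
    obtain ⟨m₃, n₃, hm₃, hn₃, e₃⟩ := h₃ y T H
    haveI := H.flat
    refine ⟨m₁ + m₃, n₁ + n₃, hm₁.tensorMul_of_exact f g hf hg hfg _ hm₃,
      hn₁.tensorMul_of_exact f g hf hg hfg _ hn₃, ?_⟩
    rw [Finsupp.add_apply, e₁, e₃]
    ring

/-- The difference of the push-forwards of the divisors of `s` and `s - 1` is rationally trivial. -/
theorem exists_isLengthCycle [Infinite κ] (ρ : Y ⟶ Spec (.of κ))
    [IsSeparated ρ] [LocallyOfFiniteType ρ] (h : Spec (.of D) ⟶ Y)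
    (hρ : h ≫ ρ = Spec.map (CommRingCat.ofHom (algebraMap κ D))) (s : D)
    (hfin : (aeval (R := κ) s).toRingHom.Finite) (hs₀ : s ∈ nonZeroDivisors D)
    (hs₁ : s - 1 ∈ nonZeroDivisors D) : ∃ Z ∈ ratTrivial Y, IsLengthCycle h s Z := by
  obtain ⟨Z, hZ, hlen⟩ := exists_ratTrivial_index ρ h hρ s hfin D
  refine ⟨Z, hZ, fun y T _ _ _ H => ?_⟩
  obtain ⟨m, n, hm, hn, hmn⟩ := hlen y T H
  have key : ∀ (t : D) (l : ℤ), t ∈ nonZeroDivisors D →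
      HasIndex (tensorMul (Y.presheaf.stalk y) T D t) l → ∃ a : ℕ,
      Module.length (Y.presheaf.stalk y) (T ⧸ LinearMap.range
        (LinearMap.mulLeft (Y.presheaf.stalk y) (algebraMap D T t))) = a ∧ l = a := by
    intro t l ht hl
    have h1 : HasIndex (LinearMap.mulLeft (Y.presheaf.stalk y) (algebraMap D T t)) l :=
      hl.of_equiv ((TensorProduct.AlgebraTensorModule.rid D T T).restrictScalars _) fun x =>
        map_smul (TensorProduct.AlgebraTensorModule.rid D T T) _ x
    obtain ⟨a, b, ha, hb, rfl⟩ := h1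
    refine ⟨a, ha, ?_⟩
    rw [LinearMap.ker_eq_bot.mpr (H.mulLeft_injective ht), Module.length_bot] at hb
    have : b = 0 := by exact_mod_cast hb.symm
    simp [this]
  obtain ⟨a, ha, rfl⟩ := key s m hs₀ hm
  obtain ⟨b, hb, rfl⟩ := key (s - 1) n hs₁ hn
  exact ⟨a, b, ha, hb, hmn⟩

end

end

section

attribute [local instance] smulCommClass_of_algebra

/-- `e` is an `A`-basis of `D ⧸ I` on which `D` acts by triangular matrices with diagonal
characters `χ`. -/
structure IsTriangular {A D : Type*} [CommRing A] [CommRing D] [Algebra A D] {n : ℕ} (I : Ideal D)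
    (χ : Fin n → D →ₐ[A] A) (e : Fin n → D) : Prop where
  indep : ∀ a : Fin n → A, ∑ i, a i • e i ∈ I → a = 0
  span : ∀ x, ∃ a : Fin n → A, x - ∑ i, a i • e i ∈ I
  eigen : ∀ i d, ∃ c : Fin n → A, (∀ j, i ≤ j → c j = 0) ∧
    d * e i - χ i d • e i - ∑ j, c j • e j ∈ I

namespace IsTriangular

variable {A D : Type*} [CommRing A] [CommRing D] [Algebra A D] {n : ℕ} {I : Ideal D}

theorem eigen_zero {χ : Fin (n + 1) → D →ₐ[A] A} {e : Fin (n + 1) → D} (h : IsTriangular I χ e)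
    (d : D) : d * e 0 - χ 0 d • e 0 ∈ I := by
  obtain ⟨c, hc, hd⟩ := h.eigen 0 d
  have : c = 0 := funext fun j => hc j (Fin.zero_le _)
  simpa [this] using hd

theorem mem_sup_span_singleton {χ : D →ₐ[A] A} {e : D} (he : ∀ d, d * e - χ d • e ∈ I) (x : D) :
    x ∈ I ⊔ Ideal.span {e} ↔ ∃ a : A, x - a • e ∈ I := by
  rw [Submodule.mem_sup]
  constructor
  · rintro ⟨y, hy, z, hz, rfl⟩
    obtain ⟨d, rfl⟩ := Ideal.mem_span_singleton'.mp hz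
    refine ⟨χ d, ?_⟩
    rw [add_sub_assoc]
    exact add_mem hy (he d)
  · rintro ⟨a, ha⟩
    refine ⟨_, ha, a • e, ?_, by abel⟩
    rw [Algebra.smul_def]
    exact Ideal.mul_mem_left _ _ (Ideal.subset_span rfl)

theorem tail {χ : Fin (n + 1) → D →ₐ[A] A} {e : Fin (n + 1) → D} (h : IsTriangular I χ e) :
    IsTriangular (I ⊔ Ideal.span {e 0}) (fun i => χ i.succ) (fun i => e i.succ) := by
  have hm := mem_sup_span_singleton h.eigen_zero
  refine ⟨fun a ha => ?_, fun x => ?_, fun i d => ?_⟩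
  · obtain ⟨b, hb⟩ := (hm _).mp ha
    have := h.indep (Fin.cons (-b) a) (by
      rw [Fin.sum_univ_succ]
      simpa [sub_eq_neg_add] using hb)
    funext i
    simpa using congr_fun this i.succ
  · obtain ⟨a, ha⟩ := h.span x
    refine ⟨fun i => a i.succ, (hm _).mpr ⟨a 0, ?_⟩⟩
    rw [Fin.sum_univ_succ] at ha
    rwa [sub_sub, add_comm]
  · obtain ⟨c, hc, hd⟩ := h.eigen i.succ d
    refine ⟨fun j => c j.succ, fun j hj => hc _ (Fin.succ_le_succ_iff.mpr hj),
      (hm _).mpr ⟨c 0, ?_⟩⟩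
    rw [Fin.sum_univ_succ] at hd
    rwa [sub_sub, add_comm]

theorem cons {χ : Fin n → D →ₐ[A] A} {e : Fin n → D} (χ₀ : D →ₐ[A] A) (e₀ : D)
    (he : ∀ d, d * e₀ - χ₀ d • e₀ ∈ I) (he' : ∀ a : A, a • e₀ ∈ I → a = 0)
    (h : IsTriangular (I ⊔ Ideal.span {e₀}) χ e) :
    IsTriangular I (Fin.cons χ₀ χ : Fin (n + 1) → D →ₐ[A] A) (Fin.cons e₀ e : Fin (n + 1) → D) := by
  have hm := mem_sup_span_singleton he
  refine ⟨fun a ha => ?_, fun x => ?_, fun i d => ?_⟩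
  · rw [Fin.sum_univ_succ] at ha
    simp only [Fin.cons_zero, Fin.cons_succ] at ha
    have h1 := h.indep (fun i => a i.succ) ((hm _).mpr ⟨-a 0, by
      rwa [neg_smul, sub_neg_eq_add, add_comm]⟩)
    have h2 : ∀ i : Fin n, a i.succ = 0 := fun i => congr_fun h1 i
    simp only [h2, zero_smul, Finset.sum_const_zero, add_zero] at ha
    funext i
    refine Fin.cases (he' _ ha) (fun i => h2 i) i
  · obtain ⟨a, ha⟩ := h.span x
    obtain ⟨b, hb⟩ := (hm _).mp ha
    refine ⟨Fin.cons b a, ?_⟩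
    rw [Fin.sum_univ_succ]
    simp only [Fin.cons_zero, Fin.cons_succ]
    rwa [sub_sub, add_comm] at hb
  · refine Fin.cases ?_ (fun i => ?_) i
    · exact ⟨0, fun _ _ => rfl, by simpa using he d⟩
    · obtain ⟨c, hc, hd⟩ := h.eigen i d
      obtain ⟨b, hb⟩ := (hm _).mp hd
      refine ⟨Fin.cons b c, fun j => ?_, ?_⟩
      · refine Fin.cases (fun hj => ?_) (fun j hj => ?_) j
        · exact absurd hj (by simp)
        · simpa using hc j (Fin.succ_le_succ_iff.mp hj)
      · rw [Fin.sum_univ_succ]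
        simp only [Fin.cons_zero, Fin.cons_succ]
        rwa [sub_sub, add_comm] at hb

theorem eq_top {χ : Fin 0 → D →ₐ[A] A} {e : Fin 0 → D} (h : IsTriangular I χ e) : I = ⊤ := by
  rw [Ideal.eq_top_iff_one]
  obtain ⟨a, ha⟩ := h.span 1
  simpa using ha

end IsTriangular

/-- Over an algebraically closed field every finite-dimensional algebra can be triangularized. -/
theorem exists_isTriangular {K D : Type*} [Field K] [IsAlgClosed K] [CommRing D] [Algebra K D]
    (N : ℕ) : ∀ (I : Ideal D) [Module.Finite K (D ⧸ I)], Module.finrank K (D ⧸ I) ≤ N →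
    ∃ (n : ℕ) (χ : Fin n → D →ₐ[K] K) (e : Fin n → D), IsTriangular I χ e := by
  induction N with
  | zero =>
    intro I _ h
    have h1 : Subsingleton (D ⧸ I) := Module.finrank_zero_iff.mp (Nat.le_zero.mp h)
    have h2 : I = ⊤ := Ideal.Quotient.subsingleton_iff.mp h1
    exact ⟨0, Fin.elim0, Fin.elim0, ⟨fun a _ => Subsingleton.elim _ _,
      fun x => ⟨0, by simp [h2]⟩, fun i => i.elim0⟩⟩
  | succ N ih =>
    intro I _ h
    by_cases hI : I = ⊤
    · exact ⟨0, Fin.elim0, Fin.elim0, ⟨fun a _ => Subsingleton.elim _ _,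
        fun x => ⟨0, by simp [hI]⟩, fun i => i.elim0⟩⟩
    haveI : Nontrivial (D ⧸ I) := Ideal.Quotient.nontrivial_iff.mpr hI
    haveI : IsArtinianRing (D ⧸ I) := IsArtinianRing.of_finite K _
    haveI : IsArtinian D (D ⧸ I) := isArtinian_of_tower K inferInstance
    obtain ⟨S, hS, -⟩ := (IsAtomic.eq_bot_or_exists_atom_le (⊤ : Submodule D (D ⧸ I))).resolve_left
      top_ne_bot
    haveI : IsSimpleModule D S := isSimpleModule_iff_isAtom.mpr hS
    obtain ⟨J, hJ, ⟨φ⟩⟩ := isSimpleModule_iff_quot_maximal.mp ‹IsSimpleModule D S›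
    obtain ⟨e, he⟩ := Ideal.Quotient.mk_surjective ((φ.symm 1 : S) : D ⧸ I)
    have hmul : ∀ d, d * e ∈ I ↔ d ∈ J := fun d => by
      have h1 : Ideal.Quotient.mk I (d * e) = ((φ.symm (Ideal.Quotient.mk J d) : S) : D ⧸ I) := by
        have h2 : Ideal.Quotient.mk J d = d • (1 : D ⧸ J) := by
          rw [Algebra.smul_def, mul_one]; rfl
        rw [h2, map_smul, Submodule.coe_smul, ← he, map_mul, Algebra.smul_def]
        rfl
      rw [← Ideal.Quotient.eq_zero_iff_mem, h1, ZeroMemClass.coe_eq_zero,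
        LinearEquiv.map_eq_zero_iff, Ideal.Quotient.eq_zero_iff_mem]
    have hIJ : I ≤ J := fun x hx => (hmul x).mp (Ideal.mul_mem_right _ _ hx)
    haveI : Module.Finite K (D ⧸ J) := Module.Finite.of_surjective
      (Ideal.Quotient.factorₐ K hIJ).toLinearMap (Ideal.Quotient.factor_surjective hIJ)
    letI : Field (D ⧸ J) := Ideal.Quotient.field J
    haveI : Algebra.IsIntegral K (D ⧸ J) := inferInstance
    let ψ : K ≃ₐ[K] D ⧸ J := AlgEquiv.ofBijective (Algebra.ofId K (D ⧸ J))
      (IsAlgClosed.algebraMap_bijective_of_isIntegral)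
    let χ₀ : D →ₐ[K] K := (ψ.symm : (D ⧸ J) →ₐ[K] K).comp (Ideal.Quotient.mkₐ K J)
    have hχ : ∀ d, d - algebraMap K D (χ₀ d) ∈ J := fun d => by
      rw [← Ideal.Quotient.eq_zero_iff_mem, map_sub, sub_eq_zero]
      exact (ψ.apply_symm_apply (Ideal.Quotient.mk J d)).symm
    have he₁ : ∀ d, d * e - χ₀ d • e ∈ I := fun d => by
      rw [Algebra.smul_def, ← sub_mul, hmul]
      exact hχ d
    have he₂ : ∀ a : K, a • e ∈ I → a = 0 := fun a ha => by
      rw [Algebra.smul_def, hmul] at ha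
      by_contra h0
      exact hJ.ne_top (Ideal.eq_top_of_isUnit_mem _ ha ((IsUnit.mk0 a h0).map _))
    have hle : I ≤ I ⊔ Ideal.span {e} := le_sup_left
    let f := (Ideal.Quotient.factorₐ K hle).toLinearMap
    have hf : Function.Surjective f := Ideal.Quotient.factor_surjective hle
    haveI : Module.Finite K (D ⧸ (I ⊔ Ideal.span {e})) := Module.Finite.of_surjective f hf
    have hlt : Module.finrank K (D ⧸ (I ⊔ Ideal.span {e})) ≤ N := by
      have h1 := f.finrank_range_add_finrank_ker
      rw [LinearMap.range_eq_top.mpr hf, finrank_top] at h1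
      have h2 : 0 < Module.finrank K (LinearMap.ker f) := by
        rw [Module.finrank_pos_iff]
        refine Submodule.nontrivial_iff_ne_bot.mpr fun h0 => ?_
        have h3 : Ideal.Quotient.mk I e ∈ LinearMap.ker f := by
          rw [LinearMap.mem_ker]
          change Ideal.Quotient.mk (I ⊔ Ideal.span {e}) e = 0
          rw [Ideal.Quotient.eq_zero_iff_mem]
          exact Ideal.mem_sup_right (Ideal.subset_span rfl)
        rw [h0, Submodule.mem_bot, Ideal.Quotient.eq_zero_iff_mem] at h3
        exact one_ne_zero (he₂ 1 (by rwa [one_smul]))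
      omega
    obtain ⟨n, χ, e', h'⟩ := ih (I ⊔ Ideal.span {e}) hlt
    exact ⟨n + 1, _, _, IsTriangular.cons χ₀ e he₁ he₂ h'⟩

section Length

variable {κ κ' : Type u} [Field κ] [Field κ'] [Algebra κ κ'] {Y : Scheme.{u}} {D : Type u}
  [CommRing D] [Algebra κ' D] {h : Spec (.of D) ⟶ Y} {y : Y} {T : Type u} [CommRing T] [Algebra D T]
  [Algebra (Y.presheaf.stalk y) T]

open Classical in
/-- The push-forward of the class of a point with values in a finite extension. -/
def pushPoint (f : Spec (.of κ') ⟶ Y) : Cycles Y :=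
  Finsupp.single (f (IsLocalRing.closedPoint κ')) ((pointDegree f).toNat : ℤ)

theorem IsFiberRing.length_tensor_field [Module.Finite κ κ'] (ρ : Y ⟶ Spec (.of κ))
    [LocallyOfFiniteType ρ] (H : IsFiberRing h y T) (χ : D →+* κ')
    (hρ : (Spec.map (CommRingCat.ofHom χ) ≫ h) ≫ ρ =
      Spec.map (CommRingCat.ofHom (algebraMap κ κ'))) :
    letI := χ.toAlgebra
    ∃ n : ℕ, Module.length (Y.presheaf.stalk y) (T ⊗[D] κ') = n ∧
      pushPoint (Spec.map (CommRingCat.ofHom χ) ≫ h) y = n := by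
  classical
  letI := χ.toAlgebra
  letI := Algebra.TensorProduct.rightAlgebra (R := D) (A := T) (B := κ')
  have H' : IsFiberRing (Spec.map (CommRingCat.ofHom χ) ≫ h) y (T ⊗[D] κ') := H.tensor κ'
  generalize Spec.map (CommRingCat.ofHom χ) ≫ h = f at *
  by_cases hy : f (IsLocalRing.closedPoint κ') = y
  · subst hy
    have h1 := pointDegree_ne_top ρ f hρ
    refine ⟨(pointDegree f).toNat, ?_, by simp [pushPoint]⟩
    rw [H'.length_of_field, ENat.coe_toNat h1]
  · have := H'.subsingleton_of_field ρ hρ _ hy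
    exact ⟨0, by simp, by simp [pushPoint, hy]⟩

theorem IsFiberRing.length_tensor_quotient [Algebra κ D] [IsScalarTower κ κ' D]
    [Module.Finite κ κ'] (ρ : Y ⟶ Spec (.of κ)) [LocallyOfFiniteType ρ] (H : IsFiberRing h y T)
    (hρ : h ≫ ρ = Spec.map (CommRingCat.ofHom (algebraMap κ D))) (n : ℕ) :
    ∀ (I : Ideal D) (χ : Fin n → D →ₐ[κ'] κ') (e : Fin n → D), IsTriangular I χ e →
    ∃ m : ℕ, Module.length (Y.presheaf.stalk y) (T ⊗[D] (D ⧸ I)) = m ∧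
      (∑ i, pushPoint (Spec.map (CommRingCat.ofHom (χ i).toRingHom) ≫ h)) y = m := by
  induction n with
  | zero =>
    intro I χ e hI
    have hI' := hI.eq_top
    haveI : Subsingleton (D ⧸ I) := Ideal.Quotient.subsingleton_iff.mpr hI'
    exact ⟨0, by simp, by simp⟩
  | succ n ih =>
    intro I χ e hI
    have hm := IsTriangular.mem_sup_span_singleton hI.eigen_zero
    obtain ⟨m, h1, h2⟩ := ih _ _ _ hI.tail
    have hχ : (χ 0).toRingHom.comp (algebraMap κ D) = algebraMap κ κ' := by
      ext c
      rw [RingHom.comp_apply, IsScalarTower.algebraMap_apply κ κ' D]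
      exact (χ 0).commutes _
    obtain ⟨m', h1', h2'⟩ := H.length_tensor_field ρ (χ 0).toRingHom (by
      rw [Category.assoc, hρ, ← Spec.map_comp, ← CommRingCat.ofHom_comp, hχ])
    refine ⟨m' + m, ?_, ?_⟩
    · letI := (χ 0).toRingHom.toAlgebra
      let F : κ' →ₗ[D] D ⧸ I :=
        { toFun := fun a => Ideal.Quotient.mk I (a • e 0)
          map_add' := fun a b => by rw [add_smul, map_add]
          map_smul' := fun d a => by
            rw [RingHom.id_apply]
            change Ideal.Quotient.mk I ((χ 0 d * a) • e 0) = d • Ideal.Quotient.mk I (a • e 0)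
            have h3 : d • Ideal.Quotient.mk I (a • e 0) = Ideal.Quotient.mk I (d * a • e 0) := rfl
            rw [h3, eq_comm, ← sub_eq_zero, ← map_sub, Ideal.Quotient.eq_zero_iff_mem, mul_comm,
              mul_smul, smul_mul_assoc, smul_comm (χ 0 d), ← smul_sub, mul_comm, Algebra.smul_def]
            exact Ideal.mul_mem_left _ _ (hI.eigen_zero d) }
      let G : (D ⧸ I) →ₗ[D] D ⧸ (I ⊔ Ideal.span {e 0}) := Submodule.factor le_sup_left
      have hF : Function.Injective F := by
        rw [injective_iff_map_eq_zero]
        intro a ha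
        have ha' : a • e 0 ∈ I := Ideal.Quotient.eq_zero_iff_mem.mp ha
        have := hI.indep (Fin.cons a 0) (by simpa [Fin.sum_univ_succ] using ha')
        simpa using congr_fun this 0
      have hG : Function.Surjective G := Submodule.factor_surjective _
      have hFG : Function.Exact F G := fun x => by
        obtain ⟨x, rfl⟩ := Ideal.Quotient.mk_surjective x
        change Ideal.Quotient.mk (I ⊔ Ideal.span {e 0}) x = 0 ↔ _
        rw [Ideal.Quotient.eq_zero_iff_mem, hm]
        refine exists_congr fun a => ?_
        change _ ↔ Ideal.Quotient.mk I (a • e 0) = Ideal.Quotient.mk I x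
        rw [eq_comm, ← sub_eq_zero, ← map_sub, Ideal.Quotient.eq_zero_iff_mem]
      haveI := H.flat
      let F' : T ⊗[D] κ' →ₗ[T] T ⊗[D] (D ⧸ I) := TensorProduct.AlgebraTensorModule.lTensor T T F
      let G' : T ⊗[D] (D ⧸ I) →ₗ[T] T ⊗[D] (D ⧸ (I ⊔ Ideal.span {e 0})) :=
        TensorProduct.AlgebraTensorModule.lTensor T T G
      have h4 := Module.length_eq_add_of_exact (F'.restrictScalars (Y.presheaf.stalk y))
        (G'.restrictScalars (Y.presheaf.stalk y))
        (Module.Flat.lTensor_preserves_injective_linearMap F hF)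
        (LinearMap.lTensor_surjective T hG) (lTensor_exact T hFG hG)
      rw [h4, h1, h1']
      push_cast
      rfl
    · rw [Fin.sum_univ_succ, Finsupp.add_apply, h2', h2]
      push_cast
      rfl

end Length

end

section

attribute [local instance] smulCommClass_of_algebra

theorem finite_aeval_of_finite {κ κ' D : Type*} [Field κ] [Field κ'] [Algebra κ κ'] [CommRing D]
    [Algebra κ' D] [Algebra κ D] [IsScalarTower κ κ' D] [Module.Finite κ κ'] (s : D)
    (hfin : (aeval (R := κ') s).toRingHom.Finite) : (aeval (R := κ) s).toRingHom.Finite := by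
  letI : Algebra κ[X] κ'[X] := (Polynomial.mapRingHom (algebraMap κ κ')).toAlgebra
  have h : (Polynomial.mapRingHom (algebraMap κ κ')).Finite := by
    change Module.Finite κ[X] κ'[X]
    obtain ⟨S, hS⟩ := Module.Finite.fg_top (R := κ) (M := κ')
    classical
    refine ⟨S.image C, eq_top_iff.mpr fun p _ => ?_⟩
    induction p using Polynomial.induction_on' with
    | add p q hp hq => exact add_mem (hp trivial) (hq trivial)
    | monomial n a =>
      have ha : a ∈ Submodule.span κ (S : Set κ') := hS ▸ trivial
      induction ha using Submodule.span_induction with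
      | mem x hx =>
        have : monomial n x = (X ^ n : κ[X]) • (C x : κ'[X]) := by
          rw [Algebra.smul_def, RingHom.algebraMap_toAlgebra, coe_mapRingHom, Polynomial.map_pow,
            map_X, mul_comm, C_mul_X_pow_eq_monomial]
        rw [this]
        exact Submodule.smul_mem _ _ (Submodule.subset_span (Finset.mem_coe.mpr
          (Finset.mem_image_of_mem C hx)))
      | zero => simp
      | add x y _ _ hx hy => rw [map_add]; exact add_mem (hx trivial) (hy trivial)
      | smul c x _ hx =>
        have : monomial n (c • x) = (C c : κ[X]) • (monomial n x : κ'[X]) := by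
          rw [Algebra.smul_def, Algebra.smul_def, RingHom.algebraMap_toAlgebra, coe_mapRingHom,
            map_C, C_mul_monomial]
        rw [this]
        exact Submodule.smul_mem _ _ (hx trivial)
  have h2 := RingHom.Finite.comp hfin h
  convert h2 using 1
  refine Polynomial.ringHom_ext (fun a => ?_) ?_
  · simp [← IsScalarTower.algebraMap_apply]
  · simp

variable {κ κ' D : Type u} [Field κ] [Field κ'] [Algebra κ κ'] [CommRing D]
    [Algebra κ' D] [Algebra κ D] [IsScalarTower κ κ' D] [Module.Finite κ κ'] {Y : Scheme.{u}}

theorem length_quot_range_mulLeft {O D T : Type*} [CommRing O] [CommRing D] [CommRing T]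
    [Algebra D T] [Algebra O T] (t : D) :
    Module.length O (T ⧸ LinearMap.range (LinearMap.mulLeft O (algebraMap D T t))) =
      Module.length O (T ⊗[D] (D ⧸ Ideal.span {t})) := by
  let f : T →ₗ[O] T ⊗[D] (D ⧸ Ideal.span {t}) :=
    ((TensorProduct.AlgebraTensorModule.mk D T T (D ⧸ Ideal.span {t})).flip 1).restrictScalars O
  have hf : ∀ x, f x = x ⊗ₜ 1 := fun x => rfl
  have hsurj : Function.Surjective f := fun x => by
    induction x using TensorProduct.induction_on with
    | zero => exact ⟨0, map_zero f⟩
    | add x y hx hy =>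
      obtain ⟨a, rfl⟩ := hx
      obtain ⟨b, rfl⟩ := hy
      exact ⟨a + b, map_add f a b⟩
    | tmul a b =>
      obtain ⟨b, rfl⟩ := Ideal.Quotient.mk_surjective b
      refine ⟨b • a, ?_⟩
      rw [hf, TensorProduct.smul_tmul, Algebra.smul_def, mul_one]
      rfl
  have hker : LinearMap.ker f = LinearMap.range (LinearMap.mulLeft O (algebraMap D T t)) := by
    ext x
    rw [LinearMap.mem_ker, hf, ← (TensorProduct.tensorQuotEquivQuotSMul T
      (Ideal.span {t})).map_eq_zero_iff, ← map_one (Ideal.Quotient.mk (Ideal.span {t})),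
      TensorProduct.tensorQuotEquivQuotSMul_tmul_mk, one_smul, Submodule.Quotient.mk_eq_zero,
      Submodule.ideal_span_singleton_smul, Submodule.mem_smul_pointwise_iff_exists, LinearMap.mem_range]
    refine exists_congr fun y => ?_
    rw [LinearMap.mulLeft_apply, ← Algebra.smul_def]
    simp
  rw [← hker]
  exact (f.quotKerEquivOfSurjective hsurj).length_eq

theorem sum_pushPoint_sub_mem_ratTrivial [Infinite κ] (ρ : Y ⟶ Spec (.of κ))
    [IsSeparated ρ] [LocallyOfFiniteType ρ] (h : Spec (.of D) ⟶ Y)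
    (hρ : h ≫ ρ = Spec.map (CommRingCat.ofHom (algebraMap κ D))) (s : D)
    (hfin : (aeval (R := κ') s).toRingHom.Finite) (hs₀ : s ∈ nonZeroDivisors D)
    (hs₁ : s - 1 ∈ nonZeroDivisors D) {n₀ n₁ : ℕ} {χ₀ : Fin n₀ → D →ₐ[κ'] κ'} {e₀ : Fin n₀ → D}
    {χ₁ : Fin n₁ → D →ₐ[κ'] κ'} {e₁ : Fin n₁ → D} (h₀ : IsTriangular (Ideal.span {s}) χ₀ e₀)
    (h₁ : IsTriangular (Ideal.span {s - 1}) χ₁ e₁) :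
    ∑ i, pushPoint (Spec.map (CommRingCat.ofHom (χ₀ i).toRingHom) ≫ h) -
      ∑ i, pushPoint (Spec.map (CommRingCat.ofHom (χ₁ i).toRingHom) ≫ h) ∈ ratTrivial Y := by
  obtain ⟨Z, hZ, hlen⟩ := exists_isLengthCycle ρ h hρ s (finite_aeval_of_finite s hfin) hs₀ hs₁
  convert hZ
  ext y
  obtain ⟨T, _, _, _, H⟩ := exists_isFiberRing ρ h y
  obtain ⟨a, b, ha, hb, hab⟩ := hlen y T H
  obtain ⟨m₀, hm₀, hm₀'⟩ := H.length_tensor_quotient ρ hρ _ _ _ _ h₀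
  obtain ⟨m₁, hm₁, hm₁'⟩ := H.length_tensor_quotient ρ hρ _ _ _ _ h₁
  rw [length_quot_range_mulLeft, hm₀] at ha
  rw [length_quot_range_mulLeft, hm₁] at hb
  rw [hab, Finsupp.sub_apply, hm₀', hm₁', ← Nat.cast_inj.mp ha, ← Nat.cast_inj.mp hb]

end

section

/-- A triangularization of the `A`-algebra `D ⧸ t D`, where `t` is a nonzerodivisor, by
characters `χ i`: the `e i` are a basis of a complement of `t D` in `D`. -/
structure Triangulation (A : Type*) {D : Type*} [CommRing A] [CommRing D] [Algebra A D] (t : D) where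
  n : ℕ
  χ : Fin n → D →ₐ[A] A
  e : Fin n → D
  coord : Fin n → D →ₗ[A] A
  quot : D →ₗ[A] D
  decomp : ∀ x, x = ∑ i, coord i x • e i + t * quot x
  coord_mul : ∀ i x, coord i (t * x) = 0
  quot_mul : ∀ x, quot (t * x) = x
  coord_e : ∀ i j, coord i (e j) = if i = j then 1 else 0
  coord_lt : ∀ i j, i < j → ∀ d, coord j (d * e i) = 0
  coord_eq : ∀ i d, coord i (d * e i) = χ i d

namespace Triangulation

variable {A D : Type*} [CommRing A] [CommRing D] [Algebra A D] {t : D}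

theorem mem_nonZeroDivisors (τ : Triangulation A t) : t ∈ nonZeroDivisors D :=
  mem_nonZeroDivisors_iff_right.mpr fun x hx => by
    rw [← τ.quot_mul x, mul_comm, hx, map_zero]

theorem isTriangular (τ : Triangulation A t) : IsTriangular (Ideal.span {t}) τ.χ τ.e := by
  refine ⟨fun a ha => ?_, fun x => ⟨fun i => τ.coord i x, ?_⟩, fun i d =>
    ⟨fun j => if i ≤ j then 0 else τ.coord j (d * τ.e i), fun j hj => if_pos hj, ?_⟩⟩
  · obtain ⟨y, hy⟩ := Ideal.mem_span_singleton.mp ha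
    funext j
    have := congr_arg (τ.coord j) hy
    rw [τ.coord_mul, map_sum] at this
    simpa [τ.coord_e] using this
  · refine Ideal.mem_span_singleton.mpr ⟨τ.quot x, ?_⟩
    rw [sub_eq_iff_eq_add']
    exact τ.decomp x
  · refine Ideal.mem_span_singleton.mpr ⟨τ.quot (d * τ.e i), ?_⟩
    rw [sub_sub, sub_eq_iff_eq_add']
    conv_lhs => rw [τ.decomp (d * τ.e i)]
    congr 1
    rw [← Finset.add_sum_erase _ _ (Finset.mem_univ i), τ.coord_eq,
      ← Finset.add_sum_erase (a := i) (f := fun j => (if i ≤ j then 0 else _) • _) _ (Finset.mem_univ i),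
      if_pos le_rfl, zero_smul, zero_add]
    congr 1
    refine Finset.sum_congr rfl fun j hj => ?_
    split_ifs with h
    · rw [τ.coord_lt i j (lt_of_le_of_ne h (Finset.ne_of_mem_erase hj).symm)]
    · rfl

/-- A triangularization of `D ⧸ t D` as a triangulation. -/
theorem exists_of_isTriangular (ht : t ∈ nonZeroDivisors D) {n : ℕ} {χ : Fin n → D →ₐ[A] A}
    {e : Fin n → D} (h : IsTriangular (Ideal.span {t}) χ e) : Nonempty (Triangulation A t) := by
  let f : (Fin n → A) × D →ₗ[A] D :=
    (Fintype.linearCombination A e).coprod (LinearMap.mulLeft A t)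
  have hf : ∀ p, f p = ∑ i, p.1 i • e i + t * p.2 := fun p => by
    simp [f, Fintype.linearCombination_apply]
  have hinj : Function.Injective f := (injective_iff_map_eq_zero f).mpr fun p hp => by
    rw [hf] at hp
    have h1 : p.1 = 0 := h.indep _ (Ideal.mem_span_singleton.mpr ⟨-p.2, by
      rw [mul_neg]; exact eq_neg_of_add_eq_zero_left hp⟩)
    refine Prod.ext h1 ?_
    simp only [h1, Pi.zero_apply, zero_smul, Finset.sum_const_zero, zero_add] at hp
    exact (mem_nonZeroDivisors_iff_right.mp ht) _ (by rw [mul_comm]; exact hp)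
  have hsurj : Function.Surjective f := fun x => by
    obtain ⟨a, ha⟩ := h.span x
    obtain ⟨y, hy⟩ := Ideal.mem_span_singleton.mp ha
    exact ⟨(a, y), by rw [hf, ← hy]; abel⟩
  let g := LinearEquiv.ofBijective f ⟨hinj, hsurj⟩
  have hg : ∀ p, g.symm (f p) = p := fun p => g.symm_apply_apply p
  have hfg : ∀ x, f (g.symm x) = x := fun x => g.apply_symm_apply x
  have he : ∀ j, f (Pi.single j 1, 0) = e j := fun j => by
    rw [hf]
    simp [Pi.single_apply, ite_smul]
  have hc : ∀ i d, ∃ c : Fin n → A, (∀ j, i ≤ j → c j = 0) ∧ ∃ y,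
      f (fun j => c j + if j = i then χ i d else 0, y) = d * e i := fun i d => by
    obtain ⟨c, hc, hd⟩ := h.eigen i d
    obtain ⟨y, hy⟩ := Ideal.mem_span_singleton.mp hd
    refine ⟨c, hc, y, ?_⟩
    rw [hf, ← hy]
    simp only [add_smul, ite_smul, Finset.sum_add_distrib, zero_smul, Finset.sum_ite_eq',
      Finset.mem_univ, if_true]
    abel
  refine ⟨⟨n, χ, e, fun i => LinearMap.proj i ∘ₗ LinearMap.fst A _ _ ∘ₗ g.symm.toLinearMap,
    LinearMap.snd A _ _ ∘ₗ g.symm.toLinearMap, fun x => ?_, fun i x => ?_, fun x => ?_,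
    fun i j => ?_, fun i j hij d => ?_, fun i d => ?_⟩⟩
  · conv_lhs => rw [← hfg x, hf]
    rfl
  · have := hg (0, x)
    rw [hf] at this
    simp only [Pi.zero_apply, zero_smul, Finset.sum_const_zero, zero_add] at this
    simp [this]
  · have := hg (0, x)
    rw [hf] at this
    simp only [Pi.zero_apply, zero_smul, Finset.sum_const_zero, zero_add] at this
    simp [this]
  · rw [← he j]
    simp [hg, Pi.single_apply]
  · obtain ⟨c, hc, y, hy⟩ := hc i d
    rw [← hy]
    simp [hg, hc j hij.le, hij.ne']
  · obtain ⟨c, hc, y, hy⟩ := hc i d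
    rw [← hy]
    simp [hg, hc i le_rfl]

/-- Base change of a triangulation. -/
def baseChange (A' : Type*) [CommRing A'] [Algebra A A'] (τ : Triangulation A t) :
    Triangulation A' (1 ⊗ₜ t : A' ⊗[A] D) where
  n := τ.n
  χ i := Algebra.TensorProduct.lift (AlgHom.id A' A') ((Algebra.ofId A A').comp (τ.χ i))
    fun _ _ => Commute.all _ _
  e i := 1 ⊗ₜ τ.e i
  coord i := (Algebra.TensorProduct.rid A A' A').toLinearMap ∘ₗ (τ.coord i).baseChange A'
  quot := τ.quot.baseChange A'
  decomp x := by
    induction x using TensorProduct.induction_on with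
    | zero => simp
    | add x y hx hy =>
      conv_lhs => rw [hx, hy]
      simp only [map_add, add_smul, mul_add, Finset.sum_add_distrib]
      abel
    | tmul a x =>
      conv_lhs => rw [τ.decomp x]
      simp [TensorProduct.tmul_add, TensorProduct.tmul_sum, TensorProduct.smul_tmul']
  coord_mul i x := by
    induction x using TensorProduct.induction_on with
    | zero => simp
    | add x y hx hy => rw [mul_add, map_add, hx, hy, add_zero]
    | tmul a x => simp [τ.coord_mul]
  quot_mul x := by
    induction x using TensorProduct.induction_on with
    | zero => simp
    | add x y hx hy => rw [mul_add, map_add, hx, hy]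
    | tmul a x => simp [τ.quot_mul]
  coord_e i j := by
    by_cases h : i = j <;> simp [τ.coord_e, h]
  coord_lt i j h d := by
    induction d using TensorProduct.induction_on with
    | zero => simp
    | add x y hx hy => rw [add_mul, map_add, hx, hy, add_zero]
    | tmul a x => simp [τ.coord_lt i j h]
  coord_eq i d := by
    induction d using TensorProduct.induction_on with
    | zero => simp
    | add x y hx hy => rw [add_mul, map_add, hx, hy, map_add]
    | tmul a x => simp [τ.coord_eq, Algebra.ofId_apply, Algebra.smul_def, mul_comm]

end Triangulation

end

section

attribute [local instance] smulCommClass_of_algebra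

section Points

variable {k : Type u} [Field k] {X : Scheme.{u}} (π : X ⟶ Spec (.of k))

/-- The `A`-valued points of the `k`-scheme `X`. -/
def Pt (A : Type u) [CommRing A] [Algebra k A] : Type u :=
  {f : Spec (.of A) ⟶ X // f ≫ π = Spec.map (CommRingCat.ofHom (algebraMap k A))}

variable {π} {A B : Type u} [CommRing A] [Algebra k A] [CommRing B] [Algebra k B]

/-- The map on points induced by a homomorphism of `k`-algebras. -/
def Pt.map (φ : A →ₐ[k] B) (f : Pt π A) : Pt π B :=
  ⟨Spec.map (CommRingCat.ofHom φ.toRingHom) ≫ f.1, by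
    rw [Category.assoc, f.2, ← Spec.map_comp, ← CommRingCat.ofHom_comp]
    congr 2
    exact φ.comp_algebraMap⟩

theorem Pt.map_map {C : Type u} [CommRing C] [Algebra k C] (φ : A →ₐ[k] B) (ψ : B →ₐ[k] C)
    (f : Pt π A) : (f.map φ).map ψ = f.map (ψ.comp φ) := by
  refine Subtype.ext ?_
  change Spec.map _ ≫ Spec.map _ ≫ f.1 = Spec.map _ ≫ f.1
  rw [← Spec.map_comp_assoc]
  rfl

variable (π) (A) in
/-- A family of elementary rational equivalences: a family of curves `Spec D`, finite over the
affine line over `A` via `s`, with a map to `X`. -/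
structure Homotopy where
  D : Type u
  [commRing : CommRing D]
  [algebra : Algebra A D]
  [algebra' : Algebra k D]
  [tower : IsScalarTower k A D]
  s : D
  gen : Finset D
  span_gen : Submodule.span A {x | ∃ (i : ℕ), ∃ d ∈ gen, x = s ^ i * d} = ⊤
  pt : Pt π D
  zero : Triangulation A s
  one : Triangulation A (s - 1)

attribute [instance] Homotopy.commRing Homotopy.algebra Homotopy.algebra' Homotopy.tower

/-- The sum of the points of a triangulation. -/
def Triangulation.sumPt {D : Type u} [CommRing D] [Algebra A D] [Algebra k D] [IsScalarTower k A D]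
    {t : D} (τ : Triangulation A t) (f : Pt π D) : Pt π A →₀ ℤ :=
  ∑ i, Finsupp.single (f.map ((τ.χ i).restrictScalars k)) 1

/-- The difference of the fibres over `0` and `1`. -/
def Homotopy.value (H : Homotopy π A) : Pt π A →₀ ℤ := H.zero.sumPt H.pt - H.one.sumPt H.pt

variable (π A) in
/-- The relations among `A`-valued points generated by the elementary rational equivalences. -/
def relations : AddSubgroup (Pt π A →₀ ℤ) := AddSubgroup.closure (Set.range Homotopy.value)

/-- Base change of an elementary rational equivalence. -/
theorem Homotopy.exists_baseChange (H : Homotopy π A) (φ : A →ₐ[k] B) :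
    ∃ H' : Homotopy π B, H'.value = Finsupp.mapDomain (Pt.map φ) H.value := by
  letI : Algebra A B := φ.toRingHom.toAlgebra
  haveI : IsScalarTower k A B := .of_algebraMap_eq' φ.comp_algebraMap.symm
  let ι : H.D →ₐ[k] B ⊗[A] H.D :=
    (Algebra.TensorProduct.includeRight : H.D →ₐ[A] B ⊗[A] H.D).restrictScalars k
  have h1 : (1 ⊗ₜ (H.s - 1) : B ⊗[A] H.D) = 1 ⊗ₜ H.s - 1 := TensorProduct.tmul_sub _ _ _
  classical
  let H' : Homotopy π B :=
    { D := B ⊗[A] H.D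
      s := 1 ⊗ₜ H.s
      gen := H.gen.image ι
      span_gen := by
        rw [eq_top_iff]
        intro x _
        induction x using TensorProduct.induction_on with
        | zero => exact zero_mem _
        | add x y hx hy => exact add_mem (hx trivial) (hy trivial)
        | tmul b d =>
          have hd : d ∈ Submodule.span A {x | ∃ (i : ℕ), ∃ d ∈ H.gen, x = H.s ^ i * d} := by
            rw [H.span_gen]; trivial
          have hb : ∀ z : H.D, b ⊗ₜ z = b • (1 ⊗ₜ[A] z) := fun z => by
            rw [TensorProduct.smul_tmul', smul_eq_mul, mul_one]
          rw [hb]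
          refine Submodule.smul_mem _ _ ?_
          induction hd using Submodule.span_induction with
          | mem x hx =>
            obtain ⟨i, d, hd, rfl⟩ := hx
            refine Submodule.subset_span ⟨i, ι d, Finset.mem_image_of_mem _ hd, ?_⟩
            change (1 ⊗ₜ (H.s ^ i * d) : B ⊗[A] H.D) = (1 ⊗ₜ H.s) ^ i * (1 ⊗ₜ d)
            simp
          | zero => simp
          | add x y _ _ hx hy => rw [TensorProduct.tmul_add]; exact add_mem (hx trivial) (hy trivial)
          | smul a x _ hx =>
            rw [← TensorProduct.smul_tmul, ← mul_one (a • (1 : B)), ← smul_eq_mul,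
              ← TensorProduct.smul_tmul']
            exact Submodule.smul_mem _ _ (hx trivial)
      pt := H.pt.map ι
      zero := H.zero.baseChange B
      one := h1 ▸ H.one.baseChange B }
  have key : ∀ (t : H.D) (τ : Triangulation A t), (τ.baseChange B).sumPt (H.pt.map ι) =
      Finsupp.mapDomain (Pt.map φ) (τ.sumPt H.pt) := fun t τ => by
    rw [Triangulation.sumPt, Triangulation.sumPt, Finsupp.mapDomain_finset_sum]
    refine Finset.sum_congr rfl fun i _ => ?_
    rw [Finsupp.mapDomain_single, Pt.map_map, Pt.map_map]
    congr 2
    ext d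
    simp [ι, Triangulation.baseChange, Algebra.ofId_apply, RingHom.algebraMap_toAlgebra]
  have key' : ∀ (t : B ⊗[A] H.D) (h : 1 ⊗ₜ (H.s - 1) = t),
      (h ▸ H.one.baseChange B : Triangulation B t).sumPt (H.pt.map ι) =
        Finsupp.mapDomain (Pt.map φ) (H.one.sumPt H.pt) := by
    rintro _ rfl
    exact key _ _
  refine ⟨H', ?_⟩
  rw [Homotopy.value, Homotopy.value, Finsupp.mapDomain_sub, ← key]
  exact congr_arg _ (key' _ h1)

theorem mapDomain_mem_relations (φ : A →ₐ[k] B) {c : Pt π A →₀ ℤ} (hc : c ∈ relations π A) :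
    Finsupp.mapDomain (Pt.map φ) c ∈ relations π B := by
  have : relations π A ≤ (relations π B).comap (Finsupp.mapDomain.addMonoidHom (Pt.map φ)) := by
    refine (AddSubgroup.closure_le _).mpr ?_
    rintro _ ⟨H, rfl⟩
    obtain ⟨H', hH'⟩ := H.exists_baseChange φ
    exact AddSubgroup.subset_closure ⟨H', hH'⟩
  exact this hc

end Points

section Push

variable {k : Type u} [Field k] {X Y : Scheme.{u}} {π : X ⟶ Spec (.of k)} {κ : Type u} [Field κ]
  [Algebra k κ] {p : Y ⟶ X} {ρ : Y ⟶ Spec (.of κ)}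
  (sq : IsPullback p ρ π (Spec.map (CommRingCat.ofHom (algebraMap k κ))))
  {B : Type u} [CommRing B] [Algebra k B] [Algebra κ B] [IsScalarTower k κ B]

include sq in
/-- The point of the base change given by a point over a bigger ring. -/
def Pt.lift (f : Pt π B) : Spec (.of B) ⟶ Y :=
  sq.lift f.1 (Spec.map (CommRingCat.ofHom (algebraMap κ B))) (by
    rw [f.2, ← Spec.map_comp, ← CommRingCat.ofHom_comp, ← IsScalarTower.algebraMap_eq])

theorem Pt.lift_fst (f : Pt π B) : f.lift sq ≫ p = f.1 := sq.lift_fst _ _ _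

theorem Pt.lift_snd (f : Pt π B) :
    f.lift sq ≫ ρ = Spec.map (CommRingCat.ofHom (algebraMap κ B)) := sq.lift_snd _ _ _

theorem Pt.map_lift {D : Type u} [CommRing D] [Algebra k D] [Algebra κ D] [IsScalarTower k κ D]
    (f : Pt π D) (φ : D →ₐ[κ] B) : (f.map (φ.restrictScalars k)).lift sq =
      Spec.map (CommRingCat.ofHom φ.toRingHom) ≫ f.lift sq := by
  refine sq.hom_ext ?_ ?_
  · rw [Pt.lift_fst, Category.assoc, Pt.lift_fst]; rfl
  · rw [Pt.lift_snd, Category.assoc, Pt.lift_snd, ← Spec.map_comp, ← CommRingCat.ofHom_comp]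
    congr 2
    exact φ.comp_algebraMap.symm

variable (κ' : Type u) [Field κ'] [Algebra k κ'] [Algebra κ κ'] [IsScalarTower k κ κ']

/-- Push-forward of `κ'`-valued points of `X` to the base change `Y` of `X` to `κ`. -/
def pushForward : (Pt π κ' →₀ ℤ) →+ Cycles Y :=
  Finsupp.liftAddHom fun f => zmultiplesHom _ (pushPoint (f.lift sq))

theorem pushForward_single (f : Pt π κ') :
    pushForward sq κ' (Finsupp.single f 1) = pushPoint (f.lift sq) := by
  simp [pushForward]

theorem finite_aeval_of_span_eq_top {A D : Type*} [CommRing A] [CommRing D] [Algebra A D] (s : D)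
    (S : Finset D) (hS : Submodule.span A {x | ∃ (i : ℕ), ∃ d ∈ S, x = s ^ i * d} = ⊤) :
    (aeval (R := A) s).toRingHom.Finite := by
  letI := (aeval (R := A) s).toRingHom.toAlgebra
  change Module.Finite A[X] D
  refine ⟨S, eq_top_iff.mpr fun x _ => ?_⟩
  have hx : x ∈ Submodule.span A {x | ∃ (i : ℕ), ∃ d ∈ S, x = s ^ i * d} := hS ▸ trivial
  have smul_def : ∀ (f : A[X]) (y : D), f • y = aeval s f * y := fun f y => rfl
  induction hx using Submodule.span_induction with
  | mem x hx =>
    obtain ⟨i, d, hd, rfl⟩ := hx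
    have := Submodule.smul_mem (Submodule.span A[X] (S : Set D)) (X ^ i) (Submodule.subset_span hd)
    simpa [smul_def] using this
  | zero => exact zero_mem _
  | add x y _ _ hx hy => exact add_mem (hx trivial) (hy trivial)
  | smul a x _ hx =>
    have := Submodule.smul_mem _ (C a) (hx trivial)
    rwa [smul_def, aeval_C, ← Algebra.smul_def] at this

theorem pushForward_mem_ratTrivial [Infinite κ] [IsSeparated π] [LocallyOfFiniteType π]
    [Module.Finite κ κ'] {c : Pt π κ' →₀ ℤ} (hc : c ∈ relations π κ') :
    pushForward sq κ' c ∈ ratTrivial Y := by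
  have : relations π κ' ≤ (ratTrivial Y).comap (pushForward sq κ') := by
    refine (AddSubgroup.closure_le _).mpr ?_
    rintro _ ⟨H, rfl⟩
    letI : Algebra κ H.D := Algebra.compHom _ (algebraMap κ κ')
    haveI : IsScalarTower κ κ' H.D := .of_algebraMap_eq fun _ => rfl
    haveI : IsScalarTower k κ H.D := .of_algebraMap_eq fun x => by
      rw [IsScalarTower.algebraMap_apply k κ' H.D, IsScalarTower.algebraMap_apply k κ κ']
      rfl
    haveI : IsSeparated ρ := MorphismProperty.of_isPullback sq ‹_›
    haveI : LocallyOfFiniteType ρ := MorphismProperty.of_isPullback sq ‹_›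
    have := sum_pushPoint_sub_mem_ratTrivial ρ (H.pt.lift sq) (H.pt.lift_snd sq) H.s
      (finite_aeval_of_span_eq_top H.s H.gen H.span_gen) H.zero.mem_nonZeroDivisors
      H.one.mem_nonZeroDivisors H.zero.isTriangular H.one.isTriangular
    have key : ∀ (t : H.D) (τ : Triangulation κ' t), pushForward sq κ' (τ.sumPt H.pt) =
        ∑ i, pushPoint (Spec.map (CommRingCat.ofHom (τ.χ i).toRingHom) ≫ H.pt.lift sq) := by
      intro t τ
      rw [Triangulation.sumPt, map_sum]
      refine Finset.sum_congr rfl fun i _ => ?_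
      rw [pushForward_single]
      congr 1
      exact Pt.map_lift sq H.pt ((τ.χ i).restrictScalars κ)
    change pushForward sq κ' H.value ∈ ratTrivial Y
    rwa [Homotopy.value, map_sub, key, key]
  exact this hc

end Push

end

section

section FiniteType

variable {k : Type u} [Field k] {D : Type u} [CommRing D] [Algebra k D]

variable (k D) in
/-- The finitely generated subalgebras of `D`. -/
abbrev FGSubalgebra : Type u := {B : Subalgebra k D // B.FG}

instance : IsDirectedOrder (FGSubalgebra k D) :=
  ⟨fun B C => ⟨⟨B.1 ⊔ C.1, B.2.sup C.2⟩, le_sup_left (a := B.1), le_sup_right (a := B.1)⟩⟩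

instance : Nonempty (FGSubalgebra k D) := ⟨⟨⊥, Subalgebra.fg_bot⟩⟩

variable (k D) in
/-- The diagram of the finitely generated subalgebras. -/
def fgDiagram : FGSubalgebra k D ⥤ CommRingCat.{u} where
  obj B := .of B.1
  map f := CommRingCat.ofHom (Subalgebra.inclusion f.le).toRingHom
  map_id _ := rfl
  map_comp _ _ := rfl

variable (k D) in
/-- The cocone with vertex `D` on the diagram of the finitely generated subalgebras. -/
def fgCocone : Cocone (fgDiagram k D) where
  pt := .of D
  ι := { app B := CommRingCat.ofHom B.1.val.toRingHom
         naturality _ _ _ := rfl }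

theorem isColimit_fgCocone : Nonempty (IsColimit (fgCocone k D)) := by
  haveI : ReflectsColimit (fgDiagram k D) (forget CommRingCat.{u}) :=
    reflectsColimit_of_reflectsIsomorphisms _ _
  refine ⟨isColimitOfReflects (forget CommRingCat.{u})
    (Types.FilteredColimit.isColimitOf' _ _ (fun x => ?_) fun i x y h => ?_)⟩
  · change D at x
    refine ⟨⟨Algebra.adjoin k {x}, by
      simpa using Subalgebra.fg_adjoin_finset (R := k) {x}⟩,
      ⟨x, Algebra.subset_adjoin rfl⟩, rfl⟩
  · exact ⟨i, 𝟙 i, congr_arg _ (Subtype.ext h)⟩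

/-- A morphism from `Spec D` to a scheme of finite presentation is defined over a finitely
generated subalgebra of `D`. -/
theorem Pt.exists_fg {X : Scheme.{u}} {π : X ⟶ Spec (.of k)} [LocallyOfFinitePresentation π]
    (f : Pt π D) : ∃ (B : Subalgebra k D), B.FG ∧ ∃ g : Pt π B, g.map B.val = f := by
  obtain ⟨hc⟩ := isColimit_fgCocone (k := k) (D := D)
  have hc' := isLimitOfPreserves Scheme.Spec hc.op
  let t : (fgDiagram k D).op ⋙ Scheme.Spec ⟶ (Functor.const _).obj (Spec (.of k)) :=
    { app B := Spec.map (CommRingCat.ofHom (algebraMap k B.unop.1))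
      naturality B C φ := by
        dsimp
        rw [Category.comp_id]
        exact (Spec.map_comp _ _).symm }
  haveI : ∀ {i j} (φ : i ⟶ j), IsAffineHom (((fgDiagram k D).op ⋙ Scheme.Spec).map φ) :=
    fun φ => inferInstanceAs (IsAffineHom (Spec.map _))
  haveI : ∀ i, CompactSpace (((fgDiagram k D).op ⋙ Scheme.Spec).obj i) :=
    fun i => inferInstanceAs (CompactSpace (Spec _))
  haveI : ∀ i, QuasiSeparatedSpace (((fgDiagram k D).op ⋙ Scheme.Spec).obj i) :=
    fun i => inferInstanceAs (QuasiSeparatedSpace (Spec _))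
  obtain ⟨B, g, hg, hg'⟩ := Scheme.exists_π_app_comp_eq_of_locallyOfFinitePresentation
    _ t π _ hc' f.1 (by
      ext B : 2
      exact ((Spec.map_comp _ _).symm.trans f.2.symm :
        Spec.map (CommRingCat.ofHom B.unop.1.val.toRingHom) ≫
          Spec.map (CommRingCat.ofHom (algebraMap k B.unop.1)) = f.1 ≫ π))
  exact ⟨B.unop.1, B.unop.2, ⟨g, hg'⟩, Subtype.ext hg⟩

theorem eventually_mem_fgSubalgebra (x : D) :
    ∀ᶠ B : FGSubalgebra k D in Filter.atTop, x ∈ B.1 := by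
  filter_upwards [Filter.eventually_ge_atTop (⟨Algebra.adjoin k {x}, by
    simpa using Subalgebra.fg_adjoin_finset (R := k) {x}⟩ : FGSubalgebra k D)] with B hB
  exact hB (Algebra.subset_adjoin rfl)

end FiniteType

section Descent

variable {k K D : Type u} [Field k] [Field K] [Algebra k K] [CommRing D] [Algebra K D]
  [Algebra k D] [IsScalarTower k K D]

/-- Restriction of a triangulation to subrings. -/
def Triangulation.restrict {A : Subalgebra k K} (S : Subalgebra A D) (t : S)
    (τ : Triangulation K (t : D)) (he : ∀ i, τ.e i ∈ S) (hc : ∀ i, ∀ x ∈ S, τ.coord i x ∈ A)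
    (hq : ∀ x ∈ S, τ.quot x ∈ S) : Triangulation A t where
  n := τ.n
  χ i :=
    { toFun x := ⟨τ.χ i x, τ.coord_eq i x ▸ hc i _ (mul_mem x.2 (he i))⟩
      map_one' := Subtype.ext (map_one _)
      map_mul' _ _ := Subtype.ext (map_mul _ _ _)
      map_zero' := Subtype.ext (map_zero _)
      map_add' _ _ := Subtype.ext (map_add _ _ _)
      commutes' a := Subtype.ext ((τ.χ i).commutes (a : K)) }
  e i := ⟨τ.e i, he i⟩
  coord i :=
    { toFun x := ⟨τ.coord i x, hc i _ x.2⟩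
      map_add' _ _ := Subtype.ext (map_add _ _ _)
      map_smul' a x := Subtype.ext ((τ.coord i).map_smul (a : K) x) }
  quot :=
    { toFun x := ⟨τ.quot x, hq _ x.2⟩
      map_add' _ _ := Subtype.ext (map_add _ _ _)
      map_smul' a x := Subtype.ext (τ.quot.map_smul (a : K) x) }
  decomp x := Subtype.ext <| by
    push_cast
    exact τ.decomp x
  coord_mul i x := Subtype.ext (τ.coord_mul i x)
  quot_mul x := Subtype.ext (τ.quot_mul x)
  coord_e i j := Subtype.ext <| by
    refine (τ.coord_e i j).trans ?_
    split_ifs <;> rfl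
  coord_lt i j h d := Subtype.ext (τ.coord_lt i j h d)
  coord_eq i d := Subtype.ext (τ.coord_eq i d)

theorem Triangulation.mapDomain_sumPt_restrict {X : Scheme.{u}} {π : X ⟶ Spec (.of k)}
    {A : Subalgebra k K} (S : Subalgebra A D) (t : S)
    (τ : Triangulation K (t : D)) (he : ∀ i, τ.e i ∈ S) (hc : ∀ i, ∀ x ∈ S, τ.coord i x ∈ A)
    (hq : ∀ x ∈ S, τ.quot x ∈ S) (f : Pt π S) :
    Finsupp.mapDomain (Pt.map A.val) ((τ.restrict S t he hc hq).sumPt f) =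
      τ.sumPt (f.map (S.val.restrictScalars k)) := by
  rw [Triangulation.sumPt, Triangulation.sumPt, Finsupp.mapDomain_finset_sum]
  refine Finset.sum_congr rfl fun i _ => ?_
  rw [Finsupp.mapDomain_single, Pt.map_map, Pt.map_map]
  rfl

variable (s : D) (S : Finset D)

/-- The `A`-submodule generated by the products of powers of `s` and elements of `S`. -/
abbrev powSpan (A : Subalgebra k K) : Submodule A D :=
  Submodule.span A {x | ∃ (i : ℕ), ∃ d ∈ S, x = s ^ i * d}

theorem eventually_mem_powSpan (hS : Submodule.span K {x | ∃ (i : ℕ), ∃ d ∈ S, x = s ^ i * d} = ⊤)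
    (x : D) : ∀ᶠ A : FGSubalgebra k K in Filter.atTop, x ∈ powSpan s S A.1 := by
  have hx : x ∈ Submodule.span K {x | ∃ (i : ℕ), ∃ d ∈ S, x = s ^ i * d} := hS ▸ trivial
  induction hx using Submodule.span_induction with
  | mem x hx => exact .of_forall fun A => Submodule.subset_span hx
  | zero => exact .of_forall fun A => zero_mem _
  | add x y _ _ hx hy => filter_upwards [hx, hy] with A hx hy using add_mem hx hy
  | smul a x _ hx =>
    filter_upwards [hx, eventually_mem_fgSubalgebra a] with A hx ha
    exact Submodule.smul_mem _ (⟨a, ha⟩ : A.1) hx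

variable {s S} in
theorem pow_mul_mem_powSpan {A : Subalgebra k K} (n : ℕ) {x : D} (hx : x ∈ powSpan s S A) :
    s ^ n * x ∈ powSpan s S A := by
  induction hx using Submodule.span_induction with
  | mem x hx =>
    obtain ⟨i, d, hd, rfl⟩ := hx
    exact Submodule.subset_span ⟨n + i, d, hd, by rw [pow_add, mul_assoc]⟩
  | zero => rw [mul_zero]; exact zero_mem _
  | add x y _ _ hx hy => rw [mul_add]; exact add_mem hx hy
  | smul a x _ hx => rw [mul_smul_comm]; exact Submodule.smul_mem _ _ hx

variable {s S} in
theorem mul_mem_powSpan {A : Subalgebra k K} (h : ∀ d ∈ S, ∀ d' ∈ S, d * d' ∈ powSpan s S A) {x y : D}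
    (hx : x ∈ powSpan s S A) (hy : y ∈ powSpan s S A) : x * y ∈ powSpan s S A := by
  induction hx, hy using Submodule.span_induction₂ with
  | mem_mem x y hx hy =>
    obtain ⟨i, d, hd, rfl⟩ := hx
    obtain ⟨j, d', hd', rfl⟩ := hy
    rw [mul_mul_mul_comm, ← pow_add]
    exact pow_mul_mem_powSpan _ (h d hd d' hd')
  | zero_left => rw [zero_mul]; exact zero_mem _
  | zero_right => rw [mul_zero]; exact zero_mem _
  | add_left x y z _ _ _ hx hy => rw [add_mul]; exact add_mem hx hy
  | add_right x y z _ _ _ hx hy => rw [mul_add]; exact add_mem hx hy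
  | smul_left a x y _ _ hx => rw [smul_mul_assoc]; exact Submodule.smul_mem _ _ hx
  | smul_right a x y _ _ hx => rw [mul_smul_comm]; exact Submodule.smul_mem _ _ hx

theorem Triangulation.eventually_restrict
    (hS : Submodule.span K {x | ∃ (i : ℕ), ∃ d ∈ S, x = s ^ i * d} = ⊤) {t : D} (c : ℤ)
    (hts : ∀ x, s * x = t * x + c • x) (τ : Triangulation K t) :
    ∀ᶠ A : FGSubalgebra k K in Filter.atTop, (∀ i, τ.e i ∈ powSpan s S A.1) ∧
      (∀ i, ∀ x ∈ powSpan s S A.1, τ.coord i x ∈ A.1) ∧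
      ∀ x ∈ powSpan s S A.1, τ.quot x ∈ powSpan s S A.1 := by
  have h1 : ∀ᶠ A : FGSubalgebra k K in Filter.atTop, ∀ i, τ.e i ∈ powSpan s S A.1 :=
    Filter.eventually_all.mpr fun i => eventually_mem_powSpan s S hS _
  have h2 : ∀ᶠ A : FGSubalgebra k K in Filter.atTop, ∀ d ∈ S, ∀ i, τ.coord i d ∈ A.1 :=
    (Filter.eventually_all_finset _).mpr fun d _ => Filter.eventually_all.mpr fun i =>
      eventually_mem_fgSubalgebra _
  have h3 : ∀ᶠ A : FGSubalgebra k K in Filter.atTop, ∀ d ∈ S, τ.quot d ∈ powSpan s S A.1 :=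
    (Filter.eventually_all_finset _).mpr fun d _ => eventually_mem_powSpan s S hS _
  filter_upwards [h1, h2, h3] with A h1 h2 h3
  refine ⟨h1, fun i x hx => ?_, fun x hx => ?_⟩
  · induction hx using Submodule.span_induction with
    | mem x hx =>
      obtain ⟨j, d, hd, rfl⟩ := hx
      induction j with
      | zero => simpa using h2 d hd i
      | succ j ih =>
        rw [pow_succ', mul_assoc, hts, map_add, τ.coord_mul, zero_add, map_zsmul]
        exact zsmul_mem ih c
    | zero => rw [map_zero]; exact zero_mem _
    | add x y _ _ hx hy => rw [map_add]; exact add_mem hx hy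
    | smul a x _ hx =>
      have : τ.coord i (a • x) = a * τ.coord i x := (τ.coord i).map_smul (a : K) x
      rw [this]
      exact mul_mem a.2 hx
  · induction hx using Submodule.span_induction with
    | mem x hx =>
      obtain ⟨j, d, hd, rfl⟩ := hx
      induction j with
      | zero => simpa using h3 d hd
      | succ j ih =>
        rw [pow_succ', mul_assoc, hts, map_add, τ.quot_mul, map_zsmul]
        exact add_mem (Submodule.subset_span ⟨j, d, hd, rfl⟩) (zsmul_mem ih c)
    | zero => rw [map_zero]; exact zero_mem _
    | add x y _ _ hx hy => rw [map_add]; exact add_mem hx hy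
    | smul a x _ hx =>
      have : τ.quot (a • x) = a • τ.quot x := τ.quot.map_smul (a : K) x
      rw [this]
      exact Submodule.smul_mem _ _ hx

end Descent

section

variable {k : Type u} [Field k] {X : Scheme.{u}} {π : X ⟶ Spec (.of k)} {K : Type u} [Field K]
  [Algebra k K]

theorem Homotopy.exists_restrict [LocallyOfFinitePresentation π] (H : Homotopy π K) :
    ∀ᶠ A : FGSubalgebra k K in Filter.atTop, ∃ H' : Homotopy π A.1,
      Finsupp.mapDomain (Pt.map A.1.val) H'.value = H.value := by
  have hS := H.span_gen
  obtain ⟨B, ⟨F, rfl⟩, g, hg⟩ := H.pt.exists_fg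
  have h1 : ∀ᶠ A : FGSubalgebra k K in Filter.atTop, ∀ d ∈ F, d ∈ powSpan H.s H.gen A.1 :=
    (Filter.eventually_all_finset _).mpr fun d _ => eventually_mem_powSpan _ _ hS _
  have h2 : ∀ᶠ A : FGSubalgebra k K in Filter.atTop, ∀ d ∈ H.gen, ∀ d' ∈ H.gen,
      d * d' ∈ powSpan H.s H.gen A.1 :=
    (Filter.eventually_all_finset _).mpr fun d _ => (Filter.eventually_all_finset _).mpr
      fun d' _ => eventually_mem_powSpan _ _ hS _
  filter_upwards [h1, h2, eventually_mem_powSpan _ _ hS 1, eventually_mem_powSpan _ _ hS H.s,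
    H.zero.eventually_restrict _ _ hS 0 (by simp),
    H.one.eventually_restrict _ _ hS 1 (fun x => by rw [sub_mul, one_mul, one_smul]; abel)]
    with A h1 h2 h3 h4 h5 h6
  let S : Subalgebra A.1 H.D := (powSpan H.s H.gen A.1).toSubalgebra h3
    fun x y hx hy => mul_mem_powSpan h2 hx hy
  have hFS : Algebra.adjoin k (F : Set H.D) ≤ S.restrictScalars k := Algebra.adjoin_le h1
  have hgen : ∀ d ∈ H.gen, d ∈ S := fun d hd => Submodule.subset_span ⟨0, d, hd, by simp⟩
  let ι : Algebra.adjoin k (F : Set H.D) →ₐ[k] S := Subalgebra.inclusion hFS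
  let s' : S := ⟨H.s, h4⟩
  classical
  let H' : Homotopy π A.1 :=
    { D := S
      s := s'
      gen := H.gen.attach.image fun d => ⟨d.1, hgen _ d.2⟩
      span_gen := by
        refine eq_top_iff.mpr fun x _ => ?_
        obtain ⟨x, hx⟩ := x
        have hx' : x ∈ powSpan H.s H.gen A.1 := hx
        induction hx' using Submodule.span_induction with
        | mem x hx' =>
          obtain ⟨i, d, hd, rfl⟩ := hx'
          exact Submodule.subset_span ⟨i, ⟨d, hgen d hd⟩,
            Finset.mem_image.mpr ⟨⟨d, hd⟩, Finset.mem_attach _ _, rfl⟩, rfl⟩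
        | zero => exact zero_mem _
        | add x y hxS hyS hx' hy' => exact add_mem (hx' hxS trivial) (hy' hyS trivial)
        | smul a x hxS hx' => exact Submodule.smul_mem _ a (hx' hxS trivial)
      pt := g.map ι
      zero := Triangulation.restrict S s' H.zero h5.1 h5.2.1 h5.2.2
      one := Triangulation.restrict S (s' - 1) H.one h6.1 h6.2.1 h6.2.2 }
  refine ⟨H', ?_⟩
  have hpt : (g.map ι).map (S.val.restrictScalars k) = H.pt := by
    rw [Pt.map_map, ← hg]
    rfl
  rw [Homotopy.value, Homotopy.value, Finsupp.mapDomain_sub]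
  congr 1
  · rw [← hpt]
    exact Triangulation.mapDomain_sumPt_restrict S s' H.zero h5.1 h5.2.1 h5.2.2 (g.map ι)
  · rw [← hpt]
    exact Triangulation.mapDomain_sumPt_restrict S (s' - 1) H.one h6.1 h6.2.1 h6.2.2 (g.map ι)

theorem exists_relations_of_mem [LocallyOfFinitePresentation π] {c : Pt π K →₀ ℤ}
    (hc : c ∈ relations π K) : ∀ᶠ A : FGSubalgebra k K in Filter.atTop,
      ∃ c' ∈ relations π A.1, Finsupp.mapDomain (Pt.map A.1.val) c' = c := by
  induction hc using AddSubgroup.closure_induction with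
  | mem c hc =>
    obtain ⟨H, rfl⟩ := hc
    filter_upwards [H.exists_restrict] with A ⟨H', hH'⟩
    exact ⟨_, AddSubgroup.subset_closure ⟨H', rfl⟩, hH'⟩
  | zero => exact .of_forall fun A => ⟨0, zero_mem _, Finsupp.mapDomain_zero⟩
  | add c d _ _ hc hd =>
    filter_upwards [hc, hd] with A ⟨c', hc', hc⟩ ⟨d', hd', hd⟩
    exact ⟨c' + d', add_mem hc' hd', by rw [Finsupp.mapDomain_add, hc, hd]⟩
  | neg c _ hc =>
    filter_upwards [hc] with A ⟨c', hc', hc⟩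
    exact ⟨-c', neg_mem hc', by rw [← hc]; exact map_neg (Finsupp.mapDomain.addMonoidHom _) _⟩

theorem Pt.map_injective [IsSeparated π] {A B : Type u} [CommRing A] [IsDomain A] [Algebra k A]
    [CommRing B] [Algebra k B] (φ : A →ₐ[k] B) (hφ : Function.Injective φ) :
    Function.Injective (Pt.map φ : Pt π A → Pt π B) := fun f g h => by
  haveI := isDominant_SpecMap_of_injective (CommRingCat.ofHom φ.toRingHom) hφ
  refine Subtype.ext (ext_of_isDominant_of_isSeparated π ?_
    (Spec.map (CommRingCat.ofHom φ.toRingHom)) ?_)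
  · rw [f.2, g.2]
  · exact congr_arg Subtype.val h

end

end

section

section Height

theorem height_eq_of_isMaximal_mvPolynomial (K : Type*) [Field K] (n : ℕ) :
    ∀ (m : Ideal (MvPolynomial (Fin n) K)) [m.IsMaximal], m.height = n := by
  induction n with
  | zero =>
    intro m _
    have hf : IsField (MvPolynomial (Fin 0) K) :=
      (MvPolynomial.isEmptyRingEquiv K (Fin 0)).toMulEquiv.isField (Field.toIsField K)
    letI := hf.toField
    have : m = ⊥ := (Ideal.eq_bot_or_top m).resolve_right Ideal.IsPrime.ne_top'
    rw [this, Ideal.height_bot]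
    rfl
  | succ n ih =>
    intro m hm
    let e := (MvPolynomial.finSuccEquiv K n).toRingEquiv
    let P : Ideal (MvPolynomial (Fin n) K)[X] := m.map e
    haveI : P.IsMaximal := Ideal.map_isMaximal_of_equiv e
    have h1 : P.height = m.height := e.height_map m
    let p := P.comap (C : MvPolynomial (Fin n) K →+* _)
    haveI : p.IsMaximal := Polynomial.isMaximal_comap_C_of_isJacobsonRing P
    haveI : P.LiesOver p := ⟨rfl⟩
    rw [← h1, Polynomial.height_eq_height_add_one p P, ih p]
    rfl

theorem height_eq_height_under {R S : Type*} [CommRing R] [CommRing S] [IsNoetherianRing R]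
    [IsNoetherianRing S] [Algebra R S] [Algebra.HasGoingDown R S] [Algebra.QuasiFinite R S]
    (P : Ideal S) [P.IsPrime] : P.height = (P.under R).height := by
  have h := Ideal.height_eq_height_add_of_liesOver_of_hasGoingDown (P.under R) P
  set q := (P.under R).map (algebraMap R S)
  have hq : q ≤ P := Ideal.map_comap_le
  have hker : RingHom.ker (Ideal.Quotient.mk q) ≤ P := by rwa [Ideal.mk_ker]
  haveI : (P.map (Ideal.Quotient.mk q)).IsPrime :=
    Ideal.map_isPrime_of_surjective Ideal.Quotient.mk_surjective hker
  have h0 : (P.map (Ideal.Quotient.mk q)).height = 0 := by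
    rw [Ideal.height_eq_zero_iff]
    refine ⟨⟨inferInstance, bot_le⟩, fun J ⟨hJ, _⟩ hJP => ?_⟩
    haveI := hJ
    have h1 : J.comap (Ideal.Quotient.mk q) ≤ P := by
      refine (Ideal.comap_mono hJP).trans ?_
      rw [Ideal.comap_map_of_surjective' _ Ideal.Quotient.mk_surjective]
      exact sup_le le_rfl hker
    have h2 : (J.comap (Ideal.Quotient.mk q)).under R = P.under R := by
      refine le_antisymm (Ideal.comap_mono h1) ?_
      refine Ideal.le_comap_of_map_le (le_trans ?_ (Ideal.comap_mono bot_le))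
      rw [← RingHom.ker_eq_comap_bot, Ideal.mk_ker]
    have h3 := Algebra.QuasiFinite.eq_of_le_of_under_eq _ _ h1 h2
    rw [Ideal.map_le_iff_le_comap, h3]
  rw [h, h0, add_zero]

/-- A finitely generated domain with a maximal ideal of height one has transcendence degree
one. -/
theorem trdeg_le_one_of_height_eq_one {K B : Type u} [Field K] [CommRing B] [IsDomain B] [Algebra K B]
    [Algebra.FiniteType K B] (m : Ideal B) [m.IsMaximal] (hm : m.height = 1) :
    Algebra.trdeg K B ≤ 1 := by
  obtain ⟨n, g, hg, hfin⟩ := exists_finite_inj_algHom_of_fg K B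
  algebraize [g.toRingHom]
  haveI : Module.Finite (MvPolynomial (Fin n) K) B := hfin
  haveI : FaithfulSMul (MvPolynomial (Fin n) K) B :=
    (faithfulSMul_iff_algebraMap_injective _ _).mpr hg
  haveI : IsNoetherianRing B := Algebra.FiniteType.isNoetherianRing K B
  haveI : (m.under (MvPolynomial (Fin n) K)).IsMaximal := inferInstance
  have h1 := height_eq_height_under (R := MvPolynomial (Fin n) K) m
  rw [height_eq_of_isMaximal_mvPolynomial, hm] at h1
  have hn : n = 1 := by exact_mod_cast h1.symm
  haveI : IsScalarTower K (MvPolynomial (Fin n) K) B := .of_algebraMap_eq' g.comp_algebraMap.symm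
  have h2 := trdeg_add_eq (R := K) (S := MvPolynomial (Fin n) K) (A := B)
  have h3 : Algebra.trdeg (MvPolynomial (Fin n) K) B = 0 := _root_.trdeg_eq_zero
  rw [← h2, h3, MvPolynomial.trdeg_of_isDomain, hn]
  simp

end Height

end

section

theorem exists_isAffineOpen_mem {W : Scheme.{u}} (z : W) :
    ∃ U : W.Opens, IsAffineOpen U ∧ z ∈ U := by
  obtain ⟨_, ⟨U, hU, rfl⟩, hzU, -⟩ :=
    W.isBasis_affineOpens.exists_subset_of_mem_open (Set.mem_univ z) isOpen_univ
  exact ⟨U, hU, hzU⟩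

section FunctionField

variable {K : Type u} [Field K] {W : Scheme.{u}} [IsIntegral W] (σ : W ⟶ Spec (.of K))
  [Algebra K W.functionField]
  (hσ : W.fromSpecStalk (genericPoint W) ≫ σ =
    Spec.map (CommRingCat.ofHom (algebraMap K W.functionField)))

include hσ in
theorem exists_algebra_affineOpen {U : W.Opens} (hU : IsAffineOpen U) [Nonempty U] :
    ∃ _ : Algebra K Γ(W, U), IsScalarTower K Γ(W, U) W.functionField ∧
      hU.fromSpec ≫ σ = Spec.map (CommRingCat.ofHom (algebraMap K Γ(W, U))) := by
  let q := Spec.preimage (hU.fromSpec ≫ σ)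
  letI : Algebra K Γ(W, U) := q.hom.toAlgebra
  refine ⟨inferInstance, .of_algebraMap_eq' ?_, (Spec.map_preimage _).symm⟩
  have hx : genericPoint W ∈ U :=
    ((genericPoint_spec W).mem_open_set_iff U.isOpen).mpr (by simpa using ‹Nonempty U›)
  have h1 : CommRingCat.ofHom (algebraMap K W.functionField) = q ≫ W.presheaf.germ U _ hx := by
    apply Spec.map_injective
    rw [Spec.map_comp, Spec.map_preimage, ← hσ, ← hU.fromSpecStalk_eq_fromSpecStalk hx,
      IsAffineOpen.fromSpecStalk, Category.assoc]
  exact congr($(h1).hom)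

include hσ in
theorem trdeg_functionField_le_one [LocallyOfFiniteType σ] (z : W) (hz : IsClosed {z})
    (hz' : coheight z = 1) : Algebra.trdeg K W.functionField ≤ 1 := by
  obtain ⟨U, hU, hzU⟩ := exists_isAffineOpen_mem z
  haveI : Nonempty U := ⟨⟨z, hzU⟩⟩
  obtain ⟨_, _, hq⟩ := exists_algebra_affineOpen σ hσ hU
  haveI : Algebra.FiniteType K Γ(W, U) := by
    have : LocallyOfFiniteType (hU.fromSpec ≫ σ) := inferInstance
    rw [hq, HasRingHomProperty.Spec_iff (P := @LocallyOfFiniteType)] at this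
    exact RingHom.finiteType_algebraMap.mp this
  haveI := hU.primeIdealOf_isMaximal_of_isClosed ⟨z, hzU⟩ hz
  letI : Algebra Γ(W, U) (W.presheaf.stalk z) := (W.presheaf.germ U z hzU).hom.toAlgebra
  haveI : IsLocalization.AtPrime (W.presheaf.stalk z) (hU.primeIdealOf ⟨z, hzU⟩).asIdeal :=
    hU.isLocalization_stalk ⟨z, hzU⟩
  have h1 := IsLocalization.AtPrime.ringKrullDim_eq_height (hU.primeIdealOf ⟨z, hzU⟩).asIdeal
    (W.presheaf.stalk z)
  rw [ringKrullDim_stalk_eq_coheight, hz'] at h1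
  have h2 := trdeg_le_one_of_height_eq_one (K := K) (hU.primeIdealOf ⟨z, hzU⟩).asIdeal
    (by exact_mod_cast h1.symm)
  haveI := functionField_isFractionRing_of_isAffineOpen W U hU
  haveI : Algebra.IsAlgebraic Γ(W, U) W.functionField := 
    IsLocalization.isAlgebraic _ (nonZeroDivisors Γ(W, U))
  have h3 := trdeg_add_eq K Γ(W, U) (A := W.functionField)
  rwa [← h3, _root_.trdeg_eq_zero (R := Γ(W, U)), add_zero]

include hσ in
theorem ord_algebraMap_eq_zero [IsLocallyNoetherian W] (c : K) (z : W) :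
    Scheme.ord (algebraMap K W.functionField c) z = 0 := by
  by_cases hc : c = 0
  · rw [hc, map_zero, Scheme.ord_zero]
    rfl
  obtain ⟨U, hU, hzU⟩ := exists_isAffineOpen_mem z
  haveI : Nonempty U := ⟨⟨z, hzU⟩⟩
  obtain ⟨_, _, hq⟩ := exists_algebra_affineOpen σ hσ hU
  rw [IsScalarTower.algebraMap_apply K Γ(W, U) W.functionField]
  exact Scheme.ord_of_isUnit ((IsUnit.mk0 c hc).map (algebraMap K Γ(W, U))) hzU

end FunctionField

section QuasiFinite

variable {K : Type u} [Field K]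

theorem quasiFinite_of_trdeg_le_one {B : Type u} [CommRing B] [IsDomain B] [Algebra K B]
    [Algebra K[X] B] [IsScalarTower K K[X] B] [Algebra.FiniteType K[X] B]
    (hinj : Function.Injective (algebraMap K[X] B)) (htr : Algebra.trdeg K B ≤ 1) :
    Algebra.QuasiFinite K[X] B := by
  haveI : FaithfulSMul K[X] B := (faithfulSMul_iff_algebraMap_injective _ _).mpr hinj
  haveI : Algebra.IsAlgebraic K[X] B := by
    rw [← trdeg_eq_zero_iff]
    have h1 := trdeg_add_eq K K[X] (A := B)
    rw [Polynomial.trdeg_of_isDomain] at h1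
    by_contra hne
    have h2 : (1 : Cardinal) ≤ Algebra.trdeg K[X] B := Cardinal.one_le_iff_ne_zero.mpr hne
    have h3 := (add_le_add_right h2 1).trans (h1.trans_le htr)
    norm_num [one_add_one_eq_two] at h3
  haveI : IsNoetherianRing B := Algebra.FiniteType.isNoetherianRing K[X] B
  haveI := krullDimLE_one_of_trdeg_le_one htr
  rw [Algebra.QuasiFinite.iff_finite_primesOver]
  intro I hI
  by_cases hI0 : I = ⊥
  · refine (Set.finite_singleton ⊥).subset fun P ⟨hP, hPI⟩ => ?_
    by_contra hP0
    obtain ⟨b, hb, hb0⟩ := Submodule.exists_mem_ne_zero_of_ne_bot hP0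
    obtain ⟨r, hr0, hr⟩ := (Algebra.IsAlgebraic.isAlgebraic (R := K[X]) b).exists_nonzero_dvd
      (mem_nonZeroDivisors_of_ne_zero hb0)
    have h1 : r ∈ I := by
      rw [hPI.over]
      exact P.mem_of_dvd hr hb
    rw [hI0] at h1
    exact hr0 h1
  · obtain ⟨f, hf, hf0⟩ := Submodule.exists_mem_ne_zero_of_ne_bot hI0
    have hf0' : algebraMap K[X] B f ≠ 0 := by rwa [Ne, map_eq_zero_iff _ hinj]
    refine (Ideal.finite_minimalPrimes_of_isNoetherianRing B
      (Ideal.span {algebraMap K[X] B f})).subset fun P ⟨hP, hPI⟩ => ?_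
    refine ⟨⟨hP, ?_⟩, fun Q ⟨hQ, hQf⟩ hQP => ?_⟩
    · rw [Ideal.span_singleton_le_iff_mem]
      have : f ∈ P.under K[X] := hPI.over ▸ hf
      exact this
    · have hQ0 : Q ≠ ⊥ := by
        rintro rfl
        exact hf0' (by simpa using hQf)
      have := hQ.isMaximal_of_ne_bot hQ0
      exact (this.eq_of_le hP.ne_top hQP).ge

/-- A morphism to the affine line from an integral scheme of dimension one is quasi-finite. -/
theorem locallyQuasiFinite_of_trdeg_le_one {Z : Scheme.{u}} [IsIntegral Z] {F : Type u} [Field F]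
    [Algebra K F] (htr : Algebra.trdeg K F ≤ 1) (f : Spec (.of F) ⟶ Z) [IsDominant f]
    (q : Z ⟶ Spec (.of K[X])) [LocallyOfFiniteType q] (s : F) (hs : Transcendental K s)
    (hq : f ≫ q = Spec.map (CommRingCat.ofHom (aeval (R := K) s).toRingHom)) :
    LocallyQuasiFinite q := by
  have key : ∀ (R : CommRingCat.{u}) (j : Spec R ⟶ Z) [IsOpenImmersion j],
      LocallyQuasiFinite (j ≫ q) := by
    intro R j _
    obtain ⟨φ, hφ⟩ := Spec.map_surjective (j ≫ q)
    have hft : LocallyOfFiniteType (j ≫ q) := inferInstance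
    rw [← hφ, HasRingHomProperty.Spec_iff (P := @LocallyOfFiniteType)] at hft
    rw [← hφ, HasRingHomProperty.Spec_iff (P := @LocallyQuasiFinite)]
    letI : Algebra K[X] R := φ.hom.toAlgebra
    haveI : Algebra.FiniteType K[X] R := hft
    change Algebra.QuasiFinite K[X] R
    rcases subsingleton_or_nontrivial R with hR | hR
    · infer_instance
    haveI : IsIntegral (Spec R) := isIntegral_of_isOpenImmersion j
    haveI : IsDomain R := (affine_isIntegral_iff R).mp inferInstance
    have hf : ∀ P, f P = genericPoint Z := fun P => by
      refine ((genericPoint_spec Z).eq ?_).symm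
      have h2 : Set.range f = {f P} := by
        ext x
        constructor
        · rintro ⟨P', rfl⟩
          rw [Set.mem_singleton_iff]
          exact congrArg f (Subsingleton.elim (α := PrimeSpectrum F) _ _)
        · rintro rfl
          exact ⟨_, rfl⟩
      rw [IsGenericPoint, ← h2]
      exact f.denseRange.closure_range
    have hrange : Set.range f ⊆ Set.range j := by
      rintro _ ⟨P, rfl⟩
      exact ⟨genericPoint (Spec R), by rw [hf, genericPoint_eq_of_isOpenImmersion]⟩
    obtain ⟨χ, hχ⟩ := Spec.map_surjective (IsOpenImmersion.lift j f hrange)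
    have hχj : Spec.map χ ≫ j = f := by rw [hχ, IsOpenImmersion.lift_fac]
    have hinj : Function.Injective χ.hom := by
      rw [RingHom.injective_iff_ker_eq_bot]
      let P : Spec (.of F) := (⊥ : PrimeSpectrum F)
      have h1 : Spec.map χ P = (⊥ : PrimeSpectrum R) := by
        rw [← genericPoint_eq_bot_of_affine]
        apply j.isOpenEmbedding.injective
        rw [genericPoint_eq_of_isOpenImmersion, ← Scheme.Hom.comp_apply, hχj, hf]
      exact congr_arg PrimeSpectrum.asIdeal h1
    have hcomp : χ.hom.comp φ.hom = (aeval (R := K) s).toRingHom := by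
      have : φ ≫ χ = CommRingCat.ofHom (aeval (R := K) s).toRingHom := by
        apply Spec.map_injective
        rw [Spec.map_comp, hφ, ← hq, ← Category.assoc, hχj]
      exact congr($(this).hom)
    letI : Algebra K R := (φ.hom.comp C).toAlgebra
    haveI : IsScalarTower K K[X] R := .of_algebraMap_eq' rfl
    let χ' : R →ₐ[K] F :=
      { χ.hom with
        commutes' := fun c => by
          have := congr($hcomp (C c))
          refine Eq.trans this ?_
          simp }
    refine quasiFinite_of_trdeg_le_one (K := K) ?_
      ((trdeg_le_of_injective χ' hinj).trans htr)
    refine Function.Injective.of_comp (f := χ.hom) ?_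
    have h3 : Function.Injective (χ.hom.comp φ.hom) := by
      rw [hcomp]
      exact transcendental_iff_injective.mp hs
    exact h3
  rw [HasRingHomProperty.iff_of_source_openCover (P := @LocallyQuasiFinite) Z.affineCover]
  intro i
  have h1 := key _ ((Z.affineCover.X i).isoSpec.inv ≫ Z.affineCover.f i)
  have h2 : LocallyQuasiFinite (Z.affineCover.f i ≫ q) := by
    have : LocallyQuasiFinite ((Z.affineCover.X i).isoSpec.hom ≫
      ((Z.affineCover.X i).isoSpec.inv ≫ Z.affineCover.f i) ≫ q) := inferInstance
    simpa using this
  exact HasRingHomProperty.iff_of_isAffine (P := @LocallyQuasiFinite) |>.mp h2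

end QuasiFinite

end

section

theorem injective_of_isDominant_SpecMap {A B : CommRingCat.{u}} [_root_.IsReduced A] (f : A ⟶ B)
    [IsDominant (Spec.map f)] : Function.Injective f.hom := by
  have h1 : DenseRange (PrimeSpectrum.comap f.hom) := (Spec.map f).denseRange
  rw [PrimeSpectrum.denseRange_comap_iff_ker_le_nilRadical, nilradical_eq_zero] at h1
  rw [RingHom.injective_iff_ker_eq_bot]
  exact le_bot_iff.mp h1

/-- A transcendental rational function `s` on a complete curve is a finite morphism to the affine
line from an affine curve that maps birationally to it. -/
theorem exists_finite_model {K : Type u} [Field K] {W : Scheme.{u}} [IsIntegral W]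
    (σ : W ⟶ Spec (.of K)) [IsProper σ] {F : Type u} [Field F] [Algebra K F]
    (f₁ : Spec (.of F) ⟶ W) (hσ : f₁ ≫ σ = Spec.map (CommRingCat.ofHom (algebraMap K F)))
    (htr : Algebra.trdeg K F ≤ 1) (s : F) (hs : Transcendental K s) :
    ∃ (D : Type u) (_ : CommRing D) (_ : IsDomain D) (_ : Algebra K D) (χ : D →ₐ[K] F) (t : D)
      (g : Spec (.of D) ⟶ W), Function.Injective χ ∧ χ t = s ∧
      (aeval (R := K) t).toRingHom.Finite ∧ Spec.map (CommRingCat.ofHom χ.toRingHom) ≫ g = f₁ ∧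
      g ≫ σ = Spec.map (CommRingCat.ofHom (algebraMap K D)) := by
  let a : Spec (.of K[X]) ⟶ Spec (.of K) := Spec.map (CommRingCat.ofHom C)
  let f₀ : Spec (.of F) ⟶ pullback σ a := pullback.lift f₁
    (Spec.map (CommRingCat.ofHom (aeval (R := K) s).toRingHom)) (by
      rw [hσ, ← Spec.map_comp, ← CommRingCat.ofHom_comp]
      congr 2
      ext x
      simp)
  haveI : QuasiCompact f₀ := by
    haveI : QuasiCompact (f₀ ≫ pullback.snd σ a) := by
      rw [pullback.lift_snd]; infer_instance
    exact QuasiCompact.of_comp f₀ (pullback.snd σ a)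
  let q := f₀.imageι ≫ pullback.snd σ a
  have hq : f₀.toImage ≫ q = Spec.map (CommRingCat.ofHom (aeval (R := K) s).toRingHom) := by
    rw [Scheme.Hom.toImage_imageι_assoc, pullback.lift_snd]
  haveI : LocallyQuasiFinite q :=
    locallyQuasiFinite_of_trdeg_le_one htr f₀.toImage q s hs hq
  haveI : IsProper q := inferInstance
  haveI : IsFinite q := IsFinite.of_isProper_of_locallyQuasiFinite q
  haveI : IsAffine f₀.image := isAffine_of_isAffineHom q
  let e := f₀.image.isoSpec
  let D : Type u := Γ(f₀.image, ⊤)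
  obtain ⟨φ, hφ⟩ := Spec.map_surjective (e.inv ≫ q)
  obtain ⟨χ, hχ⟩ := Spec.map_surjective (f₀.toImage ≫ e.hom)
  have hφfin : φ.hom.Finite := by
    have : IsFinite (e.inv ≫ q) := inferInstance
    rwa [← hφ, IsFinite.SpecMap_iff] at this
  haveI : IsDominant (Spec.map χ) := by rw [hχ]; infer_instance
  have hχinj : Function.Injective χ.hom := injective_of_isDominant_SpecMap χ
  have hcomp : φ ≫ χ = CommRingCat.ofHom (aeval (R := K) s).toRingHom := by
    apply Spec.map_injective
    rw [Spec.map_comp, hφ, hχ, ← hq, Category.assoc, Iso.hom_inv_id_assoc]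
  letI : Algebra K D := (φ.hom.comp C).toAlgebra
  let χ' : D →ₐ[K] F :=
    { χ.hom with
      commutes' := fun c => by
        have := congr($(hcomp).hom (C c))
        refine Eq.trans this ?_
        simp }
  have hD : ∀ p : K[X], aeval (R := K) (φ.hom X : D) p = φ.hom p := fun p => by
    have : (aeval (R := K) (φ.hom X : D)).toRingHom = φ.hom := by
      refine Polynomial.ringHom_ext (fun c => ?_) ?_
      · change aeval (R := K) (φ.hom X : D) (C c) = _
        rw [aeval_C]; rfl
      · exact aeval_X _
    exact congr($this p)
  refine ⟨D, inferInstance, Function.Injective.isDomain χ.hom hχinj, inferInstance, χ', φ.hom X,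
    e.inv ≫ f₀.imageι ≫ pullback.fst σ a, hχinj, ?_, ?_, ?_, ?_⟩
  · have := congr($(hcomp).hom X)
    refine Eq.trans this ?_
    simp
  · have : (aeval (R := K) (φ.hom X : D)).toRingHom = φ.hom := RingHom.ext hD
    rw [this]
    exact hφfin
  · change Spec.map χ ≫ _ = _
    rw [hχ, Category.assoc, Iso.hom_inv_id_assoc, Scheme.Hom.toImage_imageι_assoc,
      pullback.lift_fst]
  · have h1 : Spec.map (CommRingCat.ofHom (algebraMap K D)) = Spec.map φ ≫ a := by
      rw [← Spec.map_comp]; rfl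
    rw [h1, hφ]
    simp only [Category.assoc, q, pullback.condition]

end

section

attribute [local instance] smulCommClass_of_algebra

section PointDegree

variable {κ : Type u} [Field κ] {Y : Scheme.{u}} (ρ : Y ⟶ Spec (.of κ))

/-- The degree of a point that factors through a rational point. -/
theorem pointDegree_comp_of_section (r : Spec (.of κ) ⟶ Y) (hr : r ≫ ρ = 𝟙 _) {κ' : Type u}
    [Field κ'] [Algebra κ κ'] [Module.Finite κ κ'] :
    pointDegree (Spec.map (CommRingCat.ofHom (algebraMap κ κ')) ≫ r) = Module.finrank κ κ' := by
  obtain ⟨f, hf⟩ : ∃ f, f = Spec.map (CommRingCat.ofHom (algebraMap κ κ')) ≫ r := ⟨_, rfl⟩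
  rw [← hf]
  have hpt : f (IsLocalRing.closedPoint κ') = r (IsLocalRing.closedPoint κ) := by
    rw [hf]
    change r (Spec.map (CommRingCat.ofHom (algebraMap κ κ')) (IsLocalRing.closedPoint κ')) = _
    exact congr_arg r (Subsingleton.elim (α := PrimeSpectrum κ) _ _)
  let y := f (IsLocalRing.closedPoint κ')
  obtain ⟨θ, hθ⟩ : ∃ θ : Y.presheaf.stalk y ⟶ .of κ, Spec.map θ ≫ Y.fromSpecStalk y = r :=
    ⟨Y.presheaf.stalkSpecializes (specializes_of_eq hpt.symm) ≫ Scheme.stalkClosedPointTo r, by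
      rw [Spec.map_comp, Category.assoc,
        Scheme.SpecMap_stalkSpecializes_fromSpecStalk, Scheme.Spec_stalkClosedPointTo_fromSpecStalk]⟩
  have h1 : θ ≫ CommRingCat.ofHom (algebraMap κ κ') = Scheme.stalkClosedPointTo f := by
    apply Spec.map_injective
    rw [← cancel_mono (Y.fromSpecStalk y), Spec.map_comp, Category.assoc, hθ,
      Scheme.Spec_stalkClosedPointTo_fromSpecStalk, hf]
  obtain ⟨q, hq⟩ := Spec.map_surjective (Y.fromSpecStalk y ≫ ρ)
  have h2 : q ≫ θ = 𝟙 _ := by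
    apply Spec.map_injective
    rw [Spec.map_comp, hq, ← Category.assoc, hθ, hr, Spec.map_id]
  have hsurj : Function.Surjective θ.hom := fun x => ⟨q.hom x, congr($(h2).hom x)⟩
  letI := θ.hom.toAlgebra
  letI := (Scheme.stalkClosedPointTo f).hom.toAlgebra
  haveI : IsScalarTower (Y.presheaf.stalk y) κ κ' :=
    .of_algebraMap_eq' congr($(h1).hom).symm
  have h3 := Module.length_eq_of_surjective (S := Y.presheaf.stalk y) (R := κ) (M := κ') hsurj
  refine h3.trans ?_
  rw [Module.length_eq_finrank]

theorem pushPoint_of_section {f : Spec (.of κ) ⟶ Y} (hf : f ≫ ρ = 𝟙 _) :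
    pushPoint f = Finsupp.single (f (IsLocalRing.closedPoint κ)) 1 := by
  have h := pointDegree_comp_of_section ρ f hf (κ' := κ)
  have h1 : Spec.map (CommRingCat.ofHom (algebraMap κ κ)) ≫ f = f := by
    change Spec.map (𝟙 _) ≫ f = f
    rw [Spec.map_id, Category.id_comp]
  rw [h1, Module.finrank_self] at h
  rw [pushPoint, h]
  rfl

theorem Pt.comp_eq_id (f : Pt ρ κ) : f.1 ≫ ρ = 𝟙 _ := f.2.trans (Spec.map_id _)

end PointDegree

theorem exists_finset_span_eq_top {A D : Type*} [CommRing A] [CommRing D] [Algebra A D] (s : D)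
    (hfin : (aeval (R := A) s).toRingHom.Finite) :
    ∃ S : Finset D, Submodule.span A {x | ∃ (i : ℕ), ∃ d ∈ S, x = s ^ i * d} = ⊤ := by
  letI := (aeval (R := A) s).toRingHom.toAlgebra
  haveI : Module.Finite A[X] D := hfin
  obtain ⟨S, hS⟩ := Module.Finite.fg_top (R := A[X]) (M := D)
  refine ⟨S, eq_top_iff.mpr fun x _ => ?_⟩
  have hx : x ∈ Submodule.span A[X] (S : Set D) := hS ▸ trivial
  have smul_def : ∀ (f : A[X]) (y : D), f • y = aeval s f * y := fun f y => rfl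
  have hX : ∀ x ∈ Submodule.span A {x | ∃ (i : ℕ), ∃ d ∈ S, x = s ^ i * d},
      s * x ∈ Submodule.span A {x | ∃ (i : ℕ), ∃ d ∈ S, x = s ^ i * d} := fun x hx => by
    induction hx using Submodule.span_induction with
    | mem x hx =>
      obtain ⟨i, d, hd, rfl⟩ := hx
      exact Submodule.subset_span ⟨i + 1, d, hd, by rw [pow_succ', mul_assoc]⟩
    | zero => rw [mul_zero]; exact zero_mem _
    | add x y _ _ hx hy => rw [mul_add]; exact add_mem hx hy
    | smul a x _ hx => rw [mul_smul_comm]; exact Submodule.smul_mem _ _ hx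
  clear ‹x ∈ ⊤›
  induction hx using Submodule.span_induction with
  | mem x hx => exact Submodule.subset_span ⟨0, x, hx, by simp⟩
  | zero => exact zero_mem _
  | add x y _ _ hx hy => exact add_mem hx hy
  | smul p x _ hx =>
    rw [smul_def]
    induction p using Polynomial.induction_on' with
    | add p q hp hq => rw [map_add, add_mul]; exact add_mem hp hq
    | monomial n a =>
      rw [aeval_monomial, mul_assoc, ← Algebra.smul_def]
      refine Submodule.smul_mem _ _ ?_
      induction n with
      | zero => simpa using hx
      | succ n ih => rw [pow_succ', mul_assoc]; exact hX _ ih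

section Divisor

variable {K : Type u} [Field K] [IsAlgClosed K] {Y : Scheme.{u}} (ρ : Y ⟶ Spec (.of K))

theorem exists_triangulation {D : Type u} [CommRing D] [IsDomain D] [Algebra K D] {t : D}
    (hfin : (aeval (R := K) t).toRingHom.Finite) (ht : Transcendental K t) (c : K) :
    Nonempty (Triangulation K (t - algebraMap K D c)) := by
  have h0 : t - algebraMap K D c ≠ 0 := fun h =>
    ht (sub_eq_zero.mp h ▸ isAlgebraic_algebraMap c)
  haveI : Module.Finite K (D ⧸ Ideal.span {t - algebraMap K D c}) :=
    finite_quotient_of_aeval_mem hfin _ (X - C c) (X_sub_C_ne_zero c)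
      (by simpa using Ideal.mem_span_singleton_self _)
  obtain ⟨n, χ, e, h⟩ := exists_isTriangular (K := K) _ (Ideal.span {t - algebraMap K D c}) le_rfl
  exact Triangulation.exists_of_isTriangular (mem_nonZeroDivisors_of_ne_zero h0) h

theorem isFractionRing_of_finite_model {W : Scheme.{u}} [IsIntegral W] {D : Type u} [CommRing D]
    [IsDomain D] [Algebra D W.functionField]
    (hinj : Function.Injective (algebraMap D W.functionField)) (g : Spec (.of D) ⟶ W)
    (hg : Spec.map (CommRingCat.ofHom (algebraMap D W.functionField)) ≫ g =
      W.fromSpecStalk (genericPoint W)) : IsFractionRing D W.functionField := by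
  let E := FractionRing D
  haveI : FaithfulSMul D W.functionField := (faithfulSMul_iff_algebraMap_injective _ _).mpr hinj
  let ψ : E →+* W.functionField := IsFractionRing.lift (A := D) (K := E) hinj
  have hψ : ψ.comp (algebraMap D E) = algebraMap D W.functionField :=
    RingHom.ext fun x => IsFractionRing.lift_algebraMap hinj x
  have h1 : Spec.map (CommRingCat.ofHom ψ) ≫ Spec.map (CommRingCat.ofHom (algebraMap D E)) ≫ g =
      W.fromSpecStalk (genericPoint W) := by
    rw [← Category.assoc, ← Spec.map_comp, ← CommRingCat.ofHom_comp, hψ, hg]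
  haveI : IsDominant (W.fromSpecStalk (genericPoint W)) := by
    refine ⟨?_⟩
    have : genericPoint W ∈ Set.range (W.fromSpecStalk (genericPoint W)) :=
      ⟨IsLocalRing.closedPoint _, Scheme.fromSpecStalk_closedPoint⟩
    exact Dense.mono (Set.singleton_subset_iff.mpr this)
      (dense_iff_closure_eq.mpr (genericPoint_spec W).def)
  haveI : IsDominant (Spec.map (CommRingCat.ofHom (algebraMap D E)) ≫ g) := by
    haveI : IsDominant (Spec.map (CommRingCat.ofHom ψ) ≫
      Spec.map (CommRingCat.ofHom (algebraMap D E)) ≫ g) := by rw [h1]; infer_instance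
    exact IsDominant.of_comp (Spec.map (CommRingCat.ofHom ψ)) _
  obtain ⟨Φ, hΦ⟩ := exists_functionField_hom (Spec.map (CommRingCat.ofHom (algebraMap D E)) ≫ g)
  obtain ⟨a, ha⟩ : ∃ a : W.functionField ⟶ .of E, a = CommRingCat.ofHom Φ := ⟨_, rfl⟩
  obtain ⟨b, hb⟩ : ∃ b : .of E ⟶ W.functionField, b = CommRingCat.ofHom ψ := ⟨_, rfl⟩
  have h2 : a ≫ b = 𝟙 _ := by
    apply Spec.map_injective
    rw [← cancel_mono (W.fromSpecStalk (genericPoint W)), Spec.map_comp, Category.assoc, ha, hΦ, hb,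
      Spec.map_id, Category.id_comp, h1]
  refine IsFractionRing.of_field D W.functionField fun z => ?_
  obtain ⟨x, y, _, hxy⟩ := IsFractionRing.div_surjective D (Φ z)
  refine ⟨x, y, ?_⟩
  have h3 : ψ (Φ z) = z := by
    have := congr($(h2).hom z)
    rw [ha, hb] at this
    exact this
  rw [← h3, ← hxy, map_div₀, ← RingHom.comp_apply, ← RingHom.comp_apply, hψ]

/-- The closed point defined by a rational point. -/
def Pt.closedPoint {ρ : Y ⟶ Spec (.of K)} (f : Pt ρ K) : Y := f.1 (IsLocalRing.closedPoint K)

theorem Pt.closedPoint_injective [LocallyOfFiniteType ρ] :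
    Function.Injective (Pt.closedPoint : Pt ρ K → Y) := fun f g h =>
  Subtype.ext (ext_of_apply_closedPoint_eq ρ (f.comp_eq_id ρ) (g.comp_eq_id ρ) h)

theorem Pt.isClosed_closedPoint [LocallyOfFiniteType ρ] (f : Pt ρ K) : IsClosed {f.closedPoint} :=
  (pointEquivClosedPoint ρ ⟨f.1, f.comp_eq_id ρ⟩).2

variable {ρ} in
theorem sum_pushPoint_apply [LocallyOfFiniteType ρ] {D : Type u} [CommRing D] [Algebra K D] {t : D}
    (τ : Triangulation K t) (h : Pt ρ D) (f : Pt ρ K) :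
    (∑ i, pushPoint (Spec.map (CommRingCat.ofHom (τ.χ i).toRingHom) ≫ h.1)) f.closedPoint =
      τ.sumPt h f := by
  rw [Triangulation.sumPt, Finsupp.finset_sum_apply, Finsupp.finset_sum_apply]
  refine Finset.sum_congr rfl fun i _ => ?_
  have h1 := pushPoint_of_section ρ ((h.map ((τ.χ i).restrictScalars K)).comp_eq_id ρ)
  have h2 : (h.map ((τ.χ i).restrictScalars K)).1 =
    Spec.map (CommRingCat.ofHom (τ.χ i).toRingHom) ≫ h.1 := rfl
  rw [h2] at h1
  rw [h1]
  classical
  rw [Finsupp.single_apply, Finsupp.single_apply]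
  refine if_congr ?_ rfl rfl
  exact (Pt.closedPoint_injective ρ).eq_iff (a := h.map ((τ.χ i).restrictScalars K))

/-- The part of a principal divisor supported in the closed points is given by an elementary
rational equivalence. -/
theorem exists_homotopy_of_isDivisorOf [IsProper ρ] {W : Scheme.{u}} (i : W ⟶ Y)
    [IsClosedImmersion i] [IsIntegral W] [IsLocallyNoetherian W] (φ : W.functionField)
    {α : Cycles Y} (hα : IsDivisorOf i φ α) (f₀ : Pt ρ K) (hf₀ : α f₀.closedPoint ≠ 0) :
    ∃ H : Homotopy ρ K, ∀ f : Pt ρ K, α f.closedPoint = H.value f := by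
  obtain ⟨q, hq⟩ := Spec.map_surjective (W.fromSpecStalk (genericPoint W) ≫ i ≫ ρ)
  letI : Algebra K W.functionField := q.hom.toAlgebra
  have hσ : W.fromSpecStalk (genericPoint W) ≫ i ≫ ρ =
    Spec.map (CommRingCat.ofHom (algebraMap K W.functionField)) := hq.symm
  obtain ⟨z, hz⟩ : f₀.closedPoint ∈ Set.range i := by
    by_contra h
    exact hf₀ (hα.2 _ h)
  have hz0 : Scheme.ord φ z ≠ 0 := by rwa [← hα.1 z, hz]
  have hzc : IsClosed {z} := by
    have h1 : {z} = i ⁻¹' {f₀.closedPoint} := by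
      rw [← hz, ← Set.image_singleton, i.isClosedEmbedding.injective.preimage_image]
    rw [h1]
    exact (f₀.isClosed_closedPoint ρ).preimage i.continuous
  have htr := trdeg_functionField_le_one (i ≫ ρ) hσ z hzc (by
    by_contra h
    exact hz0 (Scheme.ord_eq_zero_of_coheight_neq_one h φ))
  have hφ : Transcendental K φ := fun h => by
    obtain ⟨c, hc⟩ := minpoly.mem_range_of_degree_eq_one K φ
      (IsAlgClosed.degree_eq_one_of_irreducible K (minpoly.irreducible h.isIntegral))
    rw [← hc] at hz0
    exact hz0 (ord_algebraMap_eq_zero (i ≫ ρ) hσ c z)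
  have hφ1 : φ - 1 ≠ 0 := fun h => hφ (sub_eq_zero.mp h ▸ isAlgebraic_one)
  have hs1 : φ / (φ - 1) - 1 = 1 / (φ - 1) := by field_simp; ring
  have hs : Transcendental K (φ / (φ - 1)) := fun h => by
    apply hφ
    have h1 : φ = (φ / (φ - 1)) / (φ / (φ - 1) - 1) := by rw [hs1]; field_simp
    rw [h1]
    rw [div_eq_mul_inv]
    exact IsAlgebraic.mul h (IsAlgebraic.inv (IsAlgebraic.sub h isAlgebraic_one))
  obtain ⟨D, _, _, _, χ, t, g, hinj, hχt, hfin, hg, hgσ⟩ :=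
    exists_finite_model (i ≫ ρ) _ hσ htr _ hs
  letI : Algebra D W.functionField := χ.toRingHom.toAlgebra
  haveI : IsScalarTower K D W.functionField := .of_algebraMap_eq' χ.comp_algebraMap.symm
  haveI : IsFractionRing D W.functionField := isFractionRing_of_finite_model hinj g hg
  have ht : Transcendental K t := fun h => hs (hχt ▸ h.algHom χ)
  obtain ⟨S, hS⟩ := exists_finset_span_eq_top t hfin
  obtain ⟨τ₀⟩ := exists_triangulation hfin ht 0
  obtain ⟨τ₁⟩ := exists_triangulation hfin ht 1
  rw [map_zero, sub_zero] at τ₀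
  rw [map_one] at τ₁
  let H : Homotopy ρ K :=
    { D := D
      s := t
      gen := S
      span_gen := hS
      pt := ⟨g ≫ i, by rw [Category.assoc]; exact hgσ⟩
      zero := τ₀
      one := τ₁ }
  refine ⟨H, fun f => ?_⟩
  have hρ : (g ≫ i) ≫ ρ = Spec.map (CommRingCat.ofHom (algebraMap K D)) := H.pt.2
  haveI : Infinite K := IsAlgClosed.instInfinite
  have hout : ∀ y ∉ Set.range i, ∀ (T : Type u) [CommRing T] [Algebra D T]
      [Algebra (Y.presheaf.stalk y) T], IsFiberRing (g ≫ i) y T → Subsingleton T :=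
    fun y hy T _ _ _ H => H.subsingleton_of_notMem (Set.range i) i.isClosedEmbedding.isClosed_range
      (fun P => ⟨g P, rfl⟩) hy
  obtain ⟨T, _, _, _, HT⟩ := exists_isFiberRing ρ (g ≫ i) f.closedPoint
  have hnorm : Algebra.norm W.functionField (algebraMap D W.functionField t /
      algebraMap D W.functionField (t - 1)) = φ := by
    have h1 : algebraMap D W.functionField t = φ / (φ - 1) := hχt
    rw [Algebra.norm_self, MonoidHom.id_apply, map_sub, map_one, h1, hs1]
    field_simp
  have hg' : Spec.map (CommRingCat.ofHom (algebraMap W.functionField W.functionField)) ≫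
      W.fromSpecStalk (genericPoint W) =
        Spec.map (CommRingCat.ofHom (algebraMap D W.functionField)) ≫ g := by
    refine Eq.trans ?_ hg.symm
    change Spec.map (𝟙 W.functionField) ≫ _ = _
    rw [Spec.map_id, Category.id_comp]
  have key : ∀ (y : Y) (T : Type u) [CommRing T] [Algebra D T] [Algebra (Y.presheaf.stalk y) T],
      IsFiberRing (g ≫ i) y T → ∃ a b : ℕ, Module.length (Y.presheaf.stalk y) (T ⧸ LinearMap.range
        (LinearMap.mulLeft (Y.presheaf.stalk y) (algebraMap D T t))) = a ∧
      Module.length (Y.presheaf.stalk y) (T ⧸ LinearMap.range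
        (LinearMap.mulLeft (Y.presheaf.stalk y) (algebraMap D T (t - 1)))) = b ∧
      α y = a - b := by
    intro y T _ _ _ HT
    by_cases hy : y ∈ Set.range i
    · obtain ⟨z, rfl⟩ := hy
      rw [hα.1, ← hnorm]
      exact HT.ord_norm_eq ρ i g hg' hρ t ht hfin z
    · have := hout y hy T HT
      exact ⟨0, 0, by simp, by simp, by simp [hα.2 y hy]⟩
  obtain ⟨a, b, ha, hb, hab⟩ := key _ T HT
  obtain ⟨m₀, hm₀, hm₀'⟩ := HT.length_tensor_quotient ρ hρ _ _ _ _ τ₀.isTriangular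
  obtain ⟨m₁, hm₁, hm₁'⟩ := HT.length_tensor_quotient ρ hρ _ _ _ _ τ₁.isTriangular
  rw [length_quot_range_mulLeft, hm₀] at ha
  rw [length_quot_range_mulLeft, hm₁] at hb
  rw [Homotopy.value, Finsupp.sub_apply, ← sum_pushPoint_apply, ← sum_pushPoint_apply, hab,
    ← Nat.cast_inj.mp ha, ← Nat.cast_inj.mp hb]
  exact congr_arg₂ _ hm₀'.symm hm₁'.symm

theorem comapDomain_mem_relations [IsProper ρ] {α : Cycles Y} (hα : α ∈ ratTrivial Y) :
    Finsupp.comapDomain Pt.closedPoint α (Pt.closedPoint_injective ρ).injOn ∈ relations ρ K := by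
  have : ratTrivial Y ≤ (relations ρ K).comap
      (Finsupp.comapDomain.addMonoidHom (Pt.closedPoint_injective ρ)) := by
    refine (AddSubgroup.closure_le _).mpr ?_
    rintro α ⟨W, i, _, _, _, φ, hφ, hα⟩
    change Finsupp.comapDomain _ _ _ ∈ relations ρ K
    by_cases h : ∃ f₀ : Pt ρ K, α f₀.closedPoint ≠ 0
    · obtain ⟨f₀, hf₀⟩ := h
      obtain ⟨H, hH⟩ := exists_homotopy_of_isDivisorOf ρ i φ hα f₀ hf₀
      refine AddSubgroup.subset_closure ⟨H, Finsupp.ext fun f => ?_⟩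
      rw [Finsupp.comapDomain_apply, hH]
    · push Not at h
      convert zero_mem (relations ρ K)
      exact Finsupp.ext fun f => h f
  exact this hα

end Divisor

end

section

theorem height_eq_of_isStandardSmooth {R S : Type u} [CommRing R] [CommRing S] [Algebra R S]
    (hR : IsField R) (n : ℕ) [Algebra.IsStandardSmoothOfRelativeDimension n R S] (m : Ideal S)
    [m.IsMaximal] : m.height = n := by
  letI := hR.toField
  obtain ⟨g, hg⟩ := Algebra.IsStandardSmoothOfRelativeDimension.exists_etale_mvPolynomial n R S
  letI := g.toRingHom.toAlgebra
  haveI : IsScalarTower R (MvPolynomial (Fin n) R) S := .of_algebraMap_eq' g.comp_algebraMap.symm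
  haveI : Algebra.Etale (MvPolynomial (Fin n) R) S := hg
  haveI : Module.Flat (MvPolynomial (Fin n) R) S := inferInstance
  haveI : Algebra.QuasiFinite (MvPolynomial (Fin n) R) S := inferInstance
  haveI : Algebra.FiniteType R S := Algebra.FiniteType.trans
    (S := MvPolynomial (Fin n) R) inferInstance inferInstance
  haveI : IsNoetherianRing S := Algebra.FiniteType.isNoetherianRing R S
  haveI : (m.under (MvPolynomial (Fin n) R)).IsMaximal := by
    letI := Ideal.Quotient.field m
    haveI : Module.Finite R (S ⧸ m) := finite_of_finite_type_of_isJacobsonRing R (S ⧸ m)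
    haveI : Algebra.IsIntegral (MvPolynomial (Fin n) R) (S ⧸ m) :=
      Algebra.IsIntegral.tower_top R
    have h : m.under (MvPolynomial (Fin n) R) =
        (⊥ : Ideal (S ⧸ m)).comap (algebraMap (MvPolynomial (Fin n) R) (S ⧸ m)) := by
      rw [IsScalarTower.algebraMap_eq (MvPolynomial (Fin n) R) S (S ⧸ m), ← Ideal.comap_comap,
        ← RingHom.ker_eq_comap_bot, Ideal.Quotient.algebraMap_eq, Ideal.mk_ker]
    rw [h]
    exact Ideal.isMaximal_comap_of_isIntegral_of_isMaximal (R := MvPolynomial (Fin n) R)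
      (⊥ : Ideal (S ⧸ m))
  rw [height_eq_height_under (R := MvPolynomial (Fin n) R), height_eq_of_isMaximal_mvPolynomial]

theorem coheight_eq_of_isClosed {K : Type u} [Field K] {Y : Scheme.{u}} (ρ : Y ⟶ Spec (.of K))
    (n : ℕ) [SmoothOfRelativeDimension n ρ] (y : Y) (hy : IsClosed {y}) : coheight y = n := by
  obtain ⟨U, hU, V, hV, hyV, e, h⟩ :=
    SmoothOfRelativeDimension.exists_isStandardSmoothOfRelativeDimension (n := n) (f := ρ) y
  obtain rfl : U = ⊤ := by
    refine eq_top_iff.mpr fun x _ => ?_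
    have : x = ρ y := Subsingleton.elim (α := PrimeSpectrum K) _ _
    rw [this]
    exact e hyV
  letI := (ρ.appLE ⊤ V e).hom.toAlgebra
  haveI : Algebra.IsStandardSmoothOfRelativeDimension n Γ(Spec (.of K), ⊤) Γ(Y, V) := h
  haveI := hV.primeIdealOf_isMaximal_of_isClosed ⟨y, hyV⟩ hy
  letI : Algebra Γ(Y, V) (Y.presheaf.stalk y) := (Y.presheaf.germ V y hyV).hom.toAlgebra
  haveI : IsLocalization.AtPrime (Y.presheaf.stalk y) (hV.primeIdealOf ⟨y, hyV⟩).asIdeal :=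
    hV.isLocalization_stalk ⟨y, hyV⟩
  have h1 := IsLocalization.AtPrime.ringKrullDim_eq_height (hV.primeIdealOf ⟨y, hyV⟩).asIdeal
    (Y.presheaf.stalk y)
  have hR : IsField Γ(Spec (.of K), ⊤) :=
    (Scheme.ΓSpecIso (.of K)).commRingCatIsoToRingEquiv.toMulEquiv.isField (Field.toIsField K)
  rw [ringKrullDim_stalk_eq_coheight,
    height_eq_of_isStandardSmooth hR n (hV.primeIdealOf ⟨y, hyV⟩).asIdeal] at h1
  exact_mod_cast h1

theorem residueDegree_eq_one {κ : Type u} [Field κ] {Y : Scheme.{u}} (ρ : Y ⟶ Spec (.of κ))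
    (r : Spec (.of κ) ⟶ Y) (hr : r ≫ ρ = 𝟙 _) :
    ρ.residueDegree (r (IsLocalRing.closedPoint κ)) = 1 := by
  set x : Spec (.of κ) := IsLocalRing.closedPoint κ
  have h1 : Function.Bijective ((r ≫ ρ).residueFieldMap x).hom := by
    generalize r ≫ ρ = g at hr
    subst hr
    rw [Scheme.residueFieldMap_id]
    exact Function.bijective_id
  rw [Scheme.residueFieldMap_comp] at h1
  have h2 : Function.Bijective (ρ.residueFieldMap (r x)).hom := by
    refine ⟨RingHom.injective _, fun b => ?_⟩
    obtain ⟨a, ha⟩ := h1.2 (r.residueFieldMap x b)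
    exact ⟨a, (r.residueFieldMap x).hom.injective ha⟩
  letI := (ρ.residueFieldMap (r x)).hom.toAlgebra
  change Module.finrank _ _ = 1
  exact Module.finrank_of_bijective_algebraMap h2

end

section

section Transfer

variable {k K : Type u} [Field k] [Field K] [Algebra k K] {X Y : Scheme.{u}}
  {π : X ⟶ Spec (.of k)} {p : Y ⟶ X} {ρ : Y ⟶ Spec (.of K)}

/-- The point of `X` over `k` underlying a point of its base change to `K`. -/
def Pt.descend (h : p ≫ π = ρ ≫ Spec.map (CommRingCat.ofHom (algebraMap k K)))
    {A : Type u} [CommRing A] [Algebra K A] [Algebra k A] [IsScalarTower k K A] (f : Pt ρ A) :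
    Pt π A :=
  ⟨f.1 ≫ p, by
    rw [Category.assoc, h, ← Category.assoc, f.2, ← Spec.map_comp, ← CommRingCat.ofHom_comp,
      ← IsScalarTower.algebraMap_eq]⟩

theorem mapDomain_descend_mem_relations
    (h : p ≫ π = ρ ≫ Spec.map (CommRingCat.ofHom (algebraMap k K))) {c : Pt ρ K →₀ ℤ}
    (hc : c ∈ relations ρ K) : Finsupp.mapDomain (Pt.descend h) c ∈ relations π K := by
  have : relations ρ K ≤ (relations π K).comap
      (Finsupp.mapDomain.addMonoidHom (Pt.descend h)) := by
    refine (AddSubgroup.closure_le _).mpr ?_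
    rintro _ ⟨@⟨D, iD, a, a', tower, s, gen, span_gen, pt, zero, one⟩, rfl⟩
    obtain rfl : a = a' := Algebra.algebra_ext _ _ fun x =>
      (@IsScalarTower.algebraMap_apply K K D _ _ _ _ a a' tower x).symm
    letI : Algebra k D := Algebra.compHom _ (algebraMap k K)
    haveI : IsScalarTower k K D := .of_algebraMap_eq fun _ => rfl
    refine AddSubgroup.subset_closure ⟨⟨D, s, gen, span_gen, pt.descend h, zero, one⟩, ?_⟩
    have key : ∀ (t : D) (τ : Triangulation K t), (τ.sumPt (pt.descend h) : Pt π K →₀ ℤ) =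
        Finsupp.mapDomain (Pt.descend h) (τ.sumPt pt) := fun t τ => by
      rw [Triangulation.sumPt, Triangulation.sumPt, Finsupp.mapDomain_finset_sum]
      refine Finset.sum_congr rfl fun i _ => ?_
      rw [Finsupp.mapDomain_single]
      congr 1
    exact (congr_arg₂ _ (key s zero) (key (s - 1) one)).trans (Finsupp.mapDomain_sub ..).symm
  exact this hc

variable [IsAlgClosed K]

theorem single_sub_single_mem_relations (sq : IsPullback p ρ π
      (Spec.map (CommRingCat.ofHom (algebraMap k K)))) [IsProper ρ] (f g : Pt π K)
    (h : (Finsupp.single (f.lift sq (IsLocalRing.closedPoint K)) 1 -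
      Finsupp.single (g.lift sq (IsLocalRing.closedPoint K)) 1 : Cycles Y) ∈ ratTrivial Y) :
    (Finsupp.single f 1 - Finsupp.single g 1 : Pt π K →₀ ℤ) ∈ relations π K := by
  have h1 := mapDomain_descend_mem_relations sq.w (comapDomain_mem_relations ρ h)
  let f' : Pt ρ K := ⟨f.lift sq, f.lift_snd sq⟩
  let g' : Pt ρ K := ⟨g.lift sq, g.lift_snd sq⟩
  have key : Finsupp.comapDomain Pt.closedPoint
      (Finsupp.single (f.lift sq (IsLocalRing.closedPoint K)) 1 -
      Finsupp.single (g.lift sq (IsLocalRing.closedPoint K)) 1 : Cycles Y)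
      (Pt.closedPoint_injective ρ).injOn = Finsupp.single f' 1 - Finsupp.single g' 1 := by
    refine Finsupp.ext fun x => ?_
    rw [Finsupp.comapDomain_apply, Finsupp.sub_apply, Finsupp.sub_apply]
    have : ∀ y : Pt ρ K, (Finsupp.single y.closedPoint 1 : Cycles Y) x.closedPoint =
        Finsupp.single y 1 x := fun y => by
      classical
      rw [Finsupp.single_apply, Finsupp.single_apply]
      exact if_congr (Pt.closedPoint_injective ρ).eq_iff rfl rfl
    exact congr_arg₂ _ (this f') (this g')
  rw [key, Finsupp.mapDomain_sub, Finsupp.mapDomain_single, Finsupp.mapDomain_single] at h1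
  have e : ∀ x : Pt π K, Pt.descend sq.w ⟨x.lift sq, x.lift_snd sq⟩ = x := fun x =>
    Subtype.ext (x.lift_fst sq)
  rwa [e, e] at h1

/-- If `CH²(X_K)₀ = 0` then any two `K`-points are elementarily equivalent. -/
theorem single_sub_single_mem_relations_of_chow (π : X ⟶ Spec (.of k)) [IsProper π]
    [SmoothOfRelativeDimension 2 π]
    (hCH : chowTwoDegreeZero (pullback.snd π (Spec.map (CommRingCat.ofHom (algebraMap k K)))) = ⊥)
    (f g : Pt π K) :
    (Finsupp.single f 1 - Finsupp.single g 1 : Pt π K →₀ ℤ) ∈ relations π K := by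
  let sq := IsPullback.of_hasPullback π (Spec.map (CommRingCat.ofHom (algebraMap k K)))
  refine single_sub_single_mem_relations sq f g ?_
  haveI : SmoothOfRelativeDimension 2
      (pullback.snd π (Spec.map (CommRingCat.ofHom (algebraMap k K)))) :=
    (smoothOfRelativeDimension_isStableUnderBaseChange 2).of_isPullback sq ‹_›
  set ρ := pullback.snd π (Spec.map (CommRingCat.ofHom (algebraMap k K))) with hρ
  have hlift : ∀ x : Pt π K, x.lift sq ≫ ρ = 𝟙 _ := fun x =>
    Pt.comp_eq_id ρ ⟨x.lift sq, x.lift_snd sq⟩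
  have hcl : ∀ x : Pt π K, coheight (x.lift sq (IsLocalRing.closedPoint K)) = 2 := fun x =>
    coheight_eq_of_isClosed ρ 2 _
      (Pt.isClosed_closedPoint ρ (⟨x.lift sq, x.lift_snd sq⟩ : Pt ρ K))
  set α : Cycles (pullback π (Spec.map (CommRingCat.ofHom (algebraMap k K)))) :=
    Finsupp.single (f.lift sq (IsLocalRing.closedPoint K)) 1 -
      Finsupp.single (g.lift sq (IsLocalRing.closedPoint K)) 1
  have hα : α ∈ codimCycles 2 _ ⊓ (cycleDegree ρ).ker := by
    have hs : ∀ x : Pt π K, Finsupp.single (x.lift sq (IsLocalRing.closedPoint K)) 1 ∈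
        codimCycles 2 (pullback π (Spec.map (CommRingCat.ofHom (algebraMap k K)))) := by
      intro x y hy
      rw [(Finsupp.single_apply_ne_zero.mp hy).1]
      exact hcl x
    refine ⟨AddSubgroup.sub_mem _ (hs f) (hs g), ?_⟩
    · change cycleDegree ρ α = 0
      rw [map_sub, cycleDegree, Finsupp.liftAddHom_apply_single,
        Finsupp.liftAddHom_apply_single]
      simp [residueDegree_eq_one _ _ (hlift _)]
  have h0 : cycleClass _ α ∈ chowTwoDegreeZero ρ := ⟨α, hα, rfl⟩
  rw [hCH, AddSubgroup.mem_bot] at h0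
  exact (QuotientAddGroup.eq_zero_iff _).mp h0

end Transfer

end

section

section RationalPoint

variable {k κ : Type u} [Field k] [IsAlgClosed k] [Field κ] [Algebra k κ] {X Y : Scheme.{u}}
  {π : X ⟶ Spec (.of k)} {p : Y ⟶ X} {ρ : Y ⟶ Spec (.of κ)}
  (sq : IsPullback p ρ π (Spec.map (CommRingCat.ofHom (algebraMap k κ))))

/-- The base change of a rational point. -/
abbrev Pt.const (x : Pt π k) (κ : Type u) [CommRing κ] [Algebra k κ] : Pt π κ :=
  x.map (Algebra.ofId k κ)

omit [IsAlgClosed k] in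
theorem isPullback_lift_const (x : Pt π k) :
    IsPullback ((x.const κ).lift sq) (Spec.map (CommRingCat.ofHom (algebraMap k κ))) p x.1 := by
  have h := IsPullback.of_right (h₁₁ := (x.const κ).lift sq) (h₁₂ := ρ) (h₂₁ := x.1) (h₂₂ := π)
    (v₁₁ := Spec.map (CommRingCat.ofHom (algebraMap k κ))) (v₁₂ := p)
    (v₁₃ := Spec.map (CommRingCat.ofHom (algebraMap k κ))) ?_ ?_ sq.flip
  · exact h
  · rw [Pt.comp_eq_id ρ ⟨(x.const κ).lift sq, (x.const κ).lift_snd sq⟩, x.comp_eq_id π]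
    exact IsPullback.of_horiz_isIso ⟨by simp⟩
  · rw [Pt.lift_fst]
    rfl

variable [LocallyOfFiniteType π]

theorem map_maximalIdeal_lift_const (x : Pt π k) :
    (IsLocalRing.maximalIdeal (X.presheaf.stalk
      (p ((x.const κ).lift sq (IsLocalRing.closedPoint κ))))).map
        (p.stalkMap ((x.const κ).lift sq (IsLocalRing.closedPoint κ))).hom =
      IsLocalRing.maximalIdeal (Y.presheaf.stalk _) := by
  set r := (x.const κ).lift sq with hr
  set y : Y := r (IsLocalRing.closedPoint κ) with hy
  have hpy : p y = x.closedPoint := by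
    change (r ≫ p) _ = _
    rw [hr, Pt.lift_fst]
    exact congr_arg x.1 (Subsingleton.elim (α := PrimeSpectrum k) _ _)
  set I := (IsLocalRing.maximalIdeal (X.presheaf.stalk (p y))).map (p.stalkMap y).hom with hI
  refine le_antisymm ?_ fun s hs => ?_
  · exact ((IsLocalRing.local_hom_TFAE (p.stalkMap y).hom).out 0 2).mp
      (inferInstance : IsLocalHom (p.stalkMap y).hom)
  let q : Y.presheaf.stalk y ⟶ .of (Y.presheaf.stalk y ⧸ I) :=
    CommRingCat.ofHom (Ideal.Quotient.mk I)
  let δ : X.residueField (p y) ⟶ .of (Y.presheaf.stalk y ⧸ I) :=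
    CommRingCat.ofHom (Ideal.Quotient.lift (IsLocalRing.maximalIdeal (X.presheaf.stalk (p y)))
      ((Ideal.Quotient.mk I).comp (p.stalkMap y).hom) fun a ha =>
        Ideal.Quotient.eq_zero_iff_mem.mpr (Ideal.mem_map_of_mem _ ha))
  have hδ : X.residue (p y) ≫ δ = p.stalkMap y ≫ q := rfl
  have hcl : IsClosed {p y} := hpy ▸ x.isClosed_closedPoint π
  have hx : pointOfClosedPoint π (p y) hcl = x.1 :=
    ext_of_apply_closedPoint_eq π (pointOfClosedPoint_comp ..) (x.comp_eq_id π)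
      ((pointOfClosedPoint_apply ..).trans hpy)
  have hx' : X.fromSpecResidueField (p y) =
      Spec.map (residueFieldIsoBase π (p y) hcl).inv ≫ x.1 := by
    rw [← hx, pointOfClosedPoint, ← Category.assoc, ← Spec.map_comp, Iso.hom_inv_id, Spec.map_id,
      Category.id_comp]
  have hw : (Spec.map q ≫ Y.fromSpecStalk y) ≫ p =
      (Spec.map δ ≫ Spec.map (residueFieldIsoBase π (p y) hcl).inv) ≫ x.1 := by
    rw [Category.assoc, Category.assoc, ← hx', ← Scheme.SpecMap_stalkMap_fromSpecStalk,
      Scheme.fromSpecResidueField, ← Category.assoc, ← Category.assoc, ← Spec.map_comp,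
      ← Spec.map_comp, hδ]
  have sq' := isPullback_lift_const sq x
  obtain ⟨γ, hγ⟩ := Spec.map_surjective (sq'.lift _ _ hw)
  have h1 : Spec.map γ ≫ r = Spec.map q ≫ Y.fromSpecStalk y := by
    rw [hγ]; exact sq'.lift_fst _ _ hw
  have h2 : Spec.map (Scheme.stalkClosedPointTo r) ≫ Y.fromSpecStalk y = r :=
    Scheme.Spec_stalkClosedPointTo_fromSpecStalk r
  rw [← h2, ← Category.assoc, cancel_mono, ← Spec.map_comp] at h1
  have h3 := congr_arg (fun f => f.hom s) (Spec.map_injective h1)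
  refine Ideal.Quotient.eq_zero_iff_mem.mp (h3.symm.trans ?_)
  change γ.hom ((Scheme.stalkClosedPointTo r).hom s) = 0
  have h4 : (Scheme.stalkClosedPointTo r).hom s = 0 := by
    by_contra h5
    exact hs ((isUnit_map_iff (Scheme.stalkClosedPointTo r).hom s).mp (Ne.isUnit h5))
  rw [h4, map_zero]

theorem pullbackMultiplicity_lift_const (x : Pt π k) :
    pullbackMultiplicity p ((x.const κ).lift sq (IsLocalRing.closedPoint κ)) = 1 := by
  rw [pullbackMultiplicity, map_maximalIdeal_lift_const]
  rw [Module.length_eq_one_iff.mpr]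
  · rfl
  · exact isSimpleModule_iff_isCoatom.mpr (IsLocalRing.maximalIdeal.isMaximal _).out

theorem isFlatPullback_const (x : Pt π k) (N : ℕ) :
    IsFlatPullback p (N • Finsupp.single x.closedPoint 1)
      (N • Finsupp.single ((x.const κ).lift sq (IsLocalRing.closedPoint κ)) 1) := by
  intro y
  have sq' := isPullback_lift_const sq x
  have hpy : p ((x.const κ).lift sq (IsLocalRing.closedPoint κ)) = x.closedPoint := by
    change ((x.const κ).lift sq ≫ p) _ = _
    rw [Pt.lift_fst]
    exact congr_arg x.1 (Subsingleton.elim (α := PrimeSpectrum k) _ _)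
  by_cases h : p y = x.closedPoint
  · obtain rfl : y = (x.const κ).lift sq (IsLocalRing.closedPoint κ) := by
      have h1 : y ∈ Set.range ((x.const κ).lift sq) := by
        obtain ⟨z, hz, -⟩ := Scheme.Pullback.exists_preimage_pullback (f := p) (g := x.1) y
          (IsLocalRing.closedPoint k) h
        refine ⟨sq'.isoPullback.inv z, ?_⟩
        rw [← hz, ← Scheme.Hom.comp_apply, sq'.isoPullback_inv_fst]
      obtain ⟨a, rfl⟩ := h1
      exact congr_arg _ (Subsingleton.elim (α := PrimeSpectrum κ) _ _)
    rw [pullbackMultiplicity_lift_const, h]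
    simp
  · rw [Finsupp.smul_apply, Finsupp.smul_apply, Finsupp.single_eq_of_ne, Finsupp.single_eq_of_ne]
    · simp
    · exact h
    · rintro rfl
      exact h hpy

end RationalPoint

end

section

section Specialization

variable {R : Type u} [CommRing R]

theorem nontrivial_tensor_of_isIntegral (T κ : Type u) [CommRing T] [Algebra R T]
    [Algebra.IsIntegral R T] (hT : Function.Injective (algebraMap R T)) [Field κ] [Algebra R κ] :
    Nontrivial (κ ⊗[R] T) := by
  obtain ⟨P, hP⟩ : ∃ P : PrimeSpectrum R, P.asIdeal = RingHom.ker (algebraMap R κ) :=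
    ⟨⟨_, RingHom.ker_isPrime _⟩, rfl⟩
  have h1 : P ∈ Set.range (PrimeSpectrum.comap (algebraMap R T)) := by
    obtain ⟨Q, hQ, h⟩ := Ideal.exists_ideal_over_prime_of_isIntegral P.asIdeal (⊥ : Ideal T)
      (by rw [← RingHom.ker_eq_comap_bot, (RingHom.injective_iff_ker_eq_bot _).mp hT]; exact bot_le)
    exact ⟨⟨Q, h.1⟩, PrimeSpectrum.ext h.2⟩
  haveI := (PrimeSpectrum.nontrivial_iff_mem_rangeComap P).mpr h1
  letI : Algebra P.asIdeal.ResidueField κ :=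
    (Ideal.ResidueField.lift P.asIdeal (algebraMap R κ) hP.le fun a ha =>
      Ne.isUnit fun h => ha (hP.ge (RingHom.mem_ker.mpr h))).toAlgebra
  haveI : IsScalarTower R P.asIdeal.ResidueField κ := .of_algebraMap_eq fun r => by
    exact (Ideal.ResidueField.lift_algebraMap ..).symm
  haveI : Nontrivial (κ ⊗[P.asIdeal.ResidueField] (P.asIdeal.ResidueField ⊗[R] T)) := inferInstance
  exact (Algebra.TensorProduct.cancelBaseChange R P.asIdeal.ResidueField κ κ
    T).injective.nontrivial

/-- A homomorphism from `R` to a field extends to a finite extension `T` of `R`, after a finite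
extension of bounded degree of the field. -/
theorem exists_extension_of_finite {T : Type u} [CommRing T] [Algebra R T]
    (hT : Function.Injective (algebraMap R T)) (s : Finset T)
    (hs : Submodule.span R (s : Set T) = ⊤) (κ : Type u) [Field κ] (φ : R →+* κ) :
    ∃ (κ' : Type u) (_ : Field κ') (_ : Algebra κ κ') (g : T →+* κ'), Module.Finite κ κ' ∧
      Module.finrank κ κ' ≤ s.card ∧ ∀ r, g (algebraMap R T r) = algebraMap κ κ' (φ r) := by
  letI := φ.toAlgebra
  haveI : Module.Finite R T := ⟨s, hs⟩
  haveI := nontrivial_tensor_of_isIntegral T κ hT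
  obtain ⟨m, hm⟩ := Ideal.exists_maximal (κ ⊗[R] T)
  letI := Ideal.Quotient.field m
  refine ⟨(κ ⊗[R] T) ⧸ m, inferInstance, inferInstance, (Ideal.Quotient.mk m).comp
    (Algebra.TensorProduct.includeRight : T →ₐ[R] κ ⊗[R] T).toRingHom, inferInstance, ?_,
      fun r => ?_⟩
  · refine (LinearMap.finrank_le_finrank_of_surjective
      (f := (Ideal.Quotient.mkₐ κ m).toLinearMap) (Ideal.Quotient.mk_surjective)).trans ?_
    classical
    have h1 : Submodule.span κ ((s.image fun t => (1 : κ) ⊗ₜ[R] t : Finset (κ ⊗[R] T)) :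
        Set (κ ⊗[R] T)) = ⊤ := by
      rw [Finset.coe_image]
      have := Submodule.baseChange_span (A := κ) (R := R) (s : Set T)
      rw [hs, Submodule.baseChange_top] at this
      exact this.symm
    rw [← finrank_top, ← h1]
    exact (finrank_span_finset_le_card _).trans Finset.card_image_le
  · change Ideal.Quotient.mk m (1 ⊗ₜ algebraMap R T r) = _
    rw [Algebra.algebraMap_eq_smul_one, TensorProduct.tmul_smul, TensorProduct.smul_tmul', Algebra.smul_def,
      mul_one]
    rfl

variable [IsDomain R] {K : Type u} [Field K] [Algebra R K] [FaithfulSMul R K]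
  [Algebra.IsAlgebraic R K]

/-- A finitely generated algebra, generically finite over a domain `R`, has points in field
extensions of bounded degree over all points in a nonempty open subset of `Spec R`. -/
theorem exists_extension_adjoin (S : Finset K) : ∃ f : R, f ≠ 0 ∧ ∃ N : ℕ,
    ∀ (κ : Type u) [Field κ] (φ : R →+* κ), φ f ≠ 0 →
      ∃ (κ' : Type u) (_ : Field κ') (_ : Algebra κ κ')
        (ψ : Algebra.adjoin R (S : Set K) →+* κ'), Module.Finite κ κ' ∧
        Module.finrank κ κ' ≤ N ∧ ∀ r, ψ (algebraMap R _ r) = algebraMap κ κ' (φ r) := by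
  obtain ⟨f, hf, hS⟩ := Algebra.IsAlgebraic.exists_integral_multiples R S
  classical
  let T := Algebra.adjoin R ((S.image fun a => f • a : Finset K) : Set K)
  haveI : Module.Finite R T := by
    refine Module.Finite.iff_fg.mpr (fg_adjoin_of_finite (Finset.finite_toSet _) fun x hx => ?_)
    obtain ⟨a, ha, rfl⟩ := Finset.mem_image.mp (Finset.mem_coe.mp hx)
    exact hS a ha
  obtain ⟨s, hs⟩ := Module.Finite.fg_top (R := R) (M := T)
  have hinj : Function.Injective (algebraMap R T) := FaithfulSMul.algebraMap_injective R T
  refine ⟨f, hf, s.card, fun κ _ φ hφ => ?_⟩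
  obtain ⟨κ', _, _, g, h1, h2, h3⟩ := exists_extension_of_finite hinj s hs κ φ
  refine ⟨κ', inferInstance, inferInstance, ?_⟩
  let L := Localization.Away (algebraMap R T f)
  have hfK : algebraMap R K f ≠ 0 := fun h => hf
    ((FaithfulSMul.algebraMap_injective R K) (h.trans (map_zero _).symm))
  let ι : L →ₐ[R] K := IsLocalization.liftAlgHom (M := Submonoid.powers (algebraMap R T f))
    (f := T.val) (by
      rintro ⟨_, n, rfl⟩
      rw [map_pow]
      exact (Ne.isUnit hfK).pow n)
  have hι : ∀ t : T, ι (algebraMap T L t) = t := fun t => by simp [ι]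
  have hιinj : Function.Injective ι := by
    refine (injective_iff_map_eq_zero ι).mpr fun x hx => ?_
    obtain ⟨⟨t, c⟩, h⟩ := IsLocalization.surj (Submonoid.powers (algebraMap R T f)) x
    have ht : t = 0 := Subtype.ext (by rw [← hι t, ← h, map_mul, hx, zero_mul]; rfl)
    rw [ht, map_zero] at h
    exact (IsLocalization.map_units L c).mul_left_eq_zero.mp h
  have hle : Algebra.adjoin R (S : Set K) ≤ ι.range := by
    refine Algebra.adjoin_le fun a ha => ?_
    obtain ⟨v, hv⟩ := (IsLocalization.Away.algebraMap_isUnit (S := L)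
      (algebraMap R T f)).exists_right_inv
    have hv' := congr_arg ι hv
    rw [map_mul, hι, map_one] at hv'
    let b : T := ⟨f • a, Algebra.subset_adjoin (Finset.mem_coe.mpr (Finset.mem_image_of_mem _ ha))⟩
    refine ⟨v * algebraMap T L b, mul_left_cancel₀ hfK ?_⟩
    change algebraMap R K f * ι _ = _
    rw [map_mul, hι, ← mul_assoc, ← Algebra.smul_def f a]
    exact (congr_arg (· * (b : K)) hv').trans (one_mul _)
  let γ : L →+* κ' := IsLocalization.Away.lift (algebraMap R T f) (g := g) (by
    rw [h3]
    exact (Ne.isUnit hφ).map _)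
  let e := (AlgEquiv.ofInjective ι hιinj).symm
  refine ⟨γ.comp ((e : ι.range →ₐ[R] L).comp (Subalgebra.inclusion hle)).toRingHom, h1, h2,
    fun r => ?_⟩
  change γ ((e : ι.range →ₐ[R] L).comp (Subalgebra.inclusion hle) (algebraMap R _ r)) = _
  rw [AlgHom.commutes, IsScalarTower.algebraMap_apply R T L, IsLocalization.Away.lift_eq, h3]

end Specialization

end

section

section Bounded

variable {k : Type u} [Field k] {X : Scheme.{u}} {π : X ⟶ Spec (.of k)}

/-- The point `ξ` is equivalent to the constant point `x` after a field extension of degree at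
most `N`. -/
def IsConstantUpTo (x : Pt π k) (N : ℕ) {κ : Type u} [Field κ] [Algebra k κ] (ξ : Pt π κ) : Prop :=
  ∃ (κ' : Type u) (_ : Field κ') (_ : Algebra k κ') (_ : Algebra κ κ') (_ : IsScalarTower k κ κ'),
    Module.Finite κ κ' ∧ Module.finrank κ κ' ≤ N ∧
      (Finsupp.single (ξ.map (IsScalarTower.toAlgHom k κ κ')) 1 - Finsupp.single (x.const κ') 1 :
        Pt π κ' →₀ ℤ) ∈ relations π κ'

theorem IsConstantUpTo.mono {x : Pt π k} {N N' : ℕ} {κ : Type u} [Field κ] [Algebra k κ]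
    {ξ : Pt π κ} (h : IsConstantUpTo x N ξ) (hN : N ≤ N') : IsConstantUpTo x N' ξ := by
  obtain ⟨κ', h1, h2, h3, h4, h5, h6, h7⟩ := h
  exact ⟨κ', h1, h2, h3, h4, h5, h6.trans hN, h7⟩

theorem Pt.const_map (x : Pt π k) {A B : Type u} [CommRing A] [Algebra k A] [CommRing B]
    [Algebra k B] (φ : A →ₐ[k] B) : (x.const A).map φ = x.const B := by
  rw [Pt.const, Pt.map_map]
  congr 1
  exact Subsingleton.elim _ _

theorem exists_isConstantUpTo_of_point [IsProper π] [SmoothOfRelativeDimension 2 π]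
    (hCH : ∀ (K : Type u) [Field K] [Algebra k K] [IsAlgClosed K],
      chowTwoDegreeZero (pullback.snd π (Spec.map (CommRingCat.ofHom (algebraMap k K)))) = ⊥)
    (x : Pt π k) {R : Type u} [CommRing R] [Algebra k R] [Algebra.FiniteType k R] (u : Pt π R)
    (P : Ideal R) [P.IsPrime] :
    ∃ f ∉ P, ∃ N : ℕ, ∀ (κ : Type u) [Field κ] [Algebra k κ] (φ : R →ₐ[k] κ),
      P ≤ RingHom.ker φ → φ f ≠ 0 → IsConstantUpTo x N (u.map φ) := by
  haveI : Smooth π := SmoothOfRelativeDimension.smooth 2 π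
  let K := AlgebraicClosure (FractionRing (R ⧸ P))
  haveI : Algebra.IsAlgebraic (R ⧸ P) (FractionRing (R ⧸ P)) :=
    IsLocalization.isAlgebraic _ (nonZeroDivisors (R ⧸ P))
  haveI : Algebra.IsAlgebraic (R ⧸ P) K :=
    Algebra.IsAlgebraic.trans (R ⧸ P) (FractionRing (R ⧸ P)) K
  haveI : FaithfulSMul (R ⧸ P) K := (faithfulSMul_iff_algebraMap_injective _ _).mpr <| by
    rw [IsScalarTower.algebraMap_eq (R ⧸ P) (FractionRing (R ⧸ P)) K]
    exact (algebraMap (FractionRing (R ⧸ P)) K).injective.comp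
      (IsFractionRing.injective (R ⧸ P) (FractionRing (R ⧸ P)))
  let g : R →ₐ[k] K := (IsScalarTower.toAlgHom k (R ⧸ P) K).comp (Ideal.Quotient.mkₐ k P)
  have h1 := exists_relations_of_mem
    (single_sub_single_mem_relations_of_chow π (hCH K) (u.map g) (x.const K))
  obtain ⟨s, hs⟩ := Algebra.FiniteType.out (R := k) (A := R)
  have h2 : ∀ᶠ A : FGSubalgebra k K in Filter.atTop, ∀ r ∈ s, g r ∈ A.1 :=
    (Filter.eventually_all_finset _).mpr fun r _ => eventually_mem_fgSubalgebra _
  obtain ⟨⟨A, S, hS⟩, ⟨c, hc, hc'⟩, hA⟩ := (h1.and h2).exists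
  dsimp only at c hc hc' hA
  have hgA : ∀ r, g r ∈ A := by
    have : Algebra.adjoin k (s : Set R) ≤ A.comap g := Algebra.adjoin_le hA
    exact fun r => this (hs ▸ trivial)
  let j : R →ₐ[k] A := g.codRestrict A hgA
  have hc'' : c = Finsupp.single (u.map j) 1 - Finsupp.single (x.const A) 1 := by
    refine Finsupp.mapDomain_injective (Pt.map_injective A.val Subtype.val_injective) ?_
    rw [hc', Finsupp.mapDomain_sub, Finsupp.mapDomain_single, Finsupp.mapDomain_single,
      Pt.const_map, Pt.map_map]
    rfl
  obtain ⟨f, hf, N, hN⟩ := exists_extension_adjoin (R := R ⧸ P) S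
  obtain ⟨f, rfl⟩ := Ideal.Quotient.mk_surjective f
  refine ⟨f, fun h => hf (Ideal.Quotient.eq_zero_iff_mem.mpr h), N, fun κ _ _ φ hφ hφf => ?_⟩
  obtain ⟨κ', _, _, ψ, h3, h4, h5⟩ := hN κ (Ideal.Quotient.lift P φ.toRingHom hφ) hφf
  letI : Algebra k κ' := Algebra.compHom _ (algebraMap k κ)
  haveI : IsScalarTower k κ κ' := .of_algebraMap_eq fun _ => rfl
  have hle : A ≤ (Algebra.adjoin (R ⧸ P) (S : Set K)).restrictScalars k := by
    rw [← hS]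
    exact Algebra.adjoin_le Algebra.subset_adjoin
  let i : A →+* Algebra.adjoin (R ⧸ P) (S : Set K) := (Subalgebra.inclusion hle).toRingHom
  have hi : ∀ r, ψ (i (j r)) = algebraMap κ κ' (φ r) := fun r => h5 (Ideal.Quotient.mk P r)
  let ψ' : A →ₐ[k] κ' :=
    { ψ.comp i with
      commutes' a := by
        have := hi (algebraMap k R a)
        rw [AlgHom.commutes, AlgHom.commutes] at this
        exact this }
  have h6 := mapDomain_mem_relations ψ' hc
  rw [hc'', Finsupp.mapDomain_sub, Finsupp.mapDomain_single, Finsupp.mapDomain_single,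
    Pt.const_map, Pt.map_map] at h6
  refine ⟨κ', inferInstance, inferInstance, inferInstance, inferInstance, h3, h4, ?_⟩
  rw [Pt.map_map]
  have h7 : (IsScalarTower.toAlgHom k κ κ').comp φ = ψ'.comp j :=
    AlgHom.ext fun r => (hi r).symm
  rwa [h7]

/-- The point of a scheme underlying a point with values in a field. -/
def Pt.image {κ : Type u} [Field κ] [Algebra k κ] (ξ : Pt π κ) : X :=
  ξ.1 (IsLocalRing.closedPoint κ)

theorem exists_isConstantUpTo_of_mem_closure [IsProper π] [SmoothOfRelativeDimension 2 π]
    (hCH : ∀ (K : Type u) [Field K] [Algebra k K] [IsAlgClosed K],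
      chowTwoDegreeZero (pullback.snd π (Spec.map (CommRingCat.ofHom (algebraMap k K)))) = ⊥)
    (x : Pt π k) (y : X) :
    ∃ U : X.Opens, y ∈ U ∧ ∃ N : ℕ, ∀ (κ : Type u) [Field κ] [Algebra k κ] (ξ : Pt π κ),
      ξ.image ∈ U → y ⤳ ξ.image → IsConstantUpTo x N ξ := by
  obtain ⟨V, hV, hyV⟩ := exists_isAffineOpen_mem y
  obtain ⟨q, hq⟩ := Spec.map_surjective (hV.fromSpec ≫ π)
  letI : Algebra k Γ(X, V) := q.hom.toAlgebra
  haveI : Algebra.FiniteType k Γ(X, V) := by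
    have : LocallyOfFiniteType (hV.fromSpec ≫ π) := inferInstance
    rw [← hq, HasRingHomProperty.Spec_iff (P := @LocallyOfFiniteType)] at this
    exact this
  let u : Pt π Γ(X, V) := ⟨hV.fromSpec, hq.symm⟩
  obtain ⟨P, hP⟩ : y ∈ Set.range hV.fromSpec := hV.range_fromSpec ▸ hyV
  haveI : P.asIdeal.IsPrime := PrimeSpectrum.isPrime P
  obtain ⟨f, hf, N, hN⟩ := exists_isConstantUpTo_of_point hCH x u P.asIdeal
  refine ⟨hV.fromSpec ''ᵁ (PrimeSpectrum.basicOpen f), ⟨P, hf, hP⟩, N, fun κ _ _ ξ hU hy => ?_⟩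
  have hr : Set.range ξ.1 ⊆ Set.range hV.fromSpec := by
    rintro _ ⟨a, rfl⟩
    obtain ⟨b, -, hb⟩ := hU
    refine ⟨b, hb.trans ?_⟩
    exact congr_arg ξ.1 (Subsingleton.elim (α := PrimeSpectrum κ) _ _)
  obtain ⟨φ, hφ⟩ := Spec.map_surjective (IsOpenImmersion.lift hV.fromSpec ξ.1 hr)
  have hφ' : Spec.map φ ≫ hV.fromSpec = ξ.1 := by rw [hφ, IsOpenImmersion.lift_fac]
  let φ' : Γ(X, V) →ₐ[k] κ :=
    { φ.hom with
      commutes' a := by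
        have h1 : Spec.map (CommRingCat.ofHom (algebraMap k κ)) = Spec.map (q ≫ φ) := by
          rw [← ξ.2, ← hφ', Category.assoc, ← hq, Spec.map_comp]
        exact (congr_arg (fun h => h.hom a) (Spec.map_injective h1)).symm }
  have hξ : u.map φ' = ξ := Subtype.ext hφ'
  let Q : PrimeSpectrum Γ(X, V) := Spec.map φ (IsLocalRing.closedPoint κ)
  have hQ : hV.fromSpec Q = ξ.image := by
    rw [Pt.image, ← hφ']
    rfl
  have hQ' : ∀ r, r ∈ Q.asIdeal ↔ φ r = 0 := fun r => by
    change φ r ∈ IsLocalRing.maximalIdeal κ ↔ _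
    rw [IsLocalRing.maximalIdeal_eq_bot, Ideal.mem_bot]
  rw [← hξ]
  refine hN κ φ' ?_ ?_
  · rw [← hP, ← hQ, hV.fromSpec.isOpenEmbedding.isInducing.specializes_iff] at hy
    have hPQ := (PrimeSpectrum.le_iff_specializes P Q).mpr hy
    exact fun r hr => (hQ' r).mp (hPQ hr)
  · obtain ⟨b, hb, hb'⟩ := hU
    rw [← hQ] at hb'
    obtain rfl := hV.fromSpec.isOpenEmbedding.injective hb'
    exact fun h => hb ((hQ' f).mpr h)

theorem exists_isConstantUpTo [IsProper π] [SmoothOfRelativeDimension 2 π]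
    (hCH : ∀ (K : Type u) [Field K] [Algebra k K] [IsAlgClosed K],
      chowTwoDegreeZero (pullback.snd π (Spec.map (CommRingCat.ofHom (algebraMap k K)))) = ⊥)
    (x : Pt π k) :
    ∃ N : ℕ, ∀ (κ : Type u) [Field κ] [Algebra k κ] (ξ : Pt π κ), IsConstantUpTo x N ξ := by
  haveI : IsLocallyNoetherian X := LocallyOfFiniteType.isLocallyNoetherian π
  haveI : CompactSpace X := QuasiCompact.compactSpace_of_compactSpace π
  haveI : IsNoetherian X := ⟨⟩
  suffices h : ∀ Z : TopologicalSpace.Closeds X, ∃ N : ℕ, ∀ (κ : Type u) [Field κ] [Algebra k κ]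
      (ξ : Pt π κ), ξ.image ∈ Z → IsConstantUpTo x N ξ by
    obtain ⟨N, hN⟩ := h ⊤
    exact ⟨N, fun κ _ _ ξ => hN κ ξ trivial⟩
  intro Z
  induction Z using WellFoundedLT.induction with
  | ind Z ih =>
  by_cases hZ : (Z : Set X).Nonempty; swap
  · exact ⟨0, fun κ _ _ ξ h => (hZ ⟨_, h⟩).elim⟩
  by_cases hirr : IsPreirreducible (Z : Set X)
  · obtain ⟨y, hy⟩ := QuasiSober.sober (S := (Z : Set X)) ⟨hZ, hirr⟩ Z.isClosed
    obtain ⟨U, hyU, N, hN⟩ := exists_isConstantUpTo_of_mem_closure hCH x y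
    have hyZ : y ∈ Z := hy.mem
    obtain ⟨N', hN'⟩ := ih (Z ⊓ ⟨_, U.isOpen.isClosed_compl⟩)
      (lt_of_le_of_ne inf_le_left fun h => (h.ge hyZ).2 hyU)
    refine ⟨max N N', fun κ _ _ ξ h => ?_⟩
    by_cases hU : ξ.image ∈ U
    · exact (hN κ ξ hU (hy.specializes h)).mono (le_max_left _ _)
    · exact (hN' κ ξ ⟨h, hU⟩).mono (le_max_right _ _)
  · rw [isPreirreducible_iff_isClosed_union_isClosed] at hirr
    push Not at hirr
    obtain ⟨Z₁, Z₂, h₁, h₂, h, hn₁, hn₂⟩ := hirr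
    obtain ⟨N₁, hN₁⟩ := ih (Z ⊓ ⟨Z₁, h₁⟩)
      (lt_of_le_of_ne inf_le_left fun h => hn₁ fun z hz => (h.ge hz).2)
    obtain ⟨N₂, hN₂⟩ := ih (Z ⊓ ⟨Z₂, h₂⟩)
      (lt_of_le_of_ne inf_le_left fun h => hn₂ fun z hz => (h.ge hz).2)
    refine ⟨max N₁ N₂, fun κ _ _ ξ hξ => ?_⟩
    rcases h hξ with h | h
    · exact (hN₁ κ ξ ⟨hξ, h⟩).mono (le_max_left _ _)
    · exact (hN₂ κ ξ ⟨hξ, h⟩).mono (le_max_right _ _)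

end Bounded

end

section

section Projective

attribute [local instance] MvPolynomial.gradedAlgebra

theorem isProper_projectiveSpaceToSpec (n : ℕ) (k : Type u) [Field k] :
    IsProper (projectiveSpaceToSpec n k) := by
  haveI : IsScalarTower k (MvPolynomial.homogeneousSubmodule (Fin (n + 1)) k 0)
      (MvPolynomial (Fin (n + 1)) k) :=
    ⟨fun a b c => smul_mul_assoc a (b : MvPolynomial (Fin (n + 1)) k) c⟩
  haveI : Algebra.FiniteType (MvPolynomial.homogeneousSubmodule (Fin (n + 1)) k 0)
      (MvPolynomial (Fin (n + 1)) k) :=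
    Algebra.FiniteType.of_restrictScalars_finiteType k _ _
  haveI : IsClosedImmersion (Spec.map (CommRingCat.ofHom
      (algebraMap k (MvPolynomial.homogeneousSubmodule (Fin (n + 1)) k 0)))) := by
    refine IsClosedImmersion.spec_of_surjective _ fun ⟨a, ha⟩ => ?_
    rw [MvPolynomial.homogeneousSubmodule_zero] at ha
    obtain ⟨c, hc⟩ := Submodule.mem_one.mp ha
    exact ⟨c, Subtype.ext hc⟩
  unfold projectiveSpaceToSpec
  exact MorphismProperty.comp_mem _ _ _ (inferInstance : IsProper (Proj.toSpecZero _)) inferInstance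

theorem IsProjective.isProper {k : Type u} [Field k] {X : Scheme.{u}} {π : X ⟶ Spec (.of k)}
    (h : IsProjective π) : IsProper π := by
  obtain ⟨n, i, hi, rfl⟩ := h
  haveI := isProper_projectiveSpaceToSpec n k
  infer_instance

end Projective

section Order

variable {k : Type u} [Field k] [IsAlgClosed k] {X : Scheme.{u}} {π : X ⟶ Spec (.of k)}
  [IsProper π] [SmoothOfRelativeDimension 2 π]

/-- The base changes of a point that is constant up to an extension of degree `N`: some multiple
by a positive integer bounded by `N` is rationally equivalent to a constant cycle. -/
theorem IsConstantUpTo.exists_smul_pointClass {x : Pt π k} {N : ℕ} {κ : Type u} [Field κ]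
    [Algebra k κ] {ξ : Pt π κ} (h : IsConstantUpTo x N ξ) {Y : Scheme.{u}} {p : Y ⟶ X}
    {ρ : Y ⟶ Spec (.of κ)} (sq : IsPullback p ρ π (Spec.map (CommRingCat.ofHom (algebraMap k κ)))) :
    ∃ m : ℕ, 0 < m ∧ m ≤ N ∧
      m • pointClass (ξ.lift sq (IsLocalRing.closedPoint κ)) ∈ pullbackImage 2 p := by
  obtain ⟨κ', _, _, _, _, _, hN, hrel⟩ := h
  haveI : Infinite k := IsAlgClosed.instInfinite
  haveI : Infinite κ := Infinite.of_injective _ (algebraMap k κ).injective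
  have h1 := pushForward_mem_ratTrivial sq κ' hrel
  have hpush : ∀ ζ : Pt π κ, pushForward sq κ'
      (Finsupp.single (ζ.map (IsScalarTower.toAlgHom k κ κ')) 1) =
        Module.finrank κ κ' • Finsupp.single (ζ.lift sq (IsLocalRing.closedPoint κ)) 1 := by
    intro ζ
    have e : (ζ.map (IsScalarTower.toAlgHom k κ κ')).lift sq =
        Spec.map (CommRingCat.ofHom (algebraMap κ κ')) ≫ ζ.lift sq :=
      ζ.map_lift sq (Algebra.ofId κ κ')
    rw [pushForward_single, e, pushPoint, pointDegree_comp_of_section ρ _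
      (Pt.comp_eq_id ρ ⟨ζ.lift sq, ζ.lift_snd sq⟩), Finsupp.smul_single]
    congr 1
    · exact congr_arg (ζ.lift sq) (Subsingleton.elim (α := PrimeSpectrum κ) _ _)
    · simp
  rw [← x.const_map (IsScalarTower.toAlgHom k κ κ'), map_sub, hpush, hpush] at h1
  refine ⟨Module.finrank κ κ', Module.finrank_pos, hN,
    Module.finrank κ κ' • Finsupp.single x.closedPoint 1, ?_, _,
    isFlatPullback_const sq x (Module.finrank κ κ'), ?_⟩
  · refine AddSubgroup.nsmul_mem _ (fun y hy => ?_) _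
    rw [(Finsupp.single_apply_ne_zero.mp hy).1]
    exact coheight_eq_of_isClosed π 2 _ (x.isClosed_closedPoint π)
  · rw [pointClass, ← map_nsmul]
    exact ((QuotientAddGroup.eq_iff_sub_mem).mpr h1).symm

end Order

end

end SurfaceCycles

end

theorem uniform_bound_on_ccc_order
    {k : Type u} [Field k] [IsAlgClosed k] {X : Scheme.{u}} (π : X ⟶ Spec (.of k))
    (hX : SurfaceCycles.IsSmoothProjectiveSurface π)
    (hpg : SurfaceCycles.GeometricGenusEqZero π)
    (hq : SurfaceCycles.IrregularityEqZero X)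
    (hCH : ∀ (K : Type u) [Field K] [Algebra k K] [IsAlgClosed K],
      SurfaceCycles.chowTwoDegreeZero
        (pullback.snd π (Spec.map (CommRingCat.ofHom (algebraMap k K)))) = ⊥) :
    ∃ n : ℕ, 0 < n ∧ ∀ (D : Scheme.{u}) (j : D ⟶ X), SurfaceCycles.IsCurve j →
      SurfaceCycles.IsConstantCycleOfOrderLE π j n := by
  obtain ⟨_, _, hproj⟩ := hX
  haveI := hproj.isProper
  haveI : JacobsonSpace X := LocallyOfFiniteType.jacobsonSpace π
  obtain ⟨x, -, hx⟩ := nonempty_inter_closedPoints (X := X) (Z := Set.univ) Set.univ_nonempty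
    isOpen_univ.isLocallyClosed
  let x' : SurfaceCycles.Pt π k := ⟨pointOfClosedPoint π x hx,
    (pointOfClosedPoint_comp π x hx).trans (Spec.map_id _).symm⟩
  obtain ⟨N, hN⟩ := SurfaceCycles.exists_isConstantUpTo hCH x'
  refine ⟨N + 1, N.succ_pos, fun D j _ C _ c _ _ => ?_⟩
  obtain ⟨q, hq⟩ := Spec.map_surjective (SurfaceCycles.genericMap (c ≫ j) ≫ π)
  letI : Algebra k C.functionField := q.hom.toAlgebra
  let ξ : SurfaceCycles.Pt π C.functionField := ⟨SurfaceCycles.genericMap (c ≫ j), hq.symm⟩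
  have sq : IsPullback (SurfaceCycles.genericBaseChangeFst π (c ≫ j))
      (pullback.snd π (SurfaceCycles.genericMap (c ≫ j) ≫ π)) π
      (Spec.map (CommRingCat.ofHom (algebraMap k C.functionField))) := by
    have : ∀ g, g = SurfaceCycles.genericMap (c ≫ j) ≫ π →
        IsPullback (SurfaceCycles.genericBaseChangeFst π (c ≫ j))
          (pullback.snd π (SurfaceCycles.genericMap (c ≫ j) ≫ π)) π g := by
      rintro _ rfl
      exact IsPullback.of_hasPullback _ _
    exact this _ hq
  obtain ⟨m, hm, hmN, h⟩ := (hN C.functionField ξ).exists_smul_pointClass sq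
  have hξ : ξ.lift sq = SurfaceCycles.genericSection π (c ≫ j) := by
    refine sq.hom_ext ?_ ?_
    · exact (ξ.lift_fst sq).trans (pullback.lift_fst _ _ _).symm
    · exact (ξ.lift_snd sq).trans ((Spec.map_id _).trans (pullback.lift_snd _ _ _).symm)
  rw [hξ] at h
  classical
  have hne : ∃ m : ℕ, 0 < m ∧
      m • SurfaceCycles.pointClass (SurfaceCycles.genericPointOfCurve π (c ≫ j)) ∈
        SurfaceCycles.pullbackImage 2 (SurfaceCycles.genericBaseChangeFst π (c ≫ j)) := ⟨m, hm, h⟩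
  exact ⟨Nat.find hne, (Nat.find_min' hne ⟨hm, h⟩).trans (hmN.trans N.le_succ),
    Nat.find_spec hne, fun a ha => Nat.find_min' hne ha⟩
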